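/- Let 1 ≤ p < ∞ and 0 < q, r < ∞ with r < p ≤ q, and let u, v, w be weights on (a,b). Then there exists a finite constant C > 0 such that the inequality (∫_a^b (∫_a^x (∫_a^t f(s) ds)^q u(t) dt)^{r/q} w(x) dx)^{1/r} ≤ C (∫_a^b f(x)^p v(x) dx)^{1/p} holds for all f ∈ 𝔐⁺(a,b) if and only if both C₂ := (∫_a^b (∫_x^b w)^{r/(p-r)} w(x) · ess sup_{t∈(a,x)} (∫_t^x u)^{rp/(q(p-r))} V_p(a,t)^{pr/(p-r)} dx)^{(p-r)/(pr)} < ∞ and C₃ := (∫_a^b (∫_x^b w(s) (∫_x^s u)^{r/q} ds)^{r/(p-r)} w(x) · ess sup_{t∈(a,x)} (∫_t^x u)^{r/q} V_p(a,t)^{pr/(p-r)} dx)^{(p-r)/(pr)} < ∞. Moreover, the best constant C in the inequality satisfies C ≈ C₂ + C₃. -/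

import Mathlib

open MeasureTheory Set ENNReal

noncomputable section

/-- The open interval `(a, b)` with extended-real endpoints, viewed as a set of reals. -/
def io (a b : EReal) : Set ℝ := {x : ℝ | a < (x : EReal) ∧ (x : EReal) < b}

/-- A weight on `(a, b)`: a measurable function which is positive and finite on `(a, b)`. -/
def IsWeight (a b : EReal) (u : ℝ → ℝ≥0∞) : Prop :=
  Measurable u ∧ ∀ x ∈ io a b, 0 < u x ∧ u x < ⊤

/-- `V_p(x, y)` from the paper. -/
def Vp (p : ℝ) (v : ℝ → ℝ≥0∞) (x y : EReal) : ℝ≥0∞ :=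
  if p = 1 then essSup (fun s => (v s)⁻¹) (volume.restrict (io x y))
  else (∫⁻ s in io x y, v s ^ (-(1 / (p - 1)))) ^ ((p - 1) / p)

/-- The left-hand side of the iterated Hardy inequality. -/
def lhsIter (a b : EReal) (q r : ℝ) (u w f : ℝ → ℝ≥0∞) : ℝ≥0∞ :=
  (∫⁻ x in io a b,
    (∫⁻ t in io a x, (∫⁻ s in io a t, f s) ^ q * u t) ^ (r / q) * w x) ^ (1 / r)

/-- The right-hand side (without the constant) of the iterated Hardy inequality. -/
def rhsNorm (a b : EReal) (p : ℝ) (v f : ℝ → ℝ≥0∞) : ℝ≥0∞ :=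
  (∫⁻ x in io a b, f x ^ p * v x) ^ (1 / p)

/-- The best constant in the iterated Hardy inequality. -/
def bestIter (a b : EReal) (p q r : ℝ) (u v w : ℝ → ℝ≥0∞) : ℝ≥0∞ :=
  sInf {C : ℝ≥0∞ | ∀ f : ℝ → ℝ≥0∞, Measurable f →
    lhsIter a b q r u w f ≤ C * rhsNorm a b p v f}

/-- The constant `C₂`. -/
def C2 (a b : EReal) (p q r : ℝ) (u v w : ℝ → ℝ≥0∞) : ℝ≥0∞ :=
  (∫⁻ x in io a b, (∫⁻ t in io x b, w t) ^ (r / (p - r)) * w x *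
      essSup (fun t : ℝ =>
          (∫⁻ s in io t x, u s) ^ (r * p / (q * (p - r))) * Vp p v a t ^ (p * r / (p - r)))
        (volume.restrict (io a x))) ^ ((p - r) / (p * r))

/-- The constant `C₃`. -/
def C3 (a b : EReal) (p q r : ℝ) (u v w : ℝ → ℝ≥0∞) : ℝ≥0∞ :=
  (∫⁻ x in io a b,
      (∫⁻ s in io x b, w s * (∫⁻ σ in io x s, u σ) ^ (r / q)) ^ (r / (p - r)) * w x *
      essSup (fun t : ℝ =>
          (∫⁻ s in io t x, u s) ^ (r / q) * Vp p v a t ^ (p * r / (p - r)))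
        (volume.restrict (io a x))) ^ ((p - r) / (p * r))

/-- The integral of `f` over the interval `(s, t)`. -/
def seg (f : ℝ → ℝ≥0∞) (s t : EReal) : ℝ≥0∞ := ∫⁻ x in io s t, f x

lemma measurableSet_io (a b : EReal) : MeasurableSet (io a b) :=
  (measurableSet_lt measurable_const measurable_coe_real_ereal).inter
    (measurableSet_lt measurable_coe_real_ereal measurable_const)

lemma io_subset_io {a a' b b' : EReal} (ha : a' ≤ a) (hb : b ≤ b') : io a b ⊆ io a' b' :=
  fun _ hx => ⟨ha.trans_lt hx.1, hx.2.trans_le hb⟩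

lemma io_eq_empty {a b : EReal} (h : b ≤ a) : io a b = ∅ := by
  ext x
  simp only [io, mem_ofPred_eq, mem_empty_iff_false, iff_false, not_and, not_lt]
  intro h1
  exact h.trans h1.le

lemma seg_eq_zero {f : ℝ → ℝ≥0∞} {a b : EReal} (h : b ≤ a) : seg f a b = 0 := by
  simp [seg, io_eq_empty h]

lemma seg_mono_set (f : ℝ → ℝ≥0∞) {a a' b b' : EReal} (ha : a' ≤ a) (hb : b ≤ b') :
    seg f a b ≤ seg f a' b' :=
  lintegral_mono_set (io_subset_io ha hb)

lemma seg_mono {f g : ℝ → ℝ≥0∞} {a b : EReal} (h : ∀ x ∈ io a b, f x ≤ g x) :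
    seg f a b ≤ seg g a b :=
  setLIntegral_mono' (measurableSet_io a b) h

lemma volume_coe_fiber (t : EReal) : volume {x : ℝ | (x : EReal) = t} = 0 := by
  apply Set.Subsingleton.measure_zero
  intro x hx y hy
  simp only [mem_ofPred_eq] at hx hy
  exact_mod_cast hx.trans hy.symm

lemma seg_le_add (f : ℝ → ℝ≥0∞) (s t z : EReal) : seg f s z ≤ seg f s t + seg f t z := by
  have h : io s z ⊆ (io s t ∪ {x : ℝ | (x : EReal) = t}) ∪ io t z := by
    intro x hx
    rcases lt_trichotomy (x : EReal) t with h | h | h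
    · exact Or.inl (Or.inl ⟨hx.1, h⟩)
    · exact Or.inl (Or.inr h)
    · exact Or.inr ⟨h, hx.2⟩
  calc seg f s z ≤ ∫⁻ x in (io s t ∪ {x : ℝ | (x : EReal) = t}) ∪ io t z, f x :=
        lintegral_mono_set h
    _ ≤ (∫⁻ x in io s t ∪ {x : ℝ | (x : EReal) = t}, f x) + seg f t z := lintegral_union_le _ _ _
    _ ≤ ((∫⁻ x in io s t, f x) + ∫⁻ x in {x : ℝ | (x : EReal) = t}, f x) + seg f t z := by
        gcongr
        exact lintegral_union_le _ _ _
    _ = seg f s t + seg f t z := by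
        rw [setLIntegral_measure_zero _ _ (volume_coe_fiber t), add_zero]
        rfl

/-- A decreasing sequence of endpoints tending to `a` splits `(a, x 0)` into blocks. -/
lemma seg_le_tsum (f : ℝ → ℝ≥0∞) (a : EReal) (x : ℕ → EReal)
    (h : ∀ t : ℝ, a < t → ∃ n, x n ≤ t) :
    seg f a (x 0) ≤ ∑' j, seg f (x (j + 1)) (x j) := by
  have hsub : io a (x 0) ⊆ (⋃ j, io (x (j + 1)) (x j)) ∪ ⋃ j, {t : ℝ | (t : EReal) = x j} := by
    intro t ht
    have hex := h t ht.1
    classical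
    set n := Nat.find hex with hn
    have h1 : x n ≤ t := Nat.find_spec hex
    rcases h1.eq_or_lt with h2 | h2
    · exact Or.inr (mem_iUnion.2 ⟨n, h2.symm⟩)
    · left
      cases hc : n with
      | zero => rw [hc] at h1; exact absurd ht.2 (not_lt.2 h1)
      | succ m =>
        rw [hc] at h2
        refine mem_iUnion.2 ⟨m, h2, ?_⟩
        exact not_le.1 (Nat.find_min hex (by omega))
  calc seg f a (x 0)
      ≤ ∫⁻ t in (⋃ j, io (x (j + 1)) (x j)) ∪ ⋃ j, {t : ℝ | (t : EReal) = x j}, f t :=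
        lintegral_mono_set hsub
    _ ≤ (∫⁻ t in ⋃ j, io (x (j + 1)) (x j), f t) + ∫⁻ t in ⋃ j, {t : ℝ | (t : EReal) = x j}, f t :=
        lintegral_union_le _ _ _
    _ = ∫⁻ t in ⋃ j, io (x (j + 1)) (x j), f t := by
        have h0 : ∫⁻ t in ⋃ j, {t : ℝ | (t : EReal) = x j}, f t = 0 :=
          setLIntegral_measure_zero _ _ (measure_iUnion_null fun j => volume_coe_fiber (x j))
        rw [h0, add_zero]
    _ ≤ _ := lintegral_iUnion_le _ _

lemma io_nonempty_pos {a b : EReal} (h : a < b) : 0 < volume (io a b) := by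
  obtain ⟨c, hc1, hc2⟩ := EReal.lt_iff_exists_real_btwn.1 h
  obtain ⟨d, hd1, hd2⟩ := EReal.lt_iff_exists_real_btwn.1 hc2
  have : Ioo c d ⊆ io a b := fun x hx =>
    ⟨hc1.trans (by exact_mod_cast hx.1), lt_trans (by exact_mod_cast hx.2) hd2⟩
  refine lt_of_lt_of_le ?_ (measure_mono this)
  simp only [Real.volume_Ioo, ENNReal.ofReal_pos, sub_pos]
  exact_mod_cast hd1

lemma seg_pos {u : ℝ → ℝ≥0∞} (hu : Measurable u) {a b : EReal} (h : a < b)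
    (hpos : ∀ x ∈ io a b, 0 < u x) : 0 < seg u a b := by
  rw [seg, setLIntegral_pos_iff hu]
  have : Function.support u ∩ io a b = io a b :=
    inter_eq_right.2 fun x hx => (hpos x hx).ne'
  rw [this]
  exact io_nonempty_pos h

lemma seg_monotone_right (f : ℝ → ℝ≥0∞) (a : EReal) : Monotone fun t => seg f a t :=
  fun _ _ h => seg_mono_set f le_rfl h

lemma seg_antitone_left (f : ℝ → ℝ≥0∞) (b : EReal) : Antitone fun t => seg f t b :=
  fun _ _ h => seg_mono_set f h le_rfl

lemma measurable_seg_left (f : ℝ → ℝ≥0∞) (a : EReal) : Measurable fun t => seg f a t :=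
  (seg_monotone_right f a).measurable

lemma measurable_seg {α : Type*} [MeasurableSpace α] {f : ℝ → ℝ≥0∞} (hf : Measurable f)
    {x y : α → EReal} (hx : Measurable x) (hy : Measurable y) :
    Measurable fun i => seg f (x i) (y i) := by
  have hset : MeasurableSet {z : α × ℝ | x z.1 < z.2 ∧ (z.2 : EReal) < y z.1} :=
    (measurableSet_lt (hx.comp measurable_fst)
      (measurable_coe_real_ereal.comp measurable_snd)).inter
      (measurableSet_lt (measurable_coe_real_ereal.comp measurable_snd) (hy.comp measurable_fst))
  have := Measurable.lintegral_prod_right' (ν := (volume : Measure ℝ))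
    ((hf.comp measurable_snd).indicator hset)
  convert this using 2 with i
  rw [seg, ← lintegral_indicator (measurableSet_io _ _)]
  rfl

lemma setLIntegral_scale {c : ℝ} (hc : 0 < c) (g : ℝ → ℝ≥0∞) :
    ∫⁻ τ in Ioi (0 : ℝ), g (c * τ) = ENNReal.ofReal c⁻¹ * ∫⁻ τ in Ioi (0 : ℝ), g τ := by
  have he : MeasurableEmbedding fun x : ℝ => c * x :=
    (Homeomorph.mulLeft₀ c hc.ne').measurableEmbedding
  have h1 : (fun x : ℝ => c * x) ⁻¹' Ioi (0 : ℝ) = Ioi 0 := by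
    ext x; simp [hc]
  have h2 := he.restrict_map volume (Ioi 0)
  rw [h1] at h2
  rw [← he.lintegral_map g, ← h2, Real.map_volume_mul_left hc.ne', Measure.restrict_smul,
    lintegral_smul_measure,
    abs_of_pos (inv_pos.2 hc), smul_eq_mul]

lemma ennreal_add_rpow_le (x y : ℝ≥0∞) {s : ℝ} (hs : 0 ≤ s) :
    (x + y) ^ s ≤ 2 ^ s * (x ^ s + y ^ s) := by
  calc (x + y) ^ s ≤ (2 * max x y) ^ s := by
        apply ENNReal.rpow_le_rpow _ hs
        rw [two_mul]
        exact add_le_add (le_max_left _ _) (le_max_right _ _)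
    _ = 2 ^ s * (max x y) ^ s := ENNReal.mul_rpow_of_nonneg _ _ hs
    _ ≤ _ := by
        gcongr
        rcases le_total x y with h | h
        · rw [max_eq_right h]; exact le_add_self
        · rw [max_eq_left h]; exact le_self_add

lemma ennreal_iSup_rpow {ι : Sort*} (f : ι → ℝ≥0∞) {s : ℝ} (hs : 0 < s) :
    (⨆ i, f i) ^ s = ⨆ i, f i ^ s :=
  (ENNReal.orderIsoRpow s hs).map_iSup f

/-- Dyadic summation: a function dominated by the sum of the dyadic dilates of `g` is bounded in
every `L^s` by `g`. -/
lemma lintegral_rpow_le_of_dyadic {s : ℝ} (hs : 0 < s) :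
    ∃ K : ℝ≥0∞, K ≠ ⊤ ∧ ∀ h g : ℝ → ℝ≥0∞, Measurable g →
      (∀ τ, 0 < τ → h τ ≤ ∑' j : ℕ, g (2 ^ j * τ)) →
      ∫⁻ τ in Ioi (0 : ℝ), h τ ^ s ≤ K * ∫⁻ τ in Ioi (0 : ℝ), g τ ^ s := by
  have htwo : (2 : ℝ≥0∞) ≠ 0 := two_ne_zero
  set δ : ℝ≥0∞ := 2 ^ (-(1 / (2 * s))) with hδ
  have hδ0 : δ ≠ 0 := by simp [hδ]
  have hδt : δ ≠ ⊤ := by simp [hδ]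
  have hδ1 : δ < 1 := ENNReal.rpow_lt_one_of_one_lt_of_neg (by norm_num)
    (neg_neg_of_pos (by positivity))
  set ε : ℝ≥0∞ := (δ⁻¹) ^ s * 2⁻¹ with hε
  have hεe : ε = 2 ^ (-(1 / 2 : ℝ)) := by
    rw [hε, hδ, ← ENNReal.rpow_neg, neg_neg, ← ENNReal.rpow_mul,
      ← ENNReal.rpow_neg_one (2 : ℝ≥0∞), ← ENNReal.rpow_add _ _ htwo (by norm_num)]
    congr 1
    field_simp
    norm_num
  have hε1 : ε < 1 := by
    rw [hεe]
    exact ENNReal.rpow_lt_one_of_one_lt_of_neg (by norm_num) (by norm_num)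
  have hgeo : ∀ x : ℝ≥0∞, x < 1 → ∑' j : ℕ, x ^ j ≠ ⊤ := fun x hx => by
    exact (tsum_geometric_lt_top.2 hx).ne
  refine ⟨(∑' j : ℕ, δ ^ j) ^ s * ∑' j : ℕ, ε ^ j,
    ENNReal.mul_ne_top (ENNReal.rpow_ne_top_of_nonneg hs.le (hgeo δ hδ1)) (hgeo ε hε1), ?_⟩
  intro h g hg hh
  have hpt : ∀ τ, 0 < τ → h τ ^ s ≤
      (∑' j : ℕ, δ ^ j) ^ s * ∑' j : ℕ, ((δ⁻¹) ^ s) ^ j * g (2 ^ j * τ) ^ s := by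
    intro τ hτ
    set Z := ∑' j : ℕ, ((δ⁻¹) ^ s) ^ j * g (2 ^ j * τ) ^ s with hZ
    have hj : ∀ j : ℕ, g (2 ^ j * τ) ≤ δ ^ j * Z ^ (1 / s) := by
      intro j
      have h1 : ((δ⁻¹) ^ j * g (2 ^ j * τ)) ^ s ≤ Z := by
        refine le_trans (le_of_eq ?_) (ENNReal.le_tsum j)
        rw [ENNReal.mul_rpow_of_nonneg _ _ hs.le, ← ENNReal.rpow_natCast, ← ENNReal.rpow_natCast,
          ← ENNReal.rpow_mul, ← ENNReal.rpow_mul]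
        congr 2
        ring
      have h2 : (δ⁻¹) ^ j * g (2 ^ j * τ) ≤ Z ^ (1 / s) := by
        rw [one_div]
        exact (ENNReal.le_rpow_inv_iff hs).2 h1
      calc g (2 ^ j * τ) = δ ^ j * ((δ⁻¹) ^ j * g (2 ^ j * τ)) := by
            rw [← mul_assoc, ← mul_pow, ENNReal.mul_inv_cancel hδ0 hδt, one_pow, one_mul]
        _ ≤ _ := by gcongr
    calc h τ ^ s ≤ ((∑' j : ℕ, δ ^ j) * Z ^ (1 / s)) ^ s := by
          apply ENNReal.rpow_le_rpow _ hs.le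
          rw [← ENNReal.tsum_mul_right]
          exact (hh τ hτ).trans (ENNReal.tsum_le_tsum hj)
      _ = _ := by
          rw [ENNReal.mul_rpow_of_nonneg _ _ hs.le, ← ENNReal.rpow_mul, one_div,
            inv_mul_cancel₀ hs.ne', ENNReal.rpow_one]
  have hm : ∀ j : ℕ, Measurable fun τ : ℝ => g (2 ^ j * τ) ^ s := fun j =>
    (hg.comp (measurable_const_mul _)).pow_const _
  calc ∫⁻ τ in Ioi (0 : ℝ), h τ ^ s
      ≤ ∫⁻ τ in Ioi (0 : ℝ),
        (∑' j : ℕ, δ ^ j) ^ s * ∑' j : ℕ, ((δ⁻¹) ^ s) ^ j * g (2 ^ j * τ) ^ s :=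
        setLIntegral_mono' measurableSet_Ioi hpt
    _ = (∑' j : ℕ, δ ^ j) ^ s *
        ∑' j : ℕ, ((δ⁻¹) ^ s) ^ j * ∫⁻ τ in Ioi (0 : ℝ), g (2 ^ j * τ) ^ s := by
        rw [lintegral_const_mul _ (Measurable.tsum fun j => (hm j).const_mul _),
          lintegral_tsum fun j => ((hm j).const_mul _).aemeasurable]
        congr 1
        exact tsum_congr fun j => lintegral_const_mul _ (hm j)
    _ = (∑' j : ℕ, δ ^ j) ^ s * ∑' j : ℕ, ε ^ j * ∫⁻ τ in Ioi (0 : ℝ), g τ ^ s := by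
        congr 1
        refine tsum_congr fun j => ?_
        rw [setLIntegral_scale (by positivity : (0 : ℝ) < 2 ^ j) (fun τ => g τ ^ s), ← mul_assoc,
          hε, mul_pow]
        congr 2
        rw [ENNReal.ofReal_inv_of_pos (by positivity), ENNReal.ofReal_pow (by norm_num)]
        simp [ENNReal.inv_pow]
    _ = _ := by rw [ENNReal.tsum_mul_right, mul_assoc]

lemma seg_le_of_seq_right {f : ℝ → ℝ≥0∞} {c z : EReal} {l : ℝ≥0∞} {u : ℕ → EReal}
    (hu : Monotone u) (hz : ∀ t < z, ∃ n, t < u n) (h : ∀ n, seg f c (u n) ≤ l) :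
    seg f c z ≤ l := by
  have hsub : io c z ⊆ ⋃ n, io c (u n) := fun t ht => by
    obtain ⟨n, hn⟩ := hz t ht.2
    exact mem_iUnion.2 ⟨n, ht.1, hn⟩
  refine (lintegral_mono_set hsub).trans ?_
  rw [setLIntegral_iUnion_of_directed]
  · exact iSup_le h
  · exact (monotone_nat_of_le_succ fun n =>
      io_subset_io le_rfl (hu n.le_succ) : Monotone fun n => io c (u n)).directed_le

lemma seg_le_of_seq_left {f : ℝ → ℝ≥0∞} {c z : EReal} {l : ℝ≥0∞} {u : ℕ → EReal}
    (hu : Antitone u) (hz : ∀ t, z < t → ∃ n, u n < t) (h : ∀ n, seg f (u n) c ≤ l) :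
    seg f z c ≤ l := by
  have hsub : io z c ⊆ ⋃ n, io (u n) c := fun t ht => by
    obtain ⟨n, hn⟩ := hz t ht.1
    exact mem_iUnion.2 ⟨n, hn, ht.2⟩
  refine (lintegral_mono_set hsub).trans ?_
  rw [setLIntegral_iUnion_of_directed]
  · exact iSup_le h
  · exact (monotone_nat_of_le_succ fun n =>
      io_subset_io (hu n.le_succ) le_rfl : Monotone fun n => io (u n) c).directed_le

lemma lintegral_level_le_right (f : ℝ → ℝ≥0∞) {c : EReal} (l : ℝ≥0∞) {S : Set ℝ}
    (hS : ∀ t ∈ S, c < (t : EReal) ∧ seg f c t ≤ l) : ∫⁻ t in S, f t ≤ l := by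
  rcases S.eq_empty_or_nonempty with rfl | hne
  · simp
  obtain ⟨x, hx, hlim, hmem⟩ := exists_seq_tendsto_sSup (hne.image ((↑) : ℝ → EReal))
    (OrderTop.bddAbove _)
  set z := sSup (((↑) : ℝ → EReal) '' S)
  have hz : seg f c z ≤ l := by
    refine seg_le_of_seq_right hx (fun t ht => (hlim.eventually_const_lt ht).exists) fun n => ?_
    obtain ⟨t, ht, htx⟩ := hmem n
    rw [← htx]
    exact (hS t ht).2
  have hsub : S ⊆ io c z ∪ {t : ℝ | (t : EReal) = z} := fun t ht => by
    rcases (le_sSup (mem_image_of_mem _ ht) : (t : EReal) ≤ z).lt_or_eq with h | h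
    · exact Or.inl ⟨(hS t ht).1, h⟩
    · exact Or.inr h
  refine (lintegral_mono_set hsub).trans ((lintegral_union_le _ _ _).trans ?_)
  rw [setLIntegral_measure_zero _ _ (volume_coe_fiber z), add_zero]
  exact hz

lemma lintegral_level_le_left (f : ℝ → ℝ≥0∞) {c : EReal} (l : ℝ≥0∞) {S : Set ℝ}
    (hS : ∀ t ∈ S, (t : EReal) < c ∧ seg f t c ≤ l) : ∫⁻ t in S, f t ≤ l := by
  rcases S.eq_empty_or_nonempty with rfl | hne
  · simp
  obtain ⟨x, hx, hlim, hmem⟩ := exists_seq_tendsto_sInf (hne.image ((↑) : ℝ → EReal))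
    (OrderBot.bddBelow _)
  set z := sInf (((↑) : ℝ → EReal) '' S)
  have hz : seg f z c ≤ l := by
    refine seg_le_of_seq_left hx (fun t ht => (hlim.eventually_lt_const ht).exists) fun n => ?_
    obtain ⟨t, ht, htx⟩ := hmem n
    rw [← htx]
    exact (hS t ht).2
  have hsub : S ⊆ io z c ∪ {t : ℝ | (t : EReal) = z} := fun t ht => by
    rcases (sInf_le (mem_image_of_mem _ ht) : z ≤ (t : EReal)).lt_or_eq with h | h
    · exact Or.inl ⟨h, (hS t ht).1⟩
    · exact Or.inr h.symm
  refine (lintegral_mono_set hsub).trans ((lintegral_union_le _ _ _).trans ?_)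
  rw [setLIntegral_measure_zero _ _ (volume_coe_fiber z), add_zero]
  exact hz

/-- A set of positive reals whose elements are pairwise comparable up to a factor two lies in a
dyadic interval. -/
lemma exists_subset_Icc_half {T : Set ℝ} (hpos : ∀ τ ∈ T, 0 < τ)
    (hT : ∀ τ ∈ T, ∀ τ' ∈ T, τ' ≤ 2 * τ) : ∃ y, 0 < y ∧ T ⊆ Icc (y / 2) y := by
  rcases T.eq_empty_or_nonempty with rfl | ⟨τ₀, h₀⟩
  · exact ⟨1, one_pos, empty_subset _⟩
  have hbdd : BddAbove T := ⟨2 * τ₀, fun τ h => hT τ₀ h₀ τ h⟩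
  refine ⟨sSup T, (hpos τ₀ h₀).trans_le (le_csSup hbdd h₀), fun τ h => ⟨?_, le_csSup hbdd h⟩⟩
  have := csSup_le ⟨τ₀, h₀⟩ fun τ' h' => hT τ h τ' h'
  linarith

lemma lintegral_inv_Icc_half {y : ℝ} (hy : 0 < y) :
    ∫⁻ τ in Icc (y / 2) y, (ENNReal.ofReal τ)⁻¹ ≤ 1 := by
  calc ∫⁻ τ in Icc (y / 2) y, (ENNReal.ofReal τ)⁻¹
      ≤ ∫⁻ _ in Icc (y / 2) y, (ENNReal.ofReal (y / 2))⁻¹ :=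
        setLIntegral_mono' measurableSet_Icc fun τ hτ =>
          ENNReal.inv_le_inv.2 (ENNReal.ofReal_le_ofReal hτ.1)
    _ = 1 := by
        rw [setLIntegral_const, Real.volume_Icc, show y - y / 2 = y / 2 by ring]
        exact ENNReal.inv_mul_cancel (by simpa using hy) ENNReal.ofReal_ne_top

lemma lintegral_inv_mul_seg_le {a b : EReal} {X : ℝ → EReal} (hX : Antitone X)
    (ha : ∀ τ, a ≤ X τ) (hb : ∀ τ, 0 < τ → X τ ≤ b) {g : ℝ → ℝ≥0∞} (hg : Measurable g) :
    ∫⁻ τ in Ioi (0 : ℝ), (ENNReal.ofReal τ)⁻¹ * seg g (X (2 * τ)) (X τ) ≤ seg g a b := by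
  have hXm : Measurable X := hX.measurable
  have hX2 : Measurable fun τ => X (2 * τ) := hXm.comp (measurable_const_mul _)
  set D : Set (ℝ × ℝ) := {z | X (2 * z.1) < (z.2 : EReal) ∧ (z.2 : EReal) < X z.1} with hD
  have hDm : MeasurableSet D :=
    (measurableSet_lt (hX2.comp measurable_fst)
      (measurable_coe_real_ereal.comp measurable_snd)).inter
      (measurableSet_lt (measurable_coe_real_ereal.comp measurable_snd) (hXm.comp measurable_fst))
  set Φ : ℝ × ℝ → ℝ≥0∞ := D.indicator fun z => (ENNReal.ofReal z.1)⁻¹ * g z.2 with hΦ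
  have hΦm : Measurable Φ :=
    ((ENNReal.measurable_ofReal.comp measurable_fst).inv.mul (hg.comp measurable_snd)).indicator hDm
  calc ∫⁻ τ in Ioi (0 : ℝ), (ENNReal.ofReal τ)⁻¹ * seg g (X (2 * τ)) (X τ)
      = ∫⁻ τ in Ioi (0 : ℝ), ∫⁻ t, Φ (τ, t) := by
        refine lintegral_congr fun τ => ?_
        rw [seg, ← lintegral_const_mul _ hg, ← lintegral_indicator (measurableSet_io _ _)]
        rfl
    _ = ∫⁻ t, ∫⁻ τ in Ioi (0 : ℝ), Φ (τ, t) := lintegral_lintegral_swap hΦm.aemeasurable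
    _ ≤ ∫⁻ t, (io a b).indicator g t := by
        refine lintegral_mono fun t => ?_
        set T : Set ℝ := {τ | 0 < τ ∧ X (2 * τ) < (t : EReal) ∧ (t : EReal) < X τ} with hT
        have hTm : MeasurableSet T := measurableSet_Ioi.inter
          ((measurableSet_lt hX2 measurable_const).inter (measurableSet_lt measurable_const hXm))
        have hcmp : ∀ τ ∈ T, ∀ τ' ∈ T, τ' ≤ 2 * τ := by
          intro τ h τ' h'
          by_contra hlt
          exact (h.2.1.trans h'.2.2).not_ge (hX (not_le.1 hlt).le)
        obtain ⟨y, hy, hTy⟩ := exists_subset_Icc_half (fun τ h => h.1) hcmp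
        have hle : ∀ τ ∈ Ioi (0 : ℝ), Φ (τ, t) ≤
            T.indicator (fun τ => (ENNReal.ofReal τ)⁻¹ * (io a b).indicator g t) τ := by
          intro τ hτ
          by_cases hz : (τ, t) ∈ D
          · have htT : τ ∈ T := ⟨hτ, hz.1, hz.2⟩
            have htio : t ∈ io a b := ⟨(ha _).trans_lt hz.1, hz.2.trans_le (hb _ hτ)⟩
            rw [hΦ, indicator_of_mem hz, indicator_of_mem htT, indicator_of_mem htio]
          · rw [hΦ, indicator_of_notMem hz]
            exact zero_le
        calc ∫⁻ τ in Ioi (0 : ℝ), Φ (τ, t)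
            ≤ ∫⁻ τ in Ioi (0 : ℝ),
              T.indicator (fun τ => (ENNReal.ofReal τ)⁻¹ * (io a b).indicator g t) τ :=
              setLIntegral_mono' measurableSet_Ioi hle
          _ ≤ ∫⁻ τ, T.indicator (fun τ => (ENNReal.ofReal τ)⁻¹ * (io a b).indicator g t) τ :=
              setLIntegral_le_lintegral _ _
          _ = (∫⁻ τ in T, (ENNReal.ofReal τ)⁻¹) * (io a b).indicator g t := by
              rw [lintegral_indicator hTm, lintegral_mul_const _
                (by fun_prop : Measurable fun τ : ℝ => (ENNReal.ofReal τ)⁻¹)]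
          _ ≤ 1 * (io a b).indicator g t := by
              gcongr
              exact (lintegral_mono_set hTy).trans (lintegral_inv_Icc_half hy)
          _ = _ := one_mul _
    _ = seg g a b := lintegral_indicator (measurableSet_io a b) g

/-- Hölder's inequality combined with Tonelli's theorem over dyadic blocks. -/
lemma lintegral_rpow_mul_seg_le {p r : ℝ} (hr : 0 < r) (hrp : r < p) {a b : EReal} {X : ℝ → EReal}
    (hX : Antitone X) (ha : ∀ τ, a ≤ X τ) (hb : ∀ τ, 0 < τ → X τ ≤ b)
    {g B : ℝ → ℝ≥0∞} (hg : Measurable g) (hB : Measurable B) :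
    ∫⁻ τ in Ioi (0 : ℝ), B τ ^ r * seg g (X (2 * τ)) (X τ) ^ (r / p) ≤
      (∫⁻ τ in Ioi (0 : ℝ), ENNReal.ofReal τ ^ (r / (p - r)) * B τ ^ (p * r / (p - r))) ^
        ((p - r) / p) * seg g a b ^ (r / p) := by
  have hp : 0 < p := hr.trans hrp
  have hpr : 0 < p - r := sub_pos.2 hrp
  have hXm : Measurable X := hX.measurable
  have hX2 : Measurable fun τ => X (2 * τ) := hXm.comp (measurable_const_mul _)
  have hsm : Measurable fun τ => seg g (X (2 * τ)) (X τ) := measurable_seg hg hX2 hXm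
  have hconj : (p / (p - r)).HolderConjugate (p / r) := by
    rw [Real.holderConjugate_iff]
    constructor
    · rw [lt_div_iff₀ hpr]; linarith
    · field_simp
      ring
  set P : ℝ → ℝ≥0∞ := fun τ => B τ ^ r * ENNReal.ofReal τ ^ (r / p) with hP
  set Q : ℝ → ℝ≥0∞ := fun τ => (ENNReal.ofReal τ)⁻¹ ^ (r / p) *
    seg g (X (2 * τ)) (X τ) ^ (r / p) with hQ
  have hPm : Measurable P := (hB.pow_const _).mul (ENNReal.measurable_ofReal.pow_const _)
  have hQm : Measurable Q := (ENNReal.measurable_ofReal.inv.pow_const _).mul (hsm.pow_const _)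
  calc ∫⁻ τ in Ioi (0 : ℝ), B τ ^ r * seg g (X (2 * τ)) (X τ) ^ (r / p)
      = ∫⁻ τ in Ioi (0 : ℝ), (P * Q) τ := by
        refine setLIntegral_congr_fun measurableSet_Ioi fun τ hτ => ?_
        have hτ' : 0 < τ := hτ
        simp only [Pi.mul_apply, hP, hQ]
        have : ENNReal.ofReal τ ^ (r / p) * (ENNReal.ofReal τ)⁻¹ ^ (r / p) = 1 := by
          rw [← ENNReal.mul_rpow_of_nonneg _ _ (by positivity), ENNReal.mul_inv_cancel
            (by simpa using hτ') ENNReal.ofReal_ne_top, ENNReal.one_rpow]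
        rw [mul_assoc, ← mul_assoc (ENNReal.ofReal τ ^ (r / p)), this, one_mul]
    _ ≤ (∫⁻ τ in Ioi (0 : ℝ), P τ ^ (p / (p - r))) ^ (1 / (p / (p - r))) *
        (∫⁻ τ in Ioi (0 : ℝ), Q τ ^ (p / r)) ^ (1 / (p / r)) :=
        ENNReal.lintegral_mul_le_Lp_mul_Lq _ hconj hPm.aemeasurable hQm.aemeasurable
    _ ≤ _ := by
        rw [one_div_div, one_div_div]
        refine mul_le_mul' (le_of_eq ?_) (ENNReal.rpow_le_rpow (le_trans (le_of_eq ?_)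
          (lintegral_inv_mul_seg_le hX ha hb hg)) (by positivity))
        · congr 1
          refine lintegral_congr fun τ => ?_
          rw [hP]
          simp only
          rw [ENNReal.mul_rpow_of_nonneg _ _ (by positivity), ← ENNReal.rpow_mul,
            ← ENNReal.rpow_mul, mul_comm]
          congr 2 <;> field_simp
        · refine lintegral_congr fun τ => ?_
          rw [hQ]
          simp only
          rw [← ENNReal.mul_rpow_of_nonneg _ _ (by positivity), ← ENNReal.rpow_mul,
            div_mul_div_comm, mul_comm r p, div_self (by positivity), ENNReal.rpow_one]

lemma essSup_seg_mul (u : ℝ → ℝ≥0∞) {Q : ℝ → ℝ≥0∞} (hQ : Monotone Q) {α : ℝ} (hα : 0 < α)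
    (a x : EReal) :
    essSup (fun t : ℝ => seg u t x ^ α * Q t) (volume.restrict (io a x)) =
      ⨆ (t : ℝ) (_ : t ∈ io a x), seg u t x ^ α * Q t := by
  set E := essSup (fun t : ℝ => seg u t x ^ α * Q t) (volume.restrict (io a x)) with hE
  apply le_antisymm
  · refine essSup_le_of_ae_le _ ?_
    filter_upwards [ae_restrict_mem (measurableSet_io a x)] with t ht
    exact le_iSup₂ (f := fun (t : ℝ) (_ : t ∈ io a x) => seg u t x ^ α * Q t) t ht
  · refine iSup₂_le fun t₀ ht₀ => ?_
    rcases eq_or_ne E ⊤ with hEt | hEt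
    · rw [hEt]; exact le_top
    rcases eq_or_ne (Q t₀) 0 with hQ0 | hQ0
    · simp [hQ0]
    have hae : ∀ᵐ t : ℝ ∂(volume.restrict (io a x)), seg u t x ^ α * Q t ≤ E :=
      ENNReal.ae_le_essSup _
    have key : ∀ z : EReal, t₀ < z → z < x → seg u z x ≤ (E / Q t₀) ^ (1 / α) := by
      intro z hz hzx
      have hpos : volume (io (t₀ : EReal) z) ≠ 0 := (io_nonempty_pos hz).ne'
      have hae' : ∀ᵐ t : ℝ ∂(volume.restrict (io (t₀ : EReal) z)), seg u t x ^ α * Q t ≤ E :=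
        ae_mono (Measure.restrict_mono (io_subset_io ht₀.1.le hzx.le) le_rfl) hae
      have : ∃ t ∈ io (t₀ : EReal) z, seg u t x ^ α * Q t ≤ E := by
        by_contra hcon
        push Not at hcon
        apply hpos
        rw [ae_restrict_iff' (measurableSet_io _ _)] at hae'
        refine measure_mono_null ?_ hae'
        intro t ht
        simp only [mem_compl_iff]
        intro h
        exact absurd (h ht) (not_le.2 (hcon t ht))
      obtain ⟨t, ht, hle⟩ := this
      rw [one_div, ENNReal.le_rpow_inv_iff hα,
        ENNReal.le_div_iff_mul_le (Or.inl hQ0) (Or.inr hEt)]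
      refine le_trans ?_ hle
      gcongr
      · exact seg_antitone_left u x ht.2.le
      · exact hQ (by exact_mod_cast ht.1.le)
    have hfin : seg u t₀ x ≤ (E / Q t₀) ^ (1 / α) := by
      obtain ⟨z, hz, hzmem, hlim⟩ := exists_seq_strictAnti_tendsto' ht₀.2
      exact seg_le_of_seq_left hz.antitone
        (fun t ht => (hlim.eventually_lt_const ht).exists)
        fun n => key _ (hzmem n).1 (hzmem n).2
    rwa [one_div, ENNReal.le_rpow_inv_iff hα,
        ENNReal.le_div_iff_mul_le (Or.inl hQ0) (Or.inr hEt)] at hfin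

lemma Vp_mono {p : ℝ} (hp : 1 ≤ p) (v : ℝ → ℝ≥0∞) (a : EReal) : Monotone fun x => Vp p v a x := by
  intro x y h
  unfold Vp
  split_ifs with h1
  · exact essSup_mono_measure
      (Measure.restrict_mono (io_subset_io le_rfl h) le_rfl).absolutelyContinuous
  · apply ENNReal.rpow_le_rpow _ (div_nonneg (by linarith) (by linarith))
    exact lintegral_mono_set (io_subset_io le_rfl h)

lemma Vp_self {p : ℝ} (hp : 1 ≤ p) (v : ℝ → ℝ≥0∞) (a : EReal) : Vp p v a a = 0 := by
  unfold Vp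
  rw [io_eq_empty le_rfl, Measure.restrict_empty]
  split_ifs with h1
  · exact essSup_measure_zero
  · have : 1 < p := lt_of_le_of_ne hp (Ne.symm h1)
    rw [lintegral_zero_measure]
    exact ENNReal.zero_rpow_of_pos (div_pos (by linarith) (by linarith))

/-- The density of the right-hand side norm. -/
def dens (p : ℝ) (v f : ℝ → ℝ≥0∞) : ℝ → ℝ≥0∞ := fun t => f t ^ p * v t

lemma measurable_dens (p : ℝ) {v f : ℝ → ℝ≥0∞} (hv : Measurable v) (hf : Measurable f) :
    Measurable (dens p v f) := (hf.pow_const p).mul hv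

lemma lintegral_le_Vp_mul {p : ℝ} (hp : 1 ≤ p) {a b : EReal} {v f : ℝ → ℝ≥0∞}
    (hv : IsWeight a b v) (hf : Measurable f) {x : EReal} (hx : x ≤ b) {D : Set ℝ}
    (hD : MeasurableSet D) (hDs : D ⊆ io a x) :
    ∫⁻ t in D, f t ≤ Vp p v a x * (∫⁻ t in D, dens p v f t) ^ (1 / p) := by
  have hpos : ∀ t ∈ D, v t ≠ 0 ∧ v t ≠ ⊤ := fun t ht =>
    ⟨(hv.2 t (io_subset_io le_rfl hx (hDs ht))).1.ne',
      (hv.2 t (io_subset_io le_rfl hx (hDs ht))).2.ne⟩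
  have hvm := hv.1
  unfold Vp
  split_ifs with h1
  · subst h1
    rw [one_div_one, ENNReal.rpow_one,
      ← lintegral_const_mul _ (measurable_dens 1 hvm hf)]
    have hae : ∀ᵐ t ∂(volume.restrict D),
        (v t)⁻¹ ≤ essSup (fun s => (v s)⁻¹) (volume.restrict (io a x)) :=
      ae_mono (Measure.restrict_mono hDs le_rfl) (ENNReal.ae_le_essSup _)
    refine lintegral_mono_ae ?_
    filter_upwards [hae, ae_restrict_mem hD] with t ht htD
    calc f t = (v t)⁻¹ * (f t * v t) := by
          rw [mul_comm, mul_assoc, ENNReal.mul_inv_cancel (hpos t htD).1 (hpos t htD).2, mul_one]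
      _ ≤ _ := by
          unfold dens
          rw [ENNReal.rpow_one]
          gcongr
  · have hp1 : 1 < p := lt_of_le_of_ne hp (Ne.symm h1)
    have hp0 : 0 < p := by linarith
    have hpm : 0 < p - 1 := by linarith
    have hconj : (p / (p - 1)).HolderConjugate p := by
      rw [Real.holderConjugate_iff]
      constructor
      · rw [lt_div_iff₀ hpm]; linarith
      · field_simp
        ring
    calc ∫⁻ t in D, f t
        = ∫⁻ t in D, ((fun t => v t ^ (-(1 / p))) * fun t => f t * v t ^ (1 / p)) t := by
          refine setLIntegral_congr_fun hD fun t ht => ?_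
          simp only [Pi.mul_apply]
          rw [mul_comm, mul_assoc, ← ENNReal.rpow_add _ _ (hpos t ht).1 (hpos t ht).2]
          simp
      _ ≤ (∫⁻ t in D, (v t ^ (-(1 / p))) ^ (p / (p - 1))) ^ (1 / (p / (p - 1))) *
          (∫⁻ t in D, (f t * v t ^ (1 / p)) ^ p) ^ (1 / p) :=
          ENNReal.lintegral_mul_le_Lp_mul_Lq _ hconj (by fun_prop) (by fun_prop)
      _ ≤ _ := by
          rw [one_div_div]
          refine mul_le_mul' (ENNReal.rpow_le_rpow ?_ (by positivity)) (le_of_eq ?_)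
          · refine le_trans (le_of_eq ?_) (lintegral_mono_set hDs)
            refine lintegral_congr fun t => ?_
            rw [← ENNReal.rpow_mul]
            congr 1
            field_simp
          · congr 1
            refine lintegral_congr fun t => ?_
            rw [dens, ENNReal.mul_rpow_of_nonneg _ _ hp0.le, ← ENNReal.rpow_mul, one_div,
              inv_mul_cancel₀ hp0.ne', ENNReal.rpow_one]

lemma seg_le_Vp_mul {p : ℝ} (hp : 1 ≤ p) {a b : EReal} {v f : ℝ → ℝ≥0∞}
    (hv : IsWeight a b v) (hf : Measurable f) {c x : EReal} (hc : a ≤ c) (hx : x ≤ b) :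
    seg f c x ≤ Vp p v a x * seg (dens p v f) c x ^ (1 / p) :=
  lintegral_le_Vp_mul hp hv hf hx (measurableSet_io _ _) (io_subset_io hc le_rfl)

/-- The admissible test functions for the norm on the right-hand side. -/
lemma Vp_le_iSup {p : ℝ} (hp : 1 ≤ p) {a b : EReal} {v : ℝ → ℝ≥0∞} (hv : IsWeight a b v)
    {x : EReal} (hx : x ≤ b) :
    Vp p v a x ≤ ⨆ (f : ℝ → ℝ≥0∞) (_ : Measurable f ∧ seg (dens p v f) a b ≤ 1), seg f a x := by
  have hvm := hv.1
  have hpos : ∀ t ∈ io a x, v t ≠ 0 ∧ v t ≠ ⊤ := fun t ht =>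
    ⟨(hv.2 t (io_subset_io le_rfl hx ht)).1.ne', (hv.2 t (io_subset_io le_rfl hx ht)).2.ne⟩
  have htest : ∀ (D : Set ℝ) (f : ℝ → ℝ≥0∞), MeasurableSet D → D ⊆ io a x → Measurable f →
      ∫⁻ t in D, dens p v f t ≤ 1 → ∫⁻ t in D, f t ≤
      ⨆ (f : ℝ → ℝ≥0∞) (_ : Measurable f ∧ seg (dens p v f) a b ≤ 1), seg f a x := by
    intro D f hD hDs hf h1
    refine le_trans ?_ (le_iSup₂ (f := fun (f : ℝ → ℝ≥0∞)
      (_ : Measurable f ∧ seg (dens p v f) a b ≤ 1) => seg f a x)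
      (D.indicator f) ⟨hf.indicator hD, ?_⟩)
    · rw [seg, setLIntegral_indicator hD, inter_eq_left.2 hDs]
    · have : dens p v (D.indicator f) = D.indicator (dens p v f) := by
        ext t
        by_cases ht : t ∈ D
        · simp [dens, ht]
        · simp [dens, ht, ENNReal.zero_rpow_of_pos (show 0 < p by linarith)]
      rw [seg, this, setLIntegral_indicator hD,
        inter_eq_left.2 (hDs.trans (io_subset_io le_rfl hx))]
      exact h1
  unfold Vp
  split_ifs with h1
  · subst h1
    refine le_of_forall_lt fun c hc => ?_
    obtain ⟨c', hcc', hc'⟩ := exists_between hc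
    refine hcc'.trans_le ?_
    set S : Set ℝ := {t | c' < (v t)⁻¹} ∩ io a x with hS
    have hSm : MeasurableSet S :=
      (measurableSet_lt measurable_const hvm.inv).inter (measurableSet_io a x)
    have hSpos : 0 < volume S := by
      rw [pos_iff_ne_zero]
      intro h0
      refine hc'.not_ge (essSup_le_of_ae_le _ ?_)
      rw [Filter.EventuallyLE, ae_restrict_iff' (measurableSet_io a x)]
      refine measure_mono_null ?_ h0
      intro t ht
      simp only [mem_compl_iff] at ht
      by_contra hcon
      refine ht fun h2 => ?_
      by_contra h3
      exact hcon ⟨not_le.1 h3, h2⟩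
    obtain ⟨D, hDm, hDs, hD0, hDt⟩ := Measure.exists_subset_measure_lt_top hSm hSpos
    refine le_trans ?_ (htest D (fun t => (volume D)⁻¹ * (v t)⁻¹) hDm
      (hDs.trans inter_subset_right) (hvm.inv.const_mul _) ?_)
    · calc c' = (volume D)⁻¹ * (c' * volume D) := by
            rw [mul_comm c', ← mul_assoc, ENNReal.inv_mul_cancel hD0.ne' hDt.ne, one_mul]
        _ = (volume D)⁻¹ * ∫⁻ _ in D, c' := by rw [setLIntegral_const]
        _ ≤ (volume D)⁻¹ * ∫⁻ t in D, (v t)⁻¹ := by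
            refine mul_le_mul' le_rfl (setLIntegral_mono' hDm fun t ht => (hDs ht).1.le)
        _ = _ := by rw [lintegral_const_mul _ (by fun_prop : Measurable fun t => (v t)⁻¹)]
    · calc ∫⁻ t in D, dens 1 v (fun t => (volume D)⁻¹ * (v t)⁻¹) t
          = ∫⁻ _ in D, (volume D)⁻¹ := by
            refine setLIntegral_congr_fun hDm fun t ht => ?_
            have := hpos t (hDs ht).2
            simp only [dens, ENNReal.rpow_one]
            rw [mul_assoc, ENNReal.inv_mul_cancel this.1 this.2, mul_one]
        _ = (volume D)⁻¹ * volume D := by rw [setLIntegral_const]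
        _ ≤ 1 := ENNReal.inv_mul_le_one _
  · have hp1 : 1 < p := lt_of_le_of_ne hp (Ne.symm h1)
    have hp0 : 0 < p := by linarith
    have hpm : 0 < p - 1 := by linarith
    set k : ℝ → ℝ≥0∞ := fun s => v s ^ (-(1 / (p - 1))) with hk
    have hkm : Measurable k := hvm.pow_const _
    set D : ℕ → Set ℝ := fun n => (Icc (-(n : ℝ)) n ∩ {t | k t ≤ n}) ∩ io a x with hD
    have hDm : ∀ n, MeasurableSet (D n) := fun n =>
      (measurableSet_Icc.inter (measurableSet_le hkm measurable_const)).inter (measurableSet_io a x)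
    have hDmono : Monotone D := by
      intro m n hmn t ht
      have h : (m : ℝ) ≤ n := by exact_mod_cast hmn
      exact ⟨⟨⟨by linarith [ht.1.1.1], by linarith [ht.1.1.2]⟩,
        le_trans ht.1.2 (show (m : ℝ≥0∞) ≤ n by exact_mod_cast hmn)⟩, ht.2⟩
    have hU : io a x ⊆ ⋃ n, D n := by
      intro t ht
      have hkt : k t ≠ ⊤ := by
        simp only [hk, ne_eq, ENNReal.rpow_eq_top_iff, not_or, not_and]
        exact ⟨fun h => absurd h (hpos t ht).1, fun h => absurd h (hpos t ht).2⟩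
      obtain ⟨n, hn⟩ := ENNReal.exists_nat_gt hkt
      obtain ⟨m, hm⟩ := exists_nat_gt |t|
      refine mem_iUnion.2 ⟨max m n, ⟨?_, ?_⟩, ht⟩
      · have := hm.le.trans (show (m : ℝ) ≤ (max m n : ℕ) by exact_mod_cast le_max_left m n)
        exact abs_le.1 this
      · exact hn.le.trans (by exact_mod_cast le_max_right m n)
    have hI : ∫⁻ s in io a x, k s ≤ ⨆ n, ∫⁻ s in D n, k s :=
      (lintegral_mono_set hU).trans
        (le_of_eq (setLIntegral_iUnion_of_directed _ hDmono.directed_le))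
    have he : 0 < (p - 1) / p := by positivity
    refine (ENNReal.rpow_le_rpow hI he.le).trans ?_
    rw [ennreal_iSup_rpow _ he]
    refine iSup_le fun n => ?_
    set I := ∫⁻ s in D n, k s with hIdef
    have hIt : I ≠ ⊤ := by
      refine ne_top_of_le_ne_top ?_ (setLIntegral_mono' (hDm n) fun t ht => ht.1.2)
      rw [setLIntegral_const]
      refine ENNReal.mul_ne_top (ENNReal.natCast_ne_top n)
        (ne_top_of_le_ne_top ?_ (measure_mono (inter_subset_left.trans inter_subset_left)))
      rw [Real.volume_Icc]
      exact ENNReal.ofReal_ne_top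
    refine le_trans ?_ (htest (D n) (fun t => I ^ (-(1 / p)) * k t) (hDm n)
      inter_subset_right (hkm.const_mul _) ?_)
    · rw [lintegral_const_mul _ hkm, ← hIdef]
      rcases eq_or_ne I 0 with h0 | h0
      · rw [h0, ENNReal.zero_rpow_of_pos he]; exact zero_le
      · refine le_of_eq ?_
        conv_rhs => rw [← ENNReal.rpow_one I, ← ENNReal.rpow_mul, one_mul,
          ← ENNReal.rpow_add _ _ h0 hIt]
        congr 1
        field_simp
        ring
    · calc ∫⁻ t in D n, dens p v (fun t => I ^ (-(1 / p)) * k t) t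
          = ∫⁻ t in D n, I⁻¹ * k t := by
            refine setLIntegral_congr_fun (hDm n) fun t ht => ?_
            have ht' := hpos t ht.2
            simp only [dens, hk]
            rw [ENNReal.mul_rpow_of_nonneg _ _ hp0.le, ← ENNReal.rpow_mul, ← ENNReal.rpow_mul,
              mul_assoc, ← ENNReal.rpow_neg_one]
            congr 2
            · field_simp
            · conv_lhs => rw [← ENNReal.rpow_one (v t), ← ENNReal.rpow_mul, one_mul,
                ← ENNReal.rpow_add _ _ ht'.1 ht'.2]
              congr 1
              field_simp
              ring
        _ = I⁻¹ * I := by rw [lintegral_const_mul _ hkm]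
        _ ≤ 1 := ENNReal.inv_mul_le_one _

lemma tsum_rpow_le_rpow_tsum {ι : Type*} (f : ι → ℝ≥0∞) {s : ℝ} (hs : 1 ≤ s) :
    ∑' i, f i ^ s ≤ (∑' i, f i) ^ s := by
  have h1 : ∀ x : ℝ≥0∞, x ^ s = x * x ^ (s - 1) := fun x => by
    conv_rhs => enter [1]; rw [← ENNReal.rpow_one x]
    rw [← ENNReal.rpow_add_of_nonneg _ _ zero_le_one (by linarith)]
    congr 1
    ring
  rw [h1, ← ENNReal.tsum_mul_right]
  refine ENNReal.tsum_le_tsum fun i => ?_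
  rw [h1]
  gcongr
  · exact ENNReal.le_tsum i

/-- Hardy's inequality on a subinterval, in the range `p ≤ q`. -/
lemma local_hardy {p q : ℝ} (hp : 1 ≤ p) (hpq : p ≤ q) :
    ∃ K : ℝ≥0∞, K ≠ ⊤ ∧ ∀ (a b c d : EReal) (u v f : ℝ → ℝ≥0∞) (A : ℝ≥0∞),
      IsWeight a b u → IsWeight a b v → Measurable f → a ≤ c → d ≤ b →
      (∀ t : ℝ, t ∈ io c d → seg u t d ^ (1 / q) * Vp p v a t ≤ A) →
      seg (fun t => seg f c t ^ q * u t) c d ≤ K * (A ^ q * seg (dens p v f) c d ^ (q / p)) := by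
  have hp0 : 0 < p := by linarith
  have hq0 : 0 < q := by linarith
  refine ⟨1 + 4 ^ q * 2 ^ (q / p), ENNReal.add_ne_top.2 ⟨ENNReal.one_ne_top, ENNReal.mul_ne_top
    (ENNReal.rpow_ne_top_of_nonneg hq0.le (by simp))
    (ENNReal.rpow_ne_top_of_nonneg (div_pos hq0 hp0).le (by simp))⟩, ?_⟩
  intro a b c d u v f A hu hv hf hac hdb hA
  set F : ℝ → ℝ≥0∞ := fun t => seg f c t with hF
  have hFm : Measurable F := (measurable_seg_left f c).comp measurable_coe_real_ereal
  set g := dens p v f with hg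
  have hgm : Measurable g := measurable_dens p hv.1 hf
  have hioab : io c d ⊆ io a b := io_subset_io hac hdb
  by_cases hinf : ∃ t ∈ io c d, F t = ⊤
  · obtain ⟨t, ht, hFt⟩ := hinf
    have h1 : ⊤ ≤ Vp p v a t * seg g c d ^ (1 / p) := by
      rw [← hFt]
      refine (seg_le_Vp_mul hp hv hf hac (ht.2.le.trans hdb)).trans ?_
      gcongr
      exact seg_mono_set _ le_rfl ht.2.le
    have h2 : seg u t d ^ (1 / q) ≠ 0 := by
      have := (seg_pos hu.1 ht.2 fun x hx => (hu.2 x (hioab ⟨ht.1.trans hx.1, hx.2⟩)).1).ne'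
      simp [this, hq0.le]
    have h3 : A * seg g c d ^ (1 / p) = ⊤ := by
      rw [eq_top_iff]
      calc ⊤ = seg u t d ^ (1 / q) * ⊤ := (ENNReal.mul_top h2).symm
        _ ≤ seg u t d ^ (1 / q) * (Vp p v a t * seg g c d ^ (1 / p)) := by gcongr
        _ ≤ _ := by rw [← mul_assoc]; gcongr; exact hA t ht
    have h4 : A ^ q * seg g c d ^ (q / p) = ⊤ := by
      have : A ^ q * seg g c d ^ (q / p) = (A * seg g c d ^ (1 / p)) ^ q := by
        rw [ENNReal.mul_rpow_of_nonneg _ _ hq0.le, ← ENNReal.rpow_mul]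
        congr 2
        ring
      rw [this, h3, ENNReal.top_rpow_of_pos hq0]
    rw [h4, ENNReal.mul_top (by simp)]
    exact le_top
  push Not at hinf
  set m : ℤ → ℝ≥0∞ := fun k => 2 ^ (k - 1) with hm
  have hm0 : ∀ k, m k ≠ 0 := fun k => (ENNReal.zpow_pos two_ne_zero ENNReal.ofNat_ne_top _).ne'
  have hmt : ∀ k, m k ≠ ⊤ := fun k => (ENNReal.zpow_lt_top two_ne_zero ENNReal.ofNat_ne_top _).ne
  have hm1 : ∀ k, m (k + 1) = 2 * m k := fun k => by
    simp only [hm]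
    rw [show k + 1 - 1 = (k - 1) + 1 by ring, ENNReal.zpow_add two_ne_zero ENNReal.ofNat_ne_top,
      zpow_one, mul_comm]
  set E : ℤ → Set ℝ := fun k => io c d ∩ {t | m k < F t ∧ F t ≤ m (k + 1)} with hE
  have hEm : ∀ k, MeasurableSet (E k) := fun k => (measurableSet_io c d).inter
    ((measurableSet_lt measurable_const hFm).inter (measurableSet_le hFm measurable_const))
  have hmmono : Monotone m := monotone_int_of_le_succ fun k => by
    rw [hm1, two_mul]; exact le_self_add
  have hEdisj : Pairwise (Function.onFun Disjoint E) := by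
    have : ∀ i j, i < j → Disjoint (E i) (E j) := by
      intro i j hij
      rw [Set.disjoint_left]
      intro t ht ht'
      exact (ht.2.2.trans (hmmono (by omega))).not_gt ht'.2.1
    intro i j hij
    rcases lt_or_gt_of_ne hij with h | h
    · exact this i j h
    · exact (this j i h).symm
  set J : ℤ → ℝ≥0∞ := fun k => (∫⁻ t in E k, g t) + ∫⁻ t in E (k + 1), g t with hJ
  have hsumE : ∑' k, ∫⁻ t in E k, g t ≤ seg g c d := by
    rw [← lintegral_iUnion hEm hEdisj]
    exact lintegral_mono_set (iUnion_subset fun k => inter_subset_left)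
  have hsumJ : ∑' k, J k ≤ 2 * seg g c d := by
    rw [ENNReal.tsum_add, two_mul]
    refine add_le_add hsumE (le_trans (le_of_eq ?_) hsumE)
    exact (Equiv.addRight (1 : ℤ)).tsum_eq fun k => ∫⁻ t in E k, g t
  have hlev : ∀ k, ∀ t ∈ E (k + 1), m k ≤ Vp p v a t * J k ^ (1 / p) := by
    intro k t ht
    set D : Set ℝ := io c t ∩ {s | m k < F s} with hD
    have hDm : MeasurableSet D :=
      (measurableSet_io c t).inter (measurableSet_lt measurable_const hFm)
    have hsub : io c t ⊆ {s | c < (s : EReal) ∧ seg f c s ≤ m k} ∪ D := by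
      intro s hs
      rcases le_or_gt (F s) (m k) with h | h
      · exact Or.inl ⟨hs.1, h⟩
      · exact Or.inr ⟨hs, h⟩
    have hDE : D ⊆ E k ∪ E (k + 1) := by
      intro s hs
      have h1 : F s ≤ m (k + 1 + 1) := (seg_mono_set f le_rfl hs.1.2.le).trans ht.2.2
      have h2 : s ∈ io c d := ⟨hs.1.1, hs.1.2.trans ht.1.2⟩
      rcases le_or_gt (F s) (m (k + 1)) with h | h
      · exact Or.inl ⟨h2, hs.2, h⟩
      · exact Or.inr ⟨h2, h, h1⟩
    have h1 : m k + m k ≤ m k + ∫⁻ s in D, f s := by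
      calc m k + m k = m (k + 1) := by rw [hm1, two_mul]
        _ ≤ F t := ht.2.1.le
        _ ≤ (∫⁻ s in {s : ℝ | c < (s : EReal) ∧ seg f c s ≤ m k}, f s) + ∫⁻ s in D, f s :=
          (lintegral_mono_set hsub).trans (lintegral_union_le _ _ _)
        _ ≤ _ := by
          gcongr
          exact lintegral_level_le_right f (m k) fun s hs => hs
    calc m k ≤ ∫⁻ s in D, f s := (ENNReal.add_le_add_iff_left (hmt k)).1 h1
      _ ≤ Vp p v a t * (∫⁻ s in D, g s) ^ (1 / p) :=
        lintegral_le_Vp_mul hp hv hf (ht.1.2.le.trans hdb) hDm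
          (inter_subset_left.trans (io_subset_io hac le_rfl))
      _ ≤ _ := by
        gcongr
        exact (lintegral_mono_set hDE).trans (lintegral_union_le _ _ _)
  have hblock : ∀ k, m (k + 1 + 1) ^ q * ∫⁻ t in E (k + 1), u t ≤
      4 ^ q * (A ^ q * J k ^ (q / p)) := by
    intro k
    have hU : ∫⁻ t in E (k + 1), u t ≤ A ^ q * J k ^ (q / p) / m k ^ q := by
      refine lintegral_level_le_left u (c := d) _ fun t ht => ⟨ht.1.2, ?_⟩
      rw [ENNReal.le_div_iff_mul_le (Or.inl (by simp [hm0, hmt]))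
        (Or.inl (ENNReal.rpow_ne_top_of_nonneg hq0.le (hmt k)))]
      calc seg u t d * m k ^ q ≤ seg u t d * (Vp p v a t * J k ^ (1 / p)) ^ q := by
            gcongr
            exact hlev k t ht
        _ = (seg u t d ^ (1 / q) * Vp p v a t) ^ q * J k ^ (q / p) := by
            rw [ENNReal.mul_rpow_of_nonneg _ _ hq0.le, ENNReal.mul_rpow_of_nonneg _ _ hq0.le,
              ← ENNReal.rpow_mul, ← ENNReal.rpow_mul, one_div_mul_cancel hq0.ne',
              ENNReal.rpow_one, mul_assoc]
            congr 3
            ring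
        _ ≤ _ := by
            gcongr
            exact hA t ht.1
    calc m (k + 1 + 1) ^ q * ∫⁻ t in E (k + 1), u t
        ≤ (4 * m k) ^ q * (A ^ q * J k ^ (q / p) / m k ^ q) := by
          refine mul_le_mul' (le_of_eq ?_) hU
          rw [hm1, hm1, ← mul_assoc]
          norm_num
      _ = 4 ^ q * (m k ^ q * (A ^ q * J k ^ (q / p) / m k ^ q)) := by
          rw [ENNReal.mul_rpow_of_nonneg _ _ hq0.le, mul_assoc]
      _ = _ := by
          rw [ENNReal.mul_div_cancel (by simp [hm0, hmt])
            (ENNReal.rpow_ne_top_of_nonneg hq0.le (hmt k))]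
  have hpt : ∀ t ∈ io c d, seg f c t ^ q * u t ≤
      ∑' k : ℤ, (E (k + 1)).indicator (fun t => m (k + 1 + 1) ^ q * u t) t := by
    intro t ht
    rcases eq_or_ne (F t) 0 with h0 | h0
    · have : seg f c t = 0 := h0
      rw [this, ENNReal.zero_rpow_of_pos hq0, zero_mul]
      exact zero_le
    obtain ⟨n, hn1, hn2⟩ := ENNReal.exists_mem_Ioc_zpow h0 (hinf t ht) ENNReal.one_lt_two
      ENNReal.ofNat_ne_top
    have htE : t ∈ E (n + 1) := by
      refine ⟨ht, ?_, ?_⟩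
      · simpa [hm] using hn1
      · simpa [hm] using hn2
    refine le_trans ?_ (ENNReal.le_tsum n)
    rw [indicator_of_mem htE]
    gcongr
    exact htE.2.2
  calc seg (fun t => seg f c t ^ q * u t) c d
      ≤ ∫⁻ t in io c d, ∑' k : ℤ, (E (k + 1)).indicator (fun t => m (k + 1 + 1) ^ q * u t) t :=
        setLIntegral_mono' (measurableSet_io c d) hpt
    _ ≤ ∫⁻ t, ∑' k : ℤ, (E (k + 1)).indicator (fun t => m (k + 1 + 1) ^ q * u t) t :=
        setLIntegral_le_lintegral _ _
    _ = ∑' k : ℤ, m (k + 1 + 1) ^ q * ∫⁻ t in E (k + 1), u t := by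
        rw [lintegral_tsum fun k => ((hu.1.const_mul _).indicator (hEm _)).aemeasurable]
        refine tsum_congr fun k => ?_
        rw [lintegral_indicator (hEm _), lintegral_const_mul _ hu.1]
    _ ≤ ∑' k : ℤ, 4 ^ q * (A ^ q * J k ^ (q / p)) := ENNReal.tsum_le_tsum hblock
    _ = 4 ^ q * (A ^ q * ∑' k : ℤ, J k ^ (q / p)) := by
        rw [ENNReal.tsum_mul_left, ENNReal.tsum_mul_left]
    _ ≤ 4 ^ q * (A ^ q * (2 * seg g c d) ^ (q / p)) := by
        gcongr
        exact (tsum_rpow_le_rpow_tsum J ((one_le_div hp0).2 hpq)).trans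
          (ENNReal.rpow_le_rpow hsumJ (by positivity))
    _ = 4 ^ q * 2 ^ (q / p) * (A ^ q * seg g c d ^ (q / p)) := by
        rw [ENNReal.mul_rpow_of_nonneg _ _ (by positivity)]
        ring
    _ ≤ _ := by
        gcongr
        exact le_add_self

/-- The decreasing rearrangement of the identity with respect to `μ`, on `(a, ∞]`. -/
def rearr (μ : Measure EReal) (a : EReal) (τ : ℝ) : EReal :=
  sSup (insert a {c | a < c ∧ ENNReal.ofReal τ < μ (Ioi c)})

lemma le_rearr (μ : Measure EReal) (a : EReal) (τ : ℝ) : a ≤ rearr μ a τ :=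
  le_sSup (mem_insert _ _)

lemma rearr_antitone (μ : Measure EReal) (a : EReal) : Antitone (rearr μ a) := by
  intro x y h
  refine sSup_le_sSup (insert_subset_insert fun c hc => ⟨hc.1, ?_⟩)
  exact (ENNReal.ofReal_le_ofReal h).trans_lt hc.2

lemma rearr_le {μ : Measure EReal} {a b : EReal} (hab : a ≤ b) (hb : μ (Ioi b) = 0) (τ : ℝ) :
    rearr μ a τ ≤ b := by
  refine sSup_le fun c hc => ?_
  rcases hc with rfl | hc
  · exact hab
  · by_contra hlt
    have := measure_mono_null (Ioi_subset_Ioi (not_le.1 hlt).le) hb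
    exact absurd hc.2 (by rw [this]; exact _root_.not_lt_zero)

lemma lt_rearr_iff {μ : Measure EReal} {a c : EReal} (hc : a < c) (τ : ℝ) :
    c < rearr μ a τ ↔ ENNReal.ofReal τ < μ (Ioi c) := by
  constructor
  · intro h
    obtain ⟨d, hd, hcd⟩ := lt_sSup_iff.1 h
    rcases hd with rfl | hd
    · exact absurd hc hcd.not_gt
    · exact hd.2.trans_le (measure_mono (Ioi_subset_Ioi hcd.le))
  · intro h
    have hct : c < ⊤ := by
      rw [lt_top_iff_ne_top]
      rintro rfl
      simp at h
    obtain ⟨z, hz, hzmem, hlim⟩ := exists_seq_strictAnti_tendsto' hct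
    have hU : Ioi c = ⋃ n, Ioi (z n) := by
      ext t
      simp only [mem_Ioi, mem_iUnion]
      exact ⟨fun ht => (hlim.eventually_lt_const ht).exists, fun ⟨n, hn⟩ => (hzmem n).1.trans hn⟩
    rw [hU, Monotone.measure_iUnion
      (fun m n hmn => Ioi_subset_Ioi (hz.antitone hmn))] at h
    obtain ⟨n, hn⟩ := lt_iSup_iff.1 h
    exact (hzmem n).1.trans_le (le_sSup (mem_insert_of_mem _ ⟨hc.trans (hzmem n).1, hn⟩))

lemma measure_Ioi_rearr_le {μ : Measure EReal} {a : EReal} {τ : ℝ} (h : a < rearr μ a τ) :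
    μ (Ioi (rearr μ a τ)) ≤ ENNReal.ofReal τ :=
  not_lt.1 fun h' => lt_irrefl _ ((lt_rearr_iff h τ).2 h')

lemma le_measure_Ici_rearr {μ : Measure EReal} {a : EReal} (hfin : ∀ c, a < c → μ (Ioi c) ≠ ⊤)
    {τ : ℝ} (h : a < rearr μ a τ) : ENNReal.ofReal τ ≤ μ (Ici (rearr μ a τ)) := by
  obtain ⟨z, hz, hzmem, hlim⟩ := exists_seq_strictMono_tendsto' h
  have hI : Ici (rearr μ a τ) = ⋂ n, Ioi (z n) := by
    ext t
    simp only [mem_Ici, mem_iInter, mem_Ioi]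
    constructor
    · intro ht n
      exact (hzmem n).2.trans_le ht
    · intro ht
      by_contra hlt
      obtain ⟨n, hn⟩ := (hlim.eventually_const_lt (not_le.1 hlt)).exists
      exact hn.not_gt (ht n)
  rw [hI, Antitone.measure_iInter (fun m n hmn => Ioi_subset_Ioi (hz.monotone hmn))
    (fun n => measurableSet_Ioi.nullMeasurableSet) ⟨0, hfin _ (hzmem 0).1⟩]
  exact le_iInf fun n => ((lt_rearr_iff (hzmem n).1 τ).1 (hzmem n).2).le

lemma volume_pos_ofReal_lt (M : ℝ≥0∞) :
    volume {τ : ℝ | 0 < τ ∧ ENNReal.ofReal τ < M} = M := by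
  rcases eq_or_ne M ⊤ with rfl | hM
  · have : {τ : ℝ | 0 < τ ∧ ENNReal.ofReal τ < ⊤} = Ioi 0 := by
      ext τ; simp
    rw [this, Real.volume_Ioi]
  · have : {τ : ℝ | 0 < τ ∧ ENNReal.ofReal τ < M} = Ioo 0 M.toReal := by
      ext τ
      simp only [mem_ofPred_eq, mem_Ioo]
      refine and_congr_right fun hτ => ?_
      rw [ENNReal.ofReal_lt_iff_lt_toReal hτ.le hM]
    rw [this, Real.volume_Ioo, sub_zero, ENNReal.ofReal_toReal hM]

lemma setLIntegral_Ioi_eq_rearr {μ : Measure EReal} {a : EReal}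
    (hfin : ∀ c, a < c → μ (Ioi c) ≠ ⊤) {G : EReal → ℝ≥0∞} (hG : Measurable G) :
    ∫⁻ x in Ioi a, G x ∂μ = ∫⁻ τ in Ioi (0 : ℝ), (Ioi a).indicator G (rearr μ a τ) := by
  have hXm : Measurable (rearr μ a) := (rearr_antitone μ a).measurable
  set ν : Measure EReal := (volume.restrict (Ioi (0 : ℝ))).map (rearr μ a) with hν
  have hνμ : ∀ c, a < c → ν (Ioi c) = μ (Ioi c) := by
    intro c hc
    rw [hν, Measure.map_apply hXm measurableSet_Ioi,
      Measure.restrict_apply (hXm measurableSet_Ioi), ← volume_pos_ofReal_lt (μ (Ioi c))]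
    congr 1
    ext τ
    simp only [mem_inter_iff, mem_preimage, mem_Ioi, mem_ofPred_eq, lt_rearr_iff hc, and_comm]
  have hres : ∀ c, a < c → ν.restrict (Ioi c) = μ.restrict (Ioi c) := by
    intro c hc
    have hf : IsFiniteMeasure (ν.restrict (Ioi c)) :=
      ⟨by rw [Measure.restrict_apply_univ, hνμ c hc]; exact (hfin c hc).lt_top⟩
    refine ext_of_generate_finite _ (borel_eq_generateFrom_Ioi EReal ▸ BorelSpace.measurable_eq)
      isPiSystem_Ioi ?_ ?_
    · rintro _ ⟨d, rfl⟩
      rw [Measure.restrict_apply measurableSet_Ioi, Measure.restrict_apply measurableSet_Ioi,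
        Ioi_inter_Ioi, hνμ _ (hc.trans_le le_sup_right)]
    · rw [Measure.restrict_apply_univ, Measure.restrict_apply_univ, hνμ c hc]
  have hall : ν.restrict (Ioi a) = μ.restrict (Ioi a) := by
    rcases eq_or_ne a ⊤ with rfl | ha
    · simp
    obtain ⟨z, hz, hzmem, hlim⟩ := exists_seq_strictAnti_tendsto' (lt_top_iff_ne_top.2 ha)
    have hU : Ioi a = ⋃ n, Ioi (z n) := by
      ext t
      simp only [mem_Ioi, mem_iUnion]
      exact ⟨fun ht => (hlim.eventually_lt_const ht).exists, fun ⟨n, hn⟩ => (hzmem n).1.trans hn⟩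
    rw [hU, Measure.restrict_iUnion_congr]
    exact fun n => hres _ (hzmem n).1
  rw [← hall, ← lintegral_indicator measurableSet_Ioi, hν,
    lintegral_map (hG.indicator measurableSet_Ioi) hXm]

lemma iUnion_Ioc_two_zpow : Ioi (0 : ℝ) ⊆ ⋃ k : ℤ, Ioc ((2 : ℝ) ^ k) (2 ^ (k + 1)) := fun τ hτ => by
  obtain ⟨n, hn⟩ := exists_mem_Ioc_zpow (mem_Ioi.1 hτ) (one_lt_two : (1 : ℝ) < 2)
  exact mem_iUnion.2 ⟨n, hn⟩

lemma pairwise_disjoint_Ioc_two_zpow :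
    Pairwise (Function.onFun Disjoint fun k : ℤ => Ioc ((2 : ℝ) ^ k) (2 ^ (k + 1))) := by
  have : ∀ i j : ℤ, i < j → Disjoint (Ioc ((2 : ℝ) ^ i) (2 ^ (i + 1)))
      (Ioc ((2 : ℝ) ^ j) (2 ^ (j + 1))) := by
    intro i j hij
    rw [Set.disjoint_left]
    intro t ht ht'
    have : (2 : ℝ) ^ (i + 1) ≤ 2 ^ j := zpow_le_zpow_right₀ one_le_two (by omega)
    exact (ht.2.trans this).not_gt ht'.1
  intro i j hij
  rcases lt_or_gt_of_ne hij with h | h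
  · exact this i j h
  · exact (this j i h).symm

lemma volume_Ioc_two_zpow (k : ℤ) :
    volume (Ioc ((2 : ℝ) ^ k) (2 ^ (k + 1))) = ENNReal.ofReal (2 ^ k) := by
  rw [Real.volume_Ioc, zpow_add₀ two_ne_zero]
  congr 1
  ring

lemma ofReal_two_zpow_succ (k : ℤ) :
    ENNReal.ofReal (2 ^ (k + 1)) = 2 * ENNReal.ofReal ((2 : ℝ) ^ k) := by
  rw [zpow_add₀ two_ne_zero, zpow_one, mul_comm, ENNReal.ofReal_mul two_pos.le]
  simp

/-- Testing an inequality on superpositions of near-extremal functions for a decreasing family of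
functionals. -/
lemma lintegral_le_of_test {p r : ℝ} (hr : 0 < r) (hrp : r < p) :
    ∃ K : ℝ≥0∞, K ≠ ⊤ ∧ ∀ (a b : EReal) (v : ℝ → ℝ≥0∞) (L : ℝ → (ℝ → ℝ≥0∞) → ℝ≥0∞)
      (B : ℝ → ℝ≥0∞) (C : ℝ≥0∞), Measurable v → (∀ f, Antitone fun τ => L τ f) →
      (∀ τ f g (α : ℝ≥0∞), (∀ t, α * f t ≤ g t) → α * L τ f ≤ L τ g) →
      (∀ f, Measurable f →
        ∫⁻ τ in Ioi (0 : ℝ), L τ f ^ r ≤ C ^ r * seg (dens p v f) a b ^ (r / p)) →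
      Antitone B →
      (∀ τ, 0 < τ → B τ ≤ ⨆ (f : ℝ → ℝ≥0∞) (_ : Measurable f ∧ seg (dens p v f) a b ≤ 1), L τ f) →
      ∫⁻ τ in Ioi (0 : ℝ), ENNReal.ofReal τ ^ (r / (p - r)) * B τ ^ (p * r / (p - r)) ≤
        K * C ^ (p * r / (p - r)) := by
  have hp : 0 < p := hr.trans hrp
  have hpr : 0 < p - r := sub_pos.2 hrp
  set e := r / (p - r) with he
  set ρ := p * r / (p - r) with hρ
  have he0 : 0 < e := by positivity
  have hρ0 : 0 < ρ := by positivity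
  have hee : 1 + e = p / (p - r) := by rw [he]; field_simp; ring
  refine ⟨2 ^ e * (2 ^ ρ * 2 ^ (p / (p - r))), ENNReal.mul_ne_top
    (ENNReal.rpow_ne_top_of_nonneg he0.le (by simp)) (ENNReal.mul_ne_top
    (ENNReal.rpow_ne_top_of_nonneg hρ0.le (by simp))
    (ENNReal.rpow_ne_top_of_nonneg (by positivity) (by simp))), ?_⟩
  intro a b v L B C hv hL hLα htest hB hBle
  set T : ℤ → ℝ≥0∞ := fun k => ENNReal.ofReal ((2 : ℝ) ^ k) with hT
  have hTt : ∀ k, T k ≠ ⊤ := fun k => ENNReal.ofReal_ne_top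
  have hT1 : ∀ k, T (k + 1) = 2 * T k := ofReal_two_zpow_succ
  have hclaim : ∀ (s : Finset ℤ) (n : ℕ),
      ∑ k ∈ s, T k ^ (p / (p - r)) * (min (B (2 ^ k)) n / 2) ^ ρ ≤ (2 * C ^ r) ^ (p / (p - r)) := by
    intro s n
    set κ : ℤ → ℝ≥0∞ := fun k => min (B (2 ^ k)) n / 2 with hκ
    have hmint : ∀ k : ℤ, min (B (2 ^ k)) (n : ℝ≥0∞) ≠ ⊤ := fun k =>
      ne_top_of_le_ne_top (ENNReal.natCast_ne_top n) (min_le_right _ _)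
    have hκt : ∀ k, κ k ≠ ⊤ := fun k => ENNReal.div_ne_top (hmint k) two_ne_zero
    have hex : ∀ k : ℤ, ∃ f : ℝ → ℝ≥0∞, (Measurable f ∧ seg (dens p v f) a b ≤ 1) ∧
        κ k ≤ L (2 ^ k) f := by
      intro k
      rcases eq_or_ne (min (B (2 ^ k)) (n : ℝ≥0∞)) 0 with h0 | h0
      · refine ⟨fun _ => 0, ⟨measurable_const, ?_⟩, ?_⟩
        · simp [seg, dens, ENNReal.zero_rpow_of_pos hp]
        · simp [hκ, h0]
      · have h1 : κ k < ⨆ (f : ℝ → ℝ≥0∞) (_ : Measurable f ∧ seg (dens p v f) a b ≤ 1),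
            L (2 ^ k) f :=
          (ENNReal.half_lt_self h0 (hmint k)).trans_le
            ((min_le_left _ _).trans (hBle _ (by positivity)))
        obtain ⟨f, hf⟩ := lt_iSup_iff.1 h1
        obtain ⟨hf1, hf2⟩ := lt_iSup_iff.1 hf
        exact ⟨f, hf1, hf2.le⟩
    choose F hF hFκ using hex
    set z : ℤ → ℝ≥0∞ := fun k => (T k * κ k ^ r) ^ (p / (p - r)) with hz
    have hzt : ∀ k, z k ≠ ⊤ := fun k => ENNReal.rpow_ne_top_of_nonneg (by positivity)
      (ENNReal.mul_ne_top (hTt k) (ENNReal.rpow_ne_top_of_nonneg hr.le (hκt k)))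
    set Z := ∑ k ∈ s, z k with hZ
    have hZt : Z ≠ ⊤ := (ENNReal.sum_lt_top.2 fun k _ => (hzt k).lt_top).ne
    have hzeq : ∑ k ∈ s, T k ^ (p / (p - r)) * κ k ^ ρ = Z := by
      refine Finset.sum_congr rfl fun k _ => ?_
      rw [hz]
      simp only
      rw [ENNReal.mul_rpow_of_nonneg _ _ (by positivity), ← ENNReal.rpow_mul, hρ]
      congr 2
      ring
    rw [hzeq]
    set f : ℝ → ℝ≥0∞ := fun t => (∑ k ∈ s, z k * F k t ^ p) ^ (1 / p) with hf
    have hsm : Measurable fun t => ∑ k ∈ s, z k * F k t ^ p :=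
      Finset.measurable_fun_sum _ fun k _ => ((hF k).1.pow_const p).const_mul _
    have hfm : Measurable f := hsm.pow_const _
    have hJ : seg (dens p v f) a b ≤ Z := by
      calc seg (dens p v f) a b = ∫⁻ t in io a b, ∑ k ∈ s, z k * dens p v (F k) t := by
            refine lintegral_congr fun t => ?_
            simp only [dens, hf]
            rw [← ENNReal.rpow_mul, one_div_mul_cancel hp.ne', ENNReal.rpow_one, Finset.sum_mul]
            simp only [mul_assoc]
        _ = ∑ k ∈ s, z k * seg (dens p v (F k)) a b := by
            rw [lintegral_finsetSum _ fun k _ => (measurable_dens p hv (hF k).1).const_mul _]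
            exact Finset.sum_congr rfl fun k _ =>
              lintegral_const_mul _ (measurable_dens p hv (hF k).1)
        _ ≤ ∑ k ∈ s, z k * 1 := by
            gcongr with k hk
            exact (hF k).2
        _ = Z := by simp [hZ]
    have hLf : ∀ k ∈ s, z k ^ (1 / p) * κ k ≤ L (2 ^ k) f := by
      intro k hk
      calc z k ^ (1 / p) * κ k ≤ z k ^ (1 / p) * L (2 ^ k) (F k) := by gcongr; exact hFκ k
        _ ≤ _ := by
          refine hLα _ _ _ _ fun t => ?_
          calc z k ^ (1 / p) * F k t = (z k * F k t ^ p) ^ (1 / p) := by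
                rw [ENNReal.mul_rpow_of_nonneg _ _ (by positivity),
                  ← ENNReal.rpow_mul (F k t), mul_one_div_cancel hp.ne', ENNReal.rpow_one]
            _ ≤ _ := by
                apply ENNReal.rpow_le_rpow _ (by positivity)
                exact Finset.single_le_sum (f := fun k => z k * F k t ^ p)
                  (fun _ _ => zero_le) hk
    have hlow : Z ≤ 2 * (C ^ r * Z ^ (r / p)) := by
      have hLm : Measurable fun τ => L τ f ^ r := (hL f).measurable.pow_const r
      calc Z = ∑ k ∈ s, T k * (z k ^ (1 / p) * κ k) ^ r := by
            refine Finset.sum_congr rfl fun k _ => ?_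
            rw [ENNReal.mul_rpow_of_nonneg _ _ hr.le, mul_left_comm]
            have : T k * κ k ^ r = z k ^ ((p - r) / p) := by
              rw [hz]
              simp only
              rw [← ENNReal.rpow_mul, div_mul_div_comm, mul_comm p, div_self (by positivity),
                ENNReal.rpow_one]
            rw [this, ← ENNReal.rpow_mul, ← ENNReal.rpow_add_of_nonneg _ _ (by positivity)
              (by positivity)]
            have h2 : 1 / p * r + (p - r) / p = 1 := by field_simp; ring
            rw [h2, ENNReal.rpow_one]
        _ ≤ ∑ k ∈ s, 2 * ∫⁻ τ in Ioc ((2 : ℝ) ^ (k - 1)) (2 ^ (k - 1 + 1)), L τ f ^ r := by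
            refine Finset.sum_le_sum fun k hk => ?_
            have h1 : T k = 2 * T (k - 1) := by rw [← hT1, sub_add_cancel]
            rw [h1, mul_assoc]
            gcongr
            rw [mul_comm]
            calc _ = ∫⁻ _ in Ioc ((2 : ℝ) ^ (k - 1)) (2 ^ (k - 1 + 1)),
                  (z k ^ (1 / p) * κ k) ^ r := by
                  rw [setLIntegral_const, volume_Ioc_two_zpow]
              _ ≤ _ := by
                  refine setLIntegral_mono' measurableSet_Ioc fun τ hτ => ?_
                  apply ENNReal.rpow_le_rpow _ hr.le
                  refine (hLf k hk).trans (hL f ?_)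
                  simpa using hτ.2
        _ = 2 * ∑ k ∈ s, ∫⁻ τ in Ioc ((2 : ℝ) ^ (k - 1)) (2 ^ (k - 1 + 1)), L τ f ^ r := by
            rw [Finset.mul_sum]
        _ ≤ 2 * ∑' k : ℤ, ∫⁻ τ in Ioc ((2 : ℝ) ^ (k - 1)) (2 ^ (k - 1 + 1)), L τ f ^ r := by
            gcongr
            exact ENNReal.sum_le_tsum _
        _ = 2 * ∑' k : ℤ, ∫⁻ τ in Ioc ((2 : ℝ) ^ k) (2 ^ (k + 1)), L τ f ^ r := by
            congr 1
            exact (Equiv.subRight (1 : ℤ)).tsum_eq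
              fun k => ∫⁻ τ in Ioc ((2 : ℝ) ^ k) (2 ^ (k + 1)), L τ f ^ r
        _ ≤ 2 * ∫⁻ τ in Ioi (0 : ℝ), L τ f ^ r := by
            rw [← lintegral_iUnion (fun k => measurableSet_Ioc) pairwise_disjoint_Ioc_two_zpow]
            gcongr
            refine iUnion_subset fun k τ hτ => ?_
            exact lt_trans (by positivity) hτ.1
        _ ≤ 2 * (C ^ r * Z ^ (r / p)) := by
            gcongr
            exact (htest f hfm).trans (by gcongr)
    rcases eq_or_ne Z 0 with hZ0 | hZ0
    · rw [hZ0]; exact zero_le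
    have h1 : Z ^ ((p - r) / p) ≤ 2 * C ^ r := by
      have h2 : Z ^ ((p - r) / p) * Z ^ (r / p) ≤ 2 * C ^ r * Z ^ (r / p) := by
        rw [← ENNReal.rpow_add _ _ hZ0 hZt]
        have h3 : (p - r) / p + r / p = 1 := by field_simp; ring
        rw [h3, ENNReal.rpow_one, mul_assoc]
        exact hlow
      exact (ENNReal.mul_le_mul_iff_left (by simp [hZ0, hZt])
        (ENNReal.rpow_ne_top_of_nonneg (by positivity) hZt)).1 h2
    calc Z = (Z ^ ((p - r) / p)) ^ (p / (p - r)) := by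
          rw [← ENNReal.rpow_mul, div_mul_div_comm, mul_comm p, div_self (by positivity),
            ENNReal.rpow_one]
      _ ≤ _ := ENNReal.rpow_le_rpow h1 (by positivity)
  have hfinset : ∀ s : Finset ℤ, ∑ k ∈ s, T k ^ (p / (p - r)) * B (2 ^ k) ^ ρ ≤
      2 ^ ρ * (2 * C ^ r) ^ (p / (p - r)) := by
    intro s
    have hsup : ∀ x : ℝ≥0∞, x ^ ρ = ⨆ n : ℕ, (min x n) ^ ρ := fun x => by
      rw [← ennreal_iSup_rpow _ hρ0]
      congr 1
      rw [← inf_iSup_eq, ENNReal.iSup_natCast, inf_top_eq]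
    have hmono : ∀ k, Monotone fun n : ℕ => T k ^ (p / (p - r)) * (min (B (2 ^ k)) n) ^ ρ := by
      intro k m n hmn
      simp only
      gcongr
    calc ∑ k ∈ s, T k ^ (p / (p - r)) * B (2 ^ k) ^ ρ
        = ∑ k ∈ s, ⨆ n : ℕ, T k ^ (p / (p - r)) * (min (B (2 ^ k)) n) ^ ρ := by
          refine Finset.sum_congr rfl fun k _ => ?_
          rw [hsup, ENNReal.mul_iSup]
      _ = ⨆ n : ℕ, ∑ k ∈ s, T k ^ (p / (p - r)) * (min (B (2 ^ k)) n) ^ ρ :=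
          ENNReal.finsetSum_iSup_of_monotone hmono
      _ ≤ _ := by
          refine iSup_le fun n => ?_
          calc ∑ k ∈ s, T k ^ (p / (p - r)) * (min (B (2 ^ k)) n) ^ ρ
              = 2 ^ ρ * ∑ k ∈ s, T k ^ (p / (p - r)) * (min (B (2 ^ k)) n / 2) ^ ρ := by
                rw [Finset.mul_sum]
                refine Finset.sum_congr rfl fun k _ => ?_
                rw [mul_left_comm, ← ENNReal.mul_rpow_of_nonneg _ _ hρ0.le,
                  ENNReal.mul_div_cancel two_ne_zero (by simp)]
            _ ≤ _ := by
                gcongr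
                exact hclaim s n
  calc ∫⁻ τ in Ioi (0 : ℝ), ENNReal.ofReal τ ^ e * B τ ^ ρ
      ≤ ∫⁻ τ in ⋃ k : ℤ, Ioc ((2 : ℝ) ^ k) (2 ^ (k + 1)), ENNReal.ofReal τ ^ e * B τ ^ ρ :=
        lintegral_mono_set iUnion_Ioc_two_zpow
    _ ≤ ∑' k : ℤ, ∫⁻ τ in Ioc ((2 : ℝ) ^ k) (2 ^ (k + 1)), ENNReal.ofReal τ ^ e * B τ ^ ρ :=
        lintegral_iUnion_le _ _
    _ ≤ ∑' k : ℤ, 2 ^ e * (T k ^ (p / (p - r)) * B (2 ^ k) ^ ρ) := by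
        refine ENNReal.tsum_le_tsum fun k => ?_
        calc ∫⁻ τ in Ioc ((2 : ℝ) ^ k) (2 ^ (k + 1)), ENNReal.ofReal τ ^ e * B τ ^ ρ
            ≤ ∫⁻ _ in Ioc ((2 : ℝ) ^ k) (2 ^ (k + 1)), T (k + 1) ^ e * B (2 ^ k) ^ ρ := by
              refine setLIntegral_mono' measurableSet_Ioc fun τ hτ => ?_
              gcongr
              · exact ENNReal.ofReal_le_ofReal hτ.2
              · exact hB hτ.1.le
          _ = T (k + 1) ^ e * B (2 ^ k) ^ ρ * T k := by
              rw [setLIntegral_const, volume_Ioc_two_zpow]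
          _ = 2 ^ e * ((T k ^ (1 : ℝ) * T k ^ e) * B (2 ^ k) ^ ρ) := by
              rw [hT1, ENNReal.mul_rpow_of_nonneg _ _ he0.le, ENNReal.rpow_one]
              ring
          _ = _ := by
              rw [← ENNReal.rpow_add_of_nonneg _ _ zero_le_one he0.le, hee]
    _ = 2 ^ e * ∑' k : ℤ, T k ^ (p / (p - r)) * B (2 ^ k) ^ ρ := ENNReal.tsum_mul_left
    _ ≤ 2 ^ e * (2 ^ ρ * (2 * C ^ r) ^ (p / (p - r))) := by
        gcongr
        rw [ENNReal.tsum_eq_iSup_sum]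
        exact iSup_le hfinset
    _ = _ := by
        rw [ENNReal.mul_rpow_of_nonneg _ _ (by positivity), ← ENNReal.rpow_mul, hρ,
          mul_div_assoc p r, mul_comm p (r / _), div_mul_eq_mul_div, mul_div_assoc r p]
        ring

lemma exists_rearr_le {μ : Measure EReal} {a c : EReal} (hc : a < c) (hfin : μ (Ioi c) ≠ ⊤)
    {τ : ℝ} (hτ : 0 < τ) : ∃ n : ℕ, rearr μ a (2 ^ n * τ) ≤ c := by
  obtain ⟨n, hn⟩ := pow_unbounded_of_one_lt ((μ (Ioi c)).toReal / τ) one_lt_two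
  refine ⟨n, not_lt.1 fun h => ?_⟩
  rw [lt_rearr_iff hc, ENNReal.ofReal_lt_iff_lt_toReal (by positivity) hfin] at h
  rw [div_lt_iff₀ hτ] at hn
  exact lt_asymm h hn

/-- Truncation of a function to a bounded function with bounded support on the half-line. -/
def trunc (ω : ℝ → ℝ≥0∞) (n : ℕ) : ℝ → ℝ≥0∞ := (Iio (n : ℝ)).indicator fun τ => min (ω τ) n

lemma trunc_le (ω : ℝ → ℝ≥0∞) (n : ℕ) (τ : ℝ) : trunc ω n τ ≤ ω τ := by
  unfold trunc
  by_cases h : τ ∈ Iio (n : ℝ)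
  · rw [indicator_of_mem h]; exact min_le_left _ _
  · rw [indicator_of_notMem h]; exact zero_le

lemma trunc_mono (ω : ℝ → ℝ≥0∞) (τ : ℝ) : Monotone fun n => trunc ω n τ := by
  intro m n hmn
  simp only [trunc]
  have hmn' : (m : ℝ) ≤ n := by exact_mod_cast hmn
  by_cases h : τ ∈ Iio (m : ℝ)
  · rw [indicator_of_mem h, indicator_of_mem (show τ ∈ Iio (n : ℝ) from lt_of_lt_of_le h hmn')]
    gcongr
  · rw [indicator_of_notMem h]; exact zero_le

lemma measurable_trunc {ω : ℝ → ℝ≥0∞} (hω : Measurable ω) (n : ℕ) : Measurable (trunc ω n) :=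
  (hω.min measurable_const).indicator measurableSet_Iio

lemma iSup_trunc (ω : ℝ → ℝ≥0∞) (τ : ℝ) : ⨆ n, trunc ω n τ = ω τ := by
  apply le_antisymm (iSup_le fun n => trunc_le ω n τ)
  have h : ω τ = ⨆ n : ℕ, min (ω τ) n := by
    rw [← inf_iSup_eq, ENNReal.iSup_natCast, inf_top_eq]
  rw [h]
  refine iSup_le fun n => ?_
  obtain ⟨m, hm⟩ := exists_nat_gt τ
  refine le_iSup_of_le (max m n) ?_
  have : τ ∈ Iio ((max m n : ℕ) : ℝ) :=
    hm.trans_le (by exact_mod_cast le_max_left m n)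
  rw [trunc, indicator_of_mem this]
  gcongr
  exact le_max_right _ _

lemma lintegral_trunc_ne_top (ω : ℝ → ℝ≥0∞) (n : ℕ) :
    ∫⁻ τ in Ioi (0 : ℝ), trunc ω n τ ≠ ⊤ := by
  unfold trunc
  rw [setLIntegral_indicator measurableSet_Iio]
  refine ne_top_of_le_ne_top ?_ (setLIntegral_mono' (measurableSet_Iio.inter measurableSet_Ioi)
    fun τ _ => min_le_right (ω τ) n)
  rw [setLIntegral_const]
  refine ENNReal.mul_ne_top (ENNReal.natCast_ne_top n) ?_
  have : Iio (n : ℝ) ∩ Ioi 0 = Ioo 0 (n : ℝ) := by rw [inter_comm, Ioi_inter_Iio]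
  rw [this, Real.volume_Ioo]
  exact ENNReal.ofReal_ne_top

lemma lintegral_mul_eq_iSup_trunc {ω G : ℝ → ℝ≥0∞} (hω : Measurable ω) (hG : Measurable G)
    (S : Set ℝ) : ∫⁻ τ in S, G τ * ω τ = ⨆ n, ∫⁻ τ in S, G τ * trunc ω n τ := by
  rw [← lintegral_iSup]
  · refine lintegral_congr fun τ => ?_
    rw [← ENNReal.mul_iSup, iSup_trunc]
  · exact fun n => hG.mul (measurable_trunc hω n)
  · intro m n hmn τ
    have := trunc_mono ω τ hmn
    simp only at this ⊢
    gcongr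

lemma lintegral_eq_iSup_trunc {ω : ℝ → ℝ≥0∞} (hω : Measurable ω)
    (S : Set ℝ) : ∫⁻ τ in S, ω τ = ⨆ n, ∫⁻ τ in S, trunc ω n τ := by
  simpa using lintegral_mul_eq_iSup_trunc hω (G := fun _ => 1) measurable_const S

lemma ennreal_iSup_mul_iSup {f g : ℕ → ℝ≥0∞} (hf : Monotone f) (hg : Monotone g) :
    (⨆ n, f n) * ⨆ n, g n = ⨆ n, f n * g n := by
  apply le_antisymm
  · rw [ENNReal.iSup_mul]
    refine iSup_le fun m => ?_
    rw [ENNReal.mul_iSup]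
    refine iSup_le fun n => le_iSup_of_le (max m n) ?_
    exact mul_le_mul' (hf (le_max_left _ _)) (hg (le_max_right _ _))
  · exact iSup_le fun n => mul_le_mul' (le_iSup f n) (le_iSup g n)

/-- The image under `Y` of the measure with density `ω` on the half-line. -/
def push (ω : ℝ → ℝ≥0∞) (Y : ℝ → EReal) : Measure EReal :=
  ((volume.restrict (Ioi (0 : ℝ))).withDensity ω).map Y

lemma lintegral_push {ω : ℝ → ℝ≥0∞} {Y : ℝ → EReal} (hω : Measurable ω) (hY : Measurable Y)
    {G : EReal → ℝ≥0∞} (hG : Measurable G) :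
    ∫⁻ x, G x ∂(push ω Y) = ∫⁻ τ in Ioi (0 : ℝ), G (Y τ) * ω τ := by
  rw [push, lintegral_map hG hY, lintegral_withDensity_eq_lintegral_mul _ hω
    (g := fun τ => G (Y τ)) (hG.comp hY)]
  refine lintegral_congr fun τ => ?_
  rw [Pi.mul_apply, mul_comm]

lemma push_apply {ω : ℝ → ℝ≥0∞} {Y : ℝ → EReal} (hY : Measurable Y)
    {S : Set EReal} (hS : MeasurableSet S) :
    push ω Y S = ∫⁻ τ in {τ | 0 < τ ∧ Y τ ∈ S}, ω τ := by
  rw [push, Measure.map_apply hY hS, withDensity_apply _ (hY hS),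
    Measure.restrict_restrict (hY hS)]
  congr 2
  ext τ
  exact and_comm

/-- Sufficiency part of the weighted Hardy inequality for `r < p`, in rearranged form. -/
lemma hardy_sufficiency {p r : ℝ} (hp : 1 ≤ p) (hr : 0 < r) (hrp : r < p) :
    ∃ K : ℝ≥0∞, K ≠ ⊤ ∧ ∀ (a b : EReal) (v f ω : ℝ → ℝ≥0∞) (Y : ℝ → EReal), a ≤ b →
      IsWeight a b v → Measurable f → Measurable ω → Measurable Y → (∀ τ, Y τ ≤ b) →
      ∫⁻ τ in Ioi (0 : ℝ), seg f a (Y τ) ^ r * ω τ ≤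
        K * ((∫⁻ τ in Ioi (0 : ℝ), Vp p v a (Y τ) ^ (p * r / (p - r)) *
          (∫⁻ σ in {σ | 0 < σ ∧ Y τ ≤ Y σ}, ω σ) ^ (r / (p - r)) * ω τ) ^ ((p - r) / p) *
          seg (dens p v f) a b ^ (r / p)) := by
  obtain ⟨K, hK, hdy⟩ := lintegral_rpow_le_of_dyadic hr
  have hp0 : 0 < p := by linarith
  have hpr : 0 < p - r := sub_pos.2 hrp
  refine ⟨K, hK, ?_⟩
  intro a b v f ω₀ Y hab hv hf hω₀ hY hYb
  have hG : Measurable fun x : EReal => seg f a x ^ r := (measurable_seg_left f a).pow_const r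
  rw [lintegral_mul_eq_iSup_trunc hω₀ (G := fun τ => seg f a (Y τ) ^ r) (hG.comp hY)]
  refine iSup_le fun n => ?_
  set ω := trunc ω₀ n with hωdef
  have hω : Measurable ω := measurable_trunc hω₀ n
  set μ := push ω Y with hμ
  have hfin : ∀ c : EReal, μ (Ioi c) ≠ ⊤ := by
    intro c
    rw [hμ, push_apply hY measurableSet_Ioi]
    exact ne_top_of_le_ne_top (lintegral_trunc_ne_top ω₀ n)
      (lintegral_mono_set fun τ hτ => hτ.1)
  have hb0 : μ (Ioi b) = 0 := by
    rw [hμ, push_apply hY measurableSet_Ioi]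
    have : {τ | 0 < τ ∧ Y τ ∈ Ioi b} = ∅ := by
      ext τ
      simp only [mem_ofPred_eq, mem_empty_iff_false, iff_false, not_and, mem_Ioi, not_lt]
      exact fun _ => hYb τ
    rw [this, setLIntegral_empty]
  set X := rearr μ a with hX
  have hXanti : Antitone X := rearr_antitone μ a
  have hXm : Measurable X := hXanti.measurable
  have hVm : Measurable fun x : EReal => Vp p v a x := (Vp_mono hp v a).measurable
  set N : EReal → ℝ≥0∞ := fun x => μ (Ici x) with hN
  have hNm : Measurable N := by
    have : Antitone N := fun x y h => measure_mono (Ici_subset_Ici.2 h)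
    exact this.measurable
  calc ∫⁻ τ in Ioi (0 : ℝ), seg f a (Y τ) ^ r * ω τ
      = ∫⁻ x, seg f a x ^ r ∂μ := (lintegral_push hω hY hG).symm
    _ = ∫⁻ x in Ioi a, seg f a x ^ r ∂μ := by
        rw [← lintegral_indicator measurableSet_Ioi]
        refine lintegral_congr fun x => ?_
        by_cases hx : x ∈ Ioi a
        · rw [indicator_of_mem hx]
        · rw [indicator_of_notMem hx, seg_eq_zero (not_lt.1 hx), ENNReal.zero_rpow_of_pos hr]
    _ = ∫⁻ σ in Ioi (0 : ℝ), (Ioi a).indicator (fun x => seg f a x ^ r) (X σ) :=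
        setLIntegral_Ioi_eq_rearr (fun c _ => hfin c) hG
    _ ≤ ∫⁻ σ in Ioi (0 : ℝ), seg f a (X σ) ^ r :=
        lintegral_mono fun σ => indicator_le_self _ _ _
    _ ≤ K * ∫⁻ σ in Ioi (0 : ℝ), seg f (X (2 * σ)) (X σ) ^ r := by
        refine hdy _ _ (measurable_seg hf (hXm.comp (measurable_const_mul _)) hXm) fun σ hσ => ?_
        have := seg_le_tsum f a (fun j => X (2 ^ j * σ)) fun t ht =>
          exists_rearr_le ht (hfin t) hσ
        simpa [pow_succ', mul_assoc] using this
    _ ≤ K * ∫⁻ σ in Ioi (0 : ℝ), Vp p v a (X σ) ^ r *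
          seg (dens p v f) (X (2 * σ)) (X σ) ^ (r / p) := by
        gcongr with σ
        calc seg f (X (2 * σ)) (X σ) ^ r
            ≤ (Vp p v a (X σ) * seg (dens p v f) (X (2 * σ)) (X σ) ^ (1 / p)) ^ r := by
              gcongr
              exact seg_le_Vp_mul hp hv hf (le_rearr _ _ _) (rearr_le hab hb0 _)
          _ = _ := by
              rw [ENNReal.mul_rpow_of_nonneg _ _ hr.le, ← ENNReal.rpow_mul]
              congr 2
              ring
    _ ≤ K * ((∫⁻ σ in Ioi (0 : ℝ), ENNReal.ofReal σ ^ (r / (p - r)) *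
          Vp p v a (X σ) ^ (p * r / (p - r))) ^ ((p - r) / p) *
          seg (dens p v f) a b ^ (r / p)) := by
        gcongr
        exact lintegral_rpow_mul_seg_le hr hrp hXanti (le_rearr _ _) (fun τ _ => rearr_le hab hb0 τ)
          (measurable_dens p hv.1 hf) (hVm.comp hXm)
    _ ≤ _ := by
        refine mul_le_mul' le_rfl (mul_le_mul' (ENNReal.rpow_le_rpow ?_ (by positivity)) le_rfl)
        calc ∫⁻ σ in Ioi (0 : ℝ), ENNReal.ofReal σ ^ (r / (p - r)) *
              Vp p v a (X σ) ^ (p * r / (p - r))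
            ≤ ∫⁻ σ in Ioi (0 : ℝ), (Ioi a).indicator (fun x =>
                Vp p v a x ^ (p * r / (p - r)) * N x ^ (r / (p - r))) (X σ) := by
              refine lintegral_mono fun σ => ?_
              by_cases hx : a < X σ
              · rw [indicator_of_mem (show X σ ∈ Ioi a from hx), mul_comm]
                gcongr
                exact le_measure_Ici_rearr (fun c _ => hfin c) hx
              · have : X σ = a := le_antisymm (not_lt.1 hx) (le_rearr _ _ _)
                rw [this, Vp_self hp, ENNReal.zero_rpow_of_pos (by positivity), mul_zero]
                exact zero_le
          _ = ∫⁻ x in Ioi a, Vp p v a x ^ (p * r / (p - r)) * N x ^ (r / (p - r)) ∂μ :=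
              (setLIntegral_Ioi_eq_rearr (fun c _ => hfin c)
                ((hVm.pow_const _).mul (hNm.pow_const _))).symm
          _ ≤ ∫⁻ x, Vp p v a x ^ (p * r / (p - r)) * N x ^ (r / (p - r)) ∂μ :=
              setLIntegral_le_lintegral _ _
          _ = ∫⁻ τ in Ioi (0 : ℝ), Vp p v a (Y τ) ^ (p * r / (p - r)) *
              N (Y τ) ^ (r / (p - r)) * ω τ :=
              lintegral_push hω hY ((hVm.pow_const _).mul (hNm.pow_const _))
          _ ≤ ∫⁻ τ in Ioi (0 : ℝ), Vp p v a (Y τ) ^ (p * r / (p - r)) *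
              (∫⁻ σ in {σ | 0 < σ ∧ Y τ ≤ Y σ}, ω₀ σ) ^ (r / (p - r)) * ω₀ τ := by
              refine lintegral_mono fun τ => ?_
              have h1 : N (Y τ) ≤ ∫⁻ σ in {σ | 0 < σ ∧ Y τ ≤ Y σ}, ω₀ σ := by
                rw [hN]
                simp only
                rw [hμ, push_apply hY measurableSet_Ici]
                exact lintegral_mono fun σ => trunc_le _ _ _
              have h2 : ω τ ≤ ω₀ τ := trunc_le _ _ _
              gcongr

/-- Necessity part of the weighted Hardy inequality for `r < p`, in rearranged form. -/
lemma hardy_necessity {p r : ℝ} (hp : 1 ≤ p) (hr : 0 < r) (hrp : r < p) :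
    ∃ K : ℝ≥0∞, K ≠ ⊤ ∧ ∀ (a b : EReal) (v ω : ℝ → ℝ≥0∞) (Y : ℝ → EReal) (C : ℝ≥0∞), a ≤ b →
      IsWeight a b v → Measurable ω → Measurable Y → (∀ τ, a ≤ Y τ) → (∀ τ, Y τ ≤ b) →
      (∀ f, Measurable f → ∫⁻ τ in Ioi (0 : ℝ), seg f a (Y τ) ^ r * ω τ ≤
        C ^ r * seg (dens p v f) a b ^ (r / p)) →
      ∫⁻ τ in Ioi (0 : ℝ), Vp p v a (Y τ) ^ (p * r / (p - r)) *
          (∫⁻ σ in {σ | 0 < σ ∧ Y τ < Y σ}, ω σ) ^ (r / (p - r)) * ω τ ≤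
        K * C ^ (p * r / (p - r)) := by
  obtain ⟨K, hK, htest⟩ := lintegral_le_of_test hr hrp
  have hp0 : 0 < p := by linarith
  have hpr : 0 < p - r := sub_pos.2 hrp
  have he0 : 0 < r / (p - r) := by positivity
  refine ⟨K, hK, ?_⟩
  intro a b v ω₀ Y C hab hv hω₀ hY hYa hYb hC
  have hVm : Measurable fun x : EReal => Vp p v a x := (Vp_mono hp v a).measurable
  have htail : ∀ (ω : ℝ → ℝ≥0∞), Measurable fun τ => ∫⁻ σ in {σ | 0 < σ ∧ Y τ < Y σ}, ω σ := by
    intro ω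
    have : Antitone fun x : EReal => ∫⁻ σ in {σ | 0 < σ ∧ x < Y σ}, ω σ := fun x y h =>
      lintegral_mono_set fun σ hσ => ⟨hσ.1, h.trans_lt hσ.2⟩
    exact this.measurable.comp hY
  have hlim : ∫⁻ τ in Ioi (0 : ℝ), Vp p v a (Y τ) ^ (p * r / (p - r)) *
      (∫⁻ σ in {σ | 0 < σ ∧ Y τ < Y σ}, ω₀ σ) ^ (r / (p - r)) * ω₀ τ =
      ⨆ n, ∫⁻ τ in Ioi (0 : ℝ), Vp p v a (Y τ) ^ (p * r / (p - r)) *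
      (∫⁻ σ in {σ | 0 < σ ∧ Y τ < Y σ}, trunc ω₀ n σ) ^ (r / (p - r)) * trunc ω₀ n τ := by
    have hmono : ∀ τ, Monotone fun n => Vp p v a (Y τ) ^ (p * r / (p - r)) *
        (∫⁻ σ in {σ | 0 < σ ∧ Y τ < Y σ}, trunc ω₀ n σ) ^ (r / (p - r)) := by
      intro τ m n hmn
      have : ∀ σ, trunc ω₀ m σ ≤ trunc ω₀ n σ := fun σ => trunc_mono ω₀ σ hmn
      simp only
      gcongr with σ
      exact this σ
    rw [← lintegral_iSup]
    · refine lintegral_congr fun τ => ?_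
      rw [← ennreal_iSup_mul_iSup (hmono τ) (trunc_mono ω₀ τ), iSup_trunc,
        ← ENNReal.mul_iSup, ← ennreal_iSup_rpow _ he0, ← lintegral_eq_iSup_trunc hω₀]
    · intro n
      exact (((hVm.comp hY).pow_const _).mul ((htail _).pow_const _)).mul (measurable_trunc hω₀ n)
    · intro m n hmn τ
      exact mul_le_mul' (hmono τ hmn) (trunc_mono ω₀ τ hmn)
  rw [hlim]
  refine iSup_le fun n => ?_
  set ω := trunc ω₀ n with hωdef
  have hω : Measurable ω := measurable_trunc hω₀ n
  set μ := push ω Y with hμ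
  have hfin : ∀ c : EReal, μ (Ioi c) ≠ ⊤ := by
    intro c
    rw [hμ, push_apply hY measurableSet_Ioi]
    exact ne_top_of_le_ne_top (lintegral_trunc_ne_top ω₀ n)
      (lintegral_mono_set fun τ hτ => hτ.1)
  have hb0 : μ (Ioi b) = 0 := by
    rw [hμ, push_apply hY measurableSet_Ioi]
    have : {τ | 0 < τ ∧ Y τ ∈ Ioi b} = ∅ := by
      ext τ
      simp only [mem_ofPred_eq, mem_empty_iff_false, iff_false, not_and, mem_Ioi, not_lt]
      exact fun _ => hYb τ
    rw [this, setLIntegral_empty]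
  set X := rearr μ a with hX
  have hXanti : Antitone X := rearr_antitone μ a
  have hXm : Measurable X := hXanti.measurable
  set N : EReal → ℝ≥0∞ := fun x => μ (Ioi x) with hN
  have hNm : Measurable N := by
    have : Antitone N := fun x y h => measure_mono (Ioi_subset_Ioi h)
    exact this.measurable
  have hmain := htest a b v (fun σ f => seg f a (X σ)) (fun σ => Vp p v a (X σ)) C hv.1
    (fun f => (seg_monotone_right f a).comp_antitone hXanti)
    (fun σ f g α h => (lintegral_const_mul_le _ _).trans (seg_mono fun t _ => h t))
    (by
      intro f hf
      have hG : Measurable fun x : EReal => seg f a x ^ r := (measurable_seg_left f a).pow_const r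
      calc ∫⁻ σ in Ioi (0 : ℝ), seg f a (X σ) ^ r
          = ∫⁻ σ in Ioi (0 : ℝ), (Ioi a).indicator (fun x => seg f a x ^ r) (X σ) := by
            refine lintegral_congr fun σ => ?_
            by_cases hx : X σ ∈ Ioi a
            · rw [indicator_of_mem hx]
            · rw [indicator_of_notMem hx, seg_eq_zero (not_lt.1 hx), ENNReal.zero_rpow_of_pos hr]
        _ = ∫⁻ x in Ioi a, seg f a x ^ r ∂μ :=
            (setLIntegral_Ioi_eq_rearr (fun c _ => hfin c) hG).symm
        _ ≤ ∫⁻ x, seg f a x ^ r ∂μ := setLIntegral_le_lintegral _ _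
        _ = ∫⁻ τ in Ioi (0 : ℝ), seg f a (Y τ) ^ r * ω τ := lintegral_push hω hY hG
        _ ≤ ∫⁻ τ in Ioi (0 : ℝ), seg f a (Y τ) ^ r * ω₀ τ := by
            gcongr with τ
            exact trunc_le _ _ _
        _ ≤ _ := hC f hf)
    ((Vp_mono hp v a).comp_antitone hXanti)
    (fun σ _ => Vp_le_iSup hp hv (rearr_le hab hb0 σ))
  refine le_trans ?_ hmain
  calc ∫⁻ τ in Ioi (0 : ℝ), Vp p v a (Y τ) ^ (p * r / (p - r)) *
        (∫⁻ σ in {σ | 0 < σ ∧ Y τ < Y σ}, ω σ) ^ (r / (p - r)) * ω τ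
      = ∫⁻ τ in Ioi (0 : ℝ), Vp p v a (Y τ) ^ (p * r / (p - r)) *
        N (Y τ) ^ (r / (p - r)) * ω τ := by
        refine lintegral_congr fun τ => ?_
        rw [hN]
        simp only
        rw [hμ, push_apply hY measurableSet_Ioi]
        rfl
    _ = ∫⁻ x, Vp p v a x ^ (p * r / (p - r)) * N x ^ (r / (p - r)) ∂μ :=
        (lintegral_push hω hY ((hVm.pow_const _).mul (hNm.pow_const _))).symm
    _ = ∫⁻ x in Ioi a, Vp p v a x ^ (p * r / (p - r)) * N x ^ (r / (p - r)) ∂μ := by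
        rw [← lintegral_indicator measurableSet_Ioi]
        refine lintegral_congr_ae ?_
        have hae : ∀ᵐ x ∂μ, a ≤ x := by
          rw [ae_iff]
          have h1 : {x | ¬ a ≤ x} = Iio a := by ext x; simp
          rw [h1, hμ, push_apply hY measurableSet_Iio]
          have : {τ | 0 < τ ∧ Y τ ∈ Iio a} = ∅ := by
            ext τ
            simp only [mem_ofPred_eq, mem_empty_iff_false, iff_false, not_and, mem_Iio, not_lt]
            exact fun _ => hYa τ
          rw [this, setLIntegral_empty]
        filter_upwards [hae] with x hx
        rcases hx.eq_or_lt with rfl | hlt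
        · rw [indicator_of_notMem (by simp), Vp_self hp, ENNReal.zero_rpow_of_pos (by positivity),
            zero_mul]
        · rw [indicator_of_mem (show x ∈ Ioi a from hlt)]
    _ = ∫⁻ σ in Ioi (0 : ℝ), (Ioi a).indicator (fun x =>
          Vp p v a x ^ (p * r / (p - r)) * N x ^ (r / (p - r))) (X σ) :=
        setLIntegral_Ioi_eq_rearr (fun c _ => hfin c) ((hVm.pow_const _).mul (hNm.pow_const _))
    _ ≤ ∫⁻ σ in Ioi (0 : ℝ), ENNReal.ofReal σ ^ (r / (p - r)) *
          Vp p v a (X σ) ^ (p * r / (p - r)) := by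
        refine lintegral_mono fun σ => ?_
        by_cases hx : X σ ∈ Ioi a
        · rw [indicator_of_mem hx, mul_comm]
          gcongr
          exact measure_Ioi_rearr_le hx
        · rw [indicator_of_notMem hx]
          exact zero_le

lemma setLIntegral_initial_le {η ω : ℝ → ℝ≥0∞} {I : Set ℝ}
    (hI : MeasurableSet I) (hI0 : I ⊆ Ioi 0)
    (hinit : ∀ τ ∈ I, ∀ σ, 0 < σ → σ ≤ τ → σ ∈ I)
    (h1 : ∀ τ, 0 < τ → η τ ≤ ω (2 * τ))
    (h2 : ∀ τ, 0 < τ → η τ ≤ (∫⁻ σ in Ioo 0 τ, ω σ) * (ENNReal.ofReal τ)⁻¹) :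
    ∫⁻ τ in I, η τ ≤ 2 * ∫⁻ τ in I, ω τ := by
  set I₁ : Set ℝ := {τ | 0 < τ ∧ 2 * τ ∈ I} with hI₁
  set T : Set ℝ := {τ | τ ∈ I ∧ 2 * τ ∉ I} with hT
  have hsub : I ⊆ I₁ ∪ T := by
    intro τ hτ
    by_cases h : 2 * τ ∈ I
    · exact Or.inl ⟨hI0 hτ, h⟩
    · exact Or.inr ⟨hτ, h⟩
  have hA : ∫⁻ τ in I₁, η τ ≤ ∫⁻ τ in I, ω τ := by
    have hm : MeasurableSet {τ : ℝ | 2 * τ ∈ I} := (measurable_const_mul (2 : ℝ)) hI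
    calc ∫⁻ τ in I₁, η τ = ∫⁻ τ in Ioi (0 : ℝ), {τ : ℝ | 2 * τ ∈ I}.indicator η τ := by
          rw [setLIntegral_indicator hm, inter_comm]
          rfl
      _ ≤ ∫⁻ τ in Ioi (0 : ℝ), I.indicator ω (2 * τ) := by
          refine setLIntegral_mono' measurableSet_Ioi fun τ hτ => ?_
          by_cases h : 2 * τ ∈ I
          · rw [indicator_of_mem (show τ ∈ {τ : ℝ | 2 * τ ∈ I} from h), indicator_of_mem h]
            exact h1 τ hτ
          · rw [indicator_of_notMem (show τ ∉ {τ : ℝ | 2 * τ ∈ I} from h)]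
            exact zero_le
      _ = ENNReal.ofReal 2⁻¹ * ∫⁻ τ in Ioi (0 : ℝ), I.indicator ω τ :=
          setLIntegral_scale two_pos _
      _ ≤ 1 * ∫⁻ τ in I, ω τ := by
          rw [setLIntegral_indicator hI, inter_eq_left.2 hI0]
          gcongr
          rw [← ENNReal.ofReal_one]
          exact ENNReal.ofReal_le_ofReal (by norm_num)
      _ = _ := one_mul _
  have hB : ∫⁻ τ in T, η τ ≤ ∫⁻ τ in I, ω τ := by
    obtain ⟨y, hy, hTy⟩ := exists_subset_Icc_half (T := T) (fun τ h => hI0 h.1) (by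
      intro τ hτ τ' hτ'
      by_contra hlt
      exact hτ.2 (hinit τ' hτ'.1 _ (by have := hI0 hτ.1; simp only [mem_Ioi] at this; linarith)
        (not_le.1 hlt).le))
    have hTm : MeasurableSet T := hI.diff ((measurable_const_mul (2 : ℝ)) hI)
    calc ∫⁻ τ in T, η τ ≤ ∫⁻ τ in T, (∫⁻ σ in I, ω σ) * (ENNReal.ofReal τ)⁻¹ := by
          refine setLIntegral_mono' hTm fun τ hτ => (h2 τ (hI0 hτ.1)).trans ?_
          gcongr
          exact fun σ hσ => hinit τ hτ.1 σ hσ.1 hσ.2.le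
      _ ≤ ∫⁻ τ in Icc (y / 2) y, (∫⁻ σ in I, ω σ) * (ENNReal.ofReal τ)⁻¹ := lintegral_mono_set hTy
      _ = (∫⁻ σ in I, ω σ) * ∫⁻ τ in Icc (y / 2) y, (ENNReal.ofReal τ)⁻¹ :=
          lintegral_const_mul _ ENNReal.measurable_ofReal.inv
      _ ≤ (∫⁻ σ in I, ω σ) * 1 := by
          gcongr
          exact lintegral_inv_Icc_half hy
      _ = _ := mul_one _
  calc ∫⁻ τ in I, η τ ≤ ∫⁻ τ in I₁ ∪ T, η τ := lintegral_mono_set hsub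
    _ ≤ (∫⁻ τ in I₁, η τ) + ∫⁻ τ in T, η τ := lintegral_union_le _ _ _
    _ ≤ (∫⁻ τ in I, ω τ) + ∫⁻ τ in I, ω τ := add_le_add hA hB
    _ = _ := (two_mul _).symm

lemma lintegral_mul_eq_layercake {G η : ℝ → ℝ≥0∞} (hG : Measurable G) (hη : Measurable η) :
    ∫⁻ τ in Ioi (0 : ℝ), G τ * η τ =
      ∫⁻ s in Ioi (0 : ℝ), ∫⁻ τ in {τ | 0 < τ ∧ ENNReal.ofReal s < G τ}, η τ := by
  set D : Set (ℝ × ℝ) := {z | ENNReal.ofReal z.2 < G z.1} with hD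
  have hDm : MeasurableSet D := measurableSet_lt (ENNReal.measurable_ofReal.comp measurable_snd)
    (hG.comp measurable_fst)
  set Φ : ℝ × ℝ → ℝ≥0∞ := D.indicator fun z => η z.1 with hΦ
  have hΦm : Measurable Φ := (hη.comp measurable_fst).indicator hDm
  calc ∫⁻ τ in Ioi (0 : ℝ), G τ * η τ
      = ∫⁻ τ in Ioi (0 : ℝ), ∫⁻ s in Ioi (0 : ℝ), Φ (τ, s) := by
        refine lintegral_congr fun τ => ?_
        have hm : MeasurableSet {s : ℝ | ENNReal.ofReal s < G τ} :=
          measurableSet_lt ENNReal.measurable_ofReal measurable_const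
        have h : ∀ s, Φ (τ, s) = {s : ℝ | ENNReal.ofReal s < G τ}.indicator (fun _ => η τ) s := by
          intro s
          by_cases h : ENNReal.ofReal s < G τ
          · rw [hΦ, indicator_of_mem (show (τ, s) ∈ D from h),
              indicator_of_mem (show s ∈ {s : ℝ | ENNReal.ofReal s < G τ} from h)]
          · rw [hΦ, indicator_of_notMem (show (τ, s) ∉ D from h),
              indicator_of_notMem (show s ∉ {s : ℝ | ENNReal.ofReal s < G τ} from h)]
        simp only [h]
        rw [setLIntegral_indicator hm, setLIntegral_const, ← volume_pos_ofReal_lt (G τ), mul_comm,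
          inter_comm]
        congr 2
        ext s
        simp [volume_pos_ofReal_lt]
    _ = ∫⁻ s in Ioi (0 : ℝ), ∫⁻ τ in Ioi (0 : ℝ), Φ (τ, s) :=
        lintegral_lintegral_swap hΦm.aemeasurable
    _ = _ := by
        refine lintegral_congr fun s => ?_
        have hm : MeasurableSet {τ : ℝ | ENNReal.ofReal s < G τ} :=
          measurableSet_lt measurable_const hG
        have h : ∀ τ, Φ (τ, s) = {τ : ℝ | ENNReal.ofReal s < G τ}.indicator η τ := by
          intro τ
          by_cases h : ENNReal.ofReal s < G τ
          · rw [hΦ, indicator_of_mem (show (τ, s) ∈ D from h),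
              indicator_of_mem (show τ ∈ {τ : ℝ | ENNReal.ofReal s < G τ} from h)]
          · rw [hΦ, indicator_of_notMem (show (τ, s) ∉ D from h),
              indicator_of_notMem (show τ ∉ {τ : ℝ | ENNReal.ofReal s < G τ} from h)]
        simp only [h]
        rw [setLIntegral_indicator hm, inter_comm]
        rfl

/-- Integrals of a decreasing function against comparable weights. -/
lemma lintegral_antitone_mul_le {G η ω : ℝ → ℝ≥0∞} (hG : Antitone G) (hη : Measurable η)
    (hω : Measurable ω) (h1 : ∀ τ, 0 < τ → η τ ≤ ω (2 * τ))
    (h2 : ∀ τ, 0 < τ → η τ ≤ (∫⁻ σ in Ioo 0 τ, ω σ) * (ENNReal.ofReal τ)⁻¹) :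
    ∫⁻ τ in Ioi (0 : ℝ), G τ * η τ ≤ 2 * ∫⁻ τ in Ioi (0 : ℝ), G τ * ω τ := by
  rw [lintegral_mul_eq_layercake hG.measurable hη, lintegral_mul_eq_layercake hG.measurable hω,
    ← lintegral_const_mul' _ _ (by simp)]
  refine lintegral_mono fun s => setLIntegral_initial_le
    (measurableSet_Ioi.inter (measurableSet_lt measurable_const hG.measurable))
    (fun τ hτ => hτ.1) (fun τ hτ σ hσ hle => ⟨hσ, hτ.2.trans_le (hG hle)⟩) h1 h2

lemma Vp_pos {p : ℝ} {a b : EReal} {v : ℝ → ℝ≥0∞} (hp : 1 ≤ p) (hv : IsWeight a b v) {x : EReal}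
    (hax : a < x) (hx : x ≤ b) : 0 < Vp p v a x := by
  have hfin : ∀ t ∈ io a x, v t ≠ ⊤ := fun t ht => (hv.2 t (io_subset_io le_rfl hx ht)).2.ne
  unfold Vp
  split_ifs with h1
  · rw [pos_iff_ne_zero]
    intro h0
    have hae : ∀ᵐ t ∂(volume.restrict (io a x)), (v t)⁻¹ = 0 := by
      filter_upwards [ae_le_essSup (fun s => (v s)⁻¹) (μ := volume.restrict (io a x))] with t ht
      rw [h0] at ht
      exact le_antisymm ht zero_le
    have hbot : volume.restrict (io a x) = 0 := by
      rw [← ae_eq_bot, ← Filter.eventually_false_iff_eq_bot]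
      filter_upwards [hae, ae_restrict_mem (measurableSet_io a x)] with t ht hta
      exact hfin t hta (ENNReal.inv_eq_zero.1 ht)
    rw [Measure.restrict_eq_zero] at hbot
    exact (io_nonempty_pos hax).ne' hbot
  · have hp1 : 0 < p - 1 := sub_pos.2 (lt_of_le_of_ne hp (Ne.symm h1))
    have hp0 : 0 < p := by linarith
    refine ENNReal.rpow_pos_of_nonneg ?_ (by positivity)
    refine seg_pos (hv.1.pow_const _) hax fun t ht => ?_
    rw [ENNReal.rpow_neg, ENNReal.inv_pos]
    exact ENNReal.rpow_ne_top_of_nonneg (by positivity) (hfin t ht)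

/-- The supremum over `t` in `(a, x)` of `(∫_t^x u)^α * V_p(a,t)^β`. -/
def wsup (p : ℝ) (u v : ℝ → ℝ≥0∞) (a : EReal) (α β : ℝ) (x : EReal) : ℝ≥0∞ :=
  ⨆ (t : ℝ) (_ : t ∈ io a x), seg u t x ^ α * Vp p v a t ^ β

lemma wsup_mono (p : ℝ) (u v : ℝ → ℝ≥0∞) (a : EReal) {α : ℝ} (β : ℝ) (hα : 0 ≤ α) :
    Monotone (wsup p u v a α β) := by
  intro x y h
  refine iSup₂_le fun t ht => ?_
  refine le_trans ?_ (le_iSup₂ (f := fun (t : ℝ) (_ : t ∈ io a y) => seg u t y ^ α * Vp p v a t ^ β)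
    t (io_subset_io le_rfl h ht))
  gcongr
  exact seg_mono_set u le_rfl h

lemma wsup_self (p : ℝ) (u v : ℝ → ℝ≥0∞) (a : EReal) (α β : ℝ) : wsup p u v a α β a = 0 := by
  simp [wsup, io_eq_empty le_rfl]

lemma wsup_rpow (p : ℝ) (u v : ℝ → ℝ≥0∞) (a : EReal) (α β : ℝ) {s : ℝ} (hs : 0 < s) (x : EReal) :
    wsup p u v a α β x ^ s = wsup p u v a (α * s) (β * s) x := by
  simp only [wsup, ennreal_iSup_rpow _ hs, ENNReal.mul_rpow_of_nonneg _ _ hs.le, ENNReal.rpow_mul]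

lemma seg_mul_Vp_le_wsup {p : ℝ} (hp : 1 ≤ p) (u v : ℝ → ℝ≥0∞) {a : EReal} {α β : ℝ} (hα : 0 < α)
    (hβ : 0 < β) {c x : EReal} (hc : a ≤ c) :
    seg u c x ^ α * Vp p v a c ^ β ≤ wsup p u v a α β x := by
  rcases hc.eq_or_lt with rfl | hac
  · rw [Vp_self hp, ENNReal.zero_rpow_of_pos hβ, mul_zero]
    exact zero_le
  rcases le_or_gt x c with hxc | hcx
  · rw [seg_eq_zero hxc, ENNReal.zero_rpow_of_pos hα, zero_mul]
    exact zero_le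
  lift c to ℝ using ⟨(hcx.trans_le le_top).ne, (bot_le.trans_lt hac).ne'⟩
  exact le_iSup₂ (f := fun (t : ℝ) (_ : t ∈ io a x) => seg u t x ^ α * Vp p v a t ^ β) c ⟨hac, hcx⟩

lemma essSup_eq_wsup {p : ℝ} (hp : 1 ≤ p) (u v : ℝ → ℝ≥0∞) (a : EReal) {α β : ℝ} (hα : 0 < α)
    (hβ : 0 ≤ β) (x : EReal) :
    essSup (fun t : ℝ => seg u t x ^ α * Vp p v a t ^ β) (volume.restrict (io a x)) =
      wsup p u v a α β x := by
  refine essSup_seg_mul u (Q := fun t : ℝ => Vp p v a t ^ β) (fun s t h => ?_) hα a x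
  exact ENNReal.rpow_le_rpow (Vp_mono hp v a (by exact_mod_cast h)) hβ

/-- `X` is the generalised inverse of the tail integral of `w` over `(a, b)`. -/
structure IsLevel (a b : EReal) (w : ℝ → ℝ≥0∞) (X : ℝ → EReal) : Prop where
  anti : Antitone X
  le_left : ∀ τ, a ≤ X τ
  le_right : ∀ τ, X τ ≤ b
  seg_eq : ∀ τ, 0 < τ → a < X τ → seg w (X τ) b = ENNReal.ofReal τ
  exists_le : ∀ (c : EReal) (τ : ℝ), a < c → 0 < τ → ∃ n : ℕ, X (2 ^ n * τ) ≤ c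
  lintegral_eq : ∀ G : EReal → ℝ≥0∞, Measurable G → G a = 0 →
    ∫⁻ x in io a b, G x * w x = ∫⁻ τ in Ioi (0 : ℝ), G (X τ)

lemma exists_isLevel {a b : EReal} {w : ℝ → ℝ≥0∞} (hab : a < b) (hw : Measurable w)
    (hfin : ∀ c, a < c → seg w c b ≠ ⊤) : ∃ X, IsLevel a b w X := by
  set μ : Measure EReal := ((volume.restrict (io a b)).withDensity w).map (fun x : ℝ => (x : EReal))
    with hμ
  have hcoe : Measurable fun x : ℝ => (x : EReal) := measurable_coe_real_ereal
  have happly : ∀ S : Set EReal, MeasurableSet S →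
      μ S = ∫⁻ x in {x : ℝ | (x : EReal) ∈ S} ∩ io a b, w x := by
    intro S hS
    rw [hμ, Measure.map_apply hcoe hS, withDensity_apply _ (hcoe hS),
      Measure.restrict_restrict (hcoe hS)]
    rfl
  have hIoi : ∀ c, a ≤ c → μ (Ioi c) = seg w c b := by
    intro c hc
    rw [happly _ measurableSet_Ioi, seg]
    congr 2
    ext x
    simp only [io, mem_inter_iff, mem_ofPred_eq, mem_Ioi]
    exact ⟨fun h => ⟨h.1, h.2.2⟩, fun h => ⟨h.1, hc.trans_lt h.1, h.2⟩⟩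
  have hIci : ∀ c, μ (Ici c) ≤ seg w c b := by
    intro c
    rw [happly _ measurableSet_Ici, seg]
    have hsub : {x : ℝ | (x : EReal) ∈ Ici c} ∩ io a b ⊆ io c b ∪ {x : ℝ | (x : EReal) = c} := by
      intro x hx
      rcases (show c ≤ x from hx.1).eq_or_lt with h | h
      · exact Or.inr h.symm
      · exact Or.inl ⟨h, hx.2.2⟩
    refine (lintegral_mono_set hsub).trans ((lintegral_union_le _ _ _).trans ?_)
    rw [setLIntegral_measure_zero _ _ (volume_coe_fiber c), add_zero]
  have hfin' : ∀ c, a < c → μ (Ioi c) ≠ ⊤ := fun c hc => by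
    rw [hIoi c hc.le]
    exact hfin c hc
  have hb0 : μ (Ioi b) = 0 := by rw [hIoi b hab.le, seg_eq_zero le_rfl]
  refine ⟨rearr μ a, rearr_antitone μ a, le_rearr μ a, rearr_le hab.le hb0, ?_, ?_, ?_⟩
  · intro τ hτ ha
    apply le_antisymm
    · rw [← hIoi _ ha.le]
      exact measure_Ioi_rearr_le ha
    · exact (le_measure_Ici_rearr hfin' ha).trans (hIci _)
  · exact fun c τ hc hτ => exists_rearr_le hc (hfin' c hc) hτ
  · intro G hG hGa
    calc ∫⁻ x in io a b, G x * w x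
        = ∫⁻ x, G x ∂μ := by
          rw [hμ, lintegral_map hG hcoe, lintegral_withDensity_eq_lintegral_mul _ hw
            (g := fun x : ℝ => G x) (hG.comp hcoe)]
          refine lintegral_congr fun x => ?_
          rw [Pi.mul_apply, mul_comm]
      _ = ∫⁻ x in Ioi a, G x ∂μ := by
          have hz : μ (Ioi a)ᶜ = 0 := by
            rw [happly _ measurableSet_Ioi.compl]
            refine setLIntegral_measure_zero _ _ (measure_mono_null (t := ∅) ?_ measure_empty)
            exact fun x hx => hx.1 hx.2.1
          rw [← lintegral_add_compl _ measurableSet_Ioi, setLIntegral_measure_zero _ _ hz, add_zero]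
      _ = ∫⁻ τ in Ioi (0 : ℝ), (Ioi a).indicator G (rearr μ a τ) :=
          setLIntegral_Ioi_eq_rearr hfin' hG
      _ = _ := by
          refine lintegral_congr fun τ => ?_
          by_cases h : rearr μ a τ ∈ Ioi a
          · rw [indicator_of_mem h]
          · rw [indicator_of_notMem h, le_antisymm (not_lt.1 h) (le_rearr μ a τ), hGa]

namespace IsLevel

variable {a b : EReal} {w : ℝ → ℝ≥0∞} {X : ℝ → EReal}

lemma le_of_le (h : IsLevel a b w X) {σ τ : ℝ} (hτ : 0 < τ) (hσ : 0 < σ) (ha : a < X τ)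
    (hle : X τ ≤ X σ) : σ ≤ τ := by
  have h1 : seg w (X σ) b ≤ seg w (X τ) b := seg_mono_set w hle le_rfl
  rw [h.seg_eq τ hτ ha, h.seg_eq σ hσ (ha.trans_le hle)] at h1
  exact (ENNReal.ofReal_le_ofReal_iff hτ.le).1 h1

lemma lt_of_lt (h : IsLevel a b w X) {σ τ : ℝ} (hσ : 0 < σ) (ha : a < X τ)
    (hlt : σ < τ) : X τ < X σ := by
  by_contra hn
  have hge := not_lt.1 hn
  exact absurd (h.le_of_le hσ (hσ.trans hlt) (ha.trans_le (h.anti hlt.le)) hge) (not_le.2 hlt)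

lemma lhsIter_rpow (h : IsLevel a b w X) {q r : ℝ} (hq : 0 < q) (hr : 0 < r)
    (u f : ℝ → ℝ≥0∞) :
    lhsIter a b q r u w f ^ r =
      ∫⁻ τ in Ioi (0 : ℝ), seg (fun t : ℝ => seg f a t ^ q * u t) a (X τ) ^ (r / q) := by
  rw [lhsIter, ← ENNReal.rpow_mul, one_div_mul_cancel hr.ne', ENNReal.rpow_one]
  refine h.lintegral_eq (fun x => seg (fun t : ℝ => seg f a t ^ q * u t) a x ^ (r / q))
    ((measurable_seg_left _ a).pow_const _) ?_
  rw [seg_eq_zero le_rfl, ENNReal.zero_rpow_of_pos (by positivity)]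

lemma C2_rpow (h : IsLevel a b w X) {p q r : ℝ} (hp : 1 ≤ p) (hq : 0 < q) (hr : 0 < r)
    (hrp : r < p) (u v : ℝ → ℝ≥0∞) :
    C2 a b p q r u v w ^ (p * r / (p - r)) =
      ∫⁻ τ in Ioi (0 : ℝ), ENNReal.ofReal τ ^ (r / (p - r)) *
        wsup p u v a (r * p / (q * (p - r))) (p * r / (p - r)) (X τ) := by
  have hp0 : 0 < p := by linarith
  have hpr : 0 < p - r := sub_pos.2 hrp
  have hα : 0 < r * p / (q * (p - r)) := by positivity
  have hβ : 0 < p * r / (p - r) := by positivity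
  rw [C2, ← ENNReal.rpow_mul, show (p - r) / (p * r) * (p * r / (p - r)) = 1 by field_simp,
    ENNReal.rpow_one]
  calc _ = ∫⁻ x in io a b, seg w x b ^ (r / (p - r)) *
        wsup p u v a (r * p / (q * (p - r))) (p * r / (p - r)) x * w x := by
        refine lintegral_congr fun x => ?_
        rw [← essSup_eq_wsup hp u v a hα hβ.le x, mul_right_comm]
        rfl
    _ = ∫⁻ τ in Ioi (0 : ℝ), seg w (X τ) b ^ (r / (p - r)) *
        wsup p u v a (r * p / (q * (p - r))) (p * r / (p - r)) (X τ) := by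
        refine h.lintegral_eq (fun x => seg w x b ^ (r / (p - r)) *
          wsup p u v a (r * p / (q * (p - r))) (p * r / (p - r)) x) ?_ ?_
        · exact ((seg_antitone_left w b).measurable.pow_const _).mul
            (wsup_mono p u v a _ hα.le).measurable
        · simp only [wsup_self, mul_zero]
    _ = _ := by
        refine setLIntegral_congr_fun measurableSet_Ioi fun τ hτ => ?_
        rcases (h.le_left τ).eq_or_lt with ha | ha
        · rw [← ha, wsup_self, mul_zero, mul_zero]
        · rw [h.seg_eq τ hτ ha]

lemma C3_rpow (h : IsLevel a b w X) {p q r : ℝ} (hp : 1 ≤ p) (hq : 0 < q) (hr : 0 < r)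
    (hrp : r < p) {u : ℝ → ℝ≥0∞} (v : ℝ → ℝ≥0∞) :
    C3 a b p q r u v w ^ (p * r / (p - r)) =
      ∫⁻ τ in Ioi (0 : ℝ), (∫⁻ σ in Ioi (0 : ℝ), seg u (X τ) (X σ) ^ (r / q)) ^ (r / (p - r)) *
        wsup p u v a (r / q) (p * r / (p - r)) (X τ) := by
  have hp0 : 0 < p := by linarith
  have hpr : 0 < p - r := sub_pos.2 hrp
  have hα : 0 < r / q := by positivity
  have hβ : 0 < p * r / (p - r) := by positivity
  rw [C3, ← ENNReal.rpow_mul, show (p - r) / (p * r) * (p * r / (p - r)) = 1 by field_simp,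
    ENNReal.rpow_one]
  have hΨ : ∀ x, a ≤ x → ∫⁻ s in io x b, w s * (∫⁻ σ in io x s, u σ) ^ (r / q) =
      ∫⁻ σ in Ioi (0 : ℝ), seg u x (X σ) ^ (r / q) := by
    intro x hx
    rw [← h.lintegral_eq (fun s => seg u x s ^ (r / q)) ((measurable_seg_left _ x).pow_const _) (by
      rw [seg_eq_zero hx, ENNReal.zero_rpow_of_pos hα])]
    rw [← lintegral_indicator (measurableSet_io _ _), ← lintegral_indicator (measurableSet_io _ _)]
    refine lintegral_congr fun s => ?_
    by_cases hs : s ∈ io x b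
    · rw [indicator_of_mem hs, indicator_of_mem (io_subset_io hx le_rfl hs), mul_comm]
      rfl
    · rw [indicator_of_notMem hs]
      by_cases hs' : s ∈ io a b
      · rw [indicator_of_mem hs', seg_eq_zero (not_lt.1 fun hlt => hs ⟨hlt, hs'.2⟩),
          ENNReal.zero_rpow_of_pos hα, zero_mul]
      · rw [indicator_of_notMem hs']
  calc _ = ∫⁻ x in io a b, (∫⁻ σ in Ioi (0 : ℝ), seg u x (X σ) ^ (r / q)) ^ (r / (p - r)) *
        wsup p u v a (r / q) (p * r / (p - r)) x * w x := by
        refine setLIntegral_congr_fun (measurableSet_io a b) fun x hx => ?_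
        rw [← essSup_eq_wsup hp u v a hα hβ.le x, mul_right_comm, hΨ x hx.1.le]
        rfl
    _ = _ := by
        refine h.lintegral_eq (fun x =>
          (∫⁻ σ in Ioi (0 : ℝ), seg u x (X σ) ^ (r / q)) ^ (r / (p - r)) *
          wsup p u v a (r / q) (p * r / (p - r)) x) ?_ ?_
        · refine (Antitone.measurable fun x y hxy => ?_).pow_const _ |>.mul
            (wsup_mono p u v a _ hα.le).measurable
          refine lintegral_mono fun σ => ENNReal.rpow_le_rpow ?_ hα.le
          exact seg_mono_set u hxy le_rfl
        · simp only [wsup_self, mul_zero]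

end IsLevel

lemma rhsNorm_rpow (p : ℝ) (a b : EReal) (v f : ℝ → ℝ≥0∞) (r : ℝ) :
    rhsNorm a b p v f ^ r = seg (dens p v f) a b ^ (r / p) := by
  rw [rhsNorm, ← ENNReal.rpow_mul, one_div_mul_eq_div]
  rfl

/-- Sufficiency of the two conditions, for a given level function. -/
lemma level_sufficiency {p q r : ℝ} (hp : 1 ≤ p) (hr : 0 < r) (hrp : r < p) (hpq : p ≤ q) :
    ∃ K : ℝ≥0∞, K ≠ ⊤ ∧ ∀ (a b : EReal) (u v w f : ℝ → ℝ≥0∞) (X : ℝ → EReal), a ≤ b →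
      IsWeight a b u → IsWeight a b v → IsLevel a b w X → Measurable f →
      lhsIter a b q r u w f ^ r ≤
        K * ((C2 a b p q r u v w + C3 a b p q r u v w) ^ r * seg (dens p v f) a b ^ (r / p)) := by
  have hp0 : 0 < p := by linarith
  have hq : 0 < q := hp0.trans_le hpq
  have hpr : 0 < p - r := sub_pos.2 hrp
  have hrq : 0 < r / q := by positivity
  have hrq1 : r / q ≤ 1 := (div_le_one hq).2 (by linarith)
  have he : 0 < r / (p - r) := by positivity
  have hρ : 0 < p * r / (p - r) := by positivity
  have hs : 0 < (p - r) / p := by positivity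
  obtain ⟨K₁, hK₁, hdy⟩ := lintegral_rpow_le_of_dyadic hrq
  obtain ⟨K₂, hK₂, hloc⟩ := local_hardy hp hpq
  obtain ⟨K₃, hK₃, hhardy⟩ := hardy_sufficiency hp hr hrp
  have htop : ∀ x : ℝ, 0 ≤ x → (2 : ℝ≥0∞) ^ x ≠ ⊤ := fun x hx =>
    ENNReal.rpow_ne_top_of_nonneg hx (by simp)
  refine ⟨K₁ * (2 ^ r * (K₂ ^ (r / q) + K₃ * (2 ^ (r / (p - r)) * 2) ^ ((p - r) / p))), ?_, ?_⟩
  · refine ENNReal.mul_ne_top hK₁ (ENNReal.mul_ne_top (htop _ hr.le) (ENNReal.add_ne_top.2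
      ⟨ENNReal.rpow_ne_top_of_nonneg hrq.le hK₂, ENNReal.mul_ne_top hK₃ ?_⟩))
    exact ENNReal.rpow_ne_top_of_nonneg hs.le (ENNReal.mul_ne_top (htop _ he.le) (by simp))
  intro a b u v w f X hab hu hv hX hf
  set J := seg (dens p v f) a b with hJ
  set D := C2 a b p q r u v w + C3 a b p q r u v w with hD
  have hXm : Measurable X := hX.anti.measurable
  have hX2m : Measurable fun τ => X (2 * τ) := hXm.comp (measurable_const_mul _)
  have hDρ : (D ^ (p * r / (p - r))) ^ ((p - r) / p) = D ^ r := by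
    rw [← ENNReal.rpow_mul]
    congr 1
    field_simp
  have hC2 : ∫⁻ τ in Ioi (0 : ℝ), ENNReal.ofReal τ ^ (r / (p - r)) *
      wsup p u v a (r * p / (q * (p - r))) (p * r / (p - r)) (X τ) ≤ D ^ (p * r / (p - r)) := by
    rw [← hX.C2_rpow hp hq hr hrp]
    exact ENNReal.rpow_le_rpow le_self_add hρ.le
  have hC3 : ∫⁻ τ in Ioi (0 : ℝ),
      (∫⁻ σ in Ioi (0 : ℝ), seg u (X τ) (X σ) ^ (r / q)) ^ (r / (p - r)) *
      wsup p u v a (r / q) (p * r / (p - r)) (X τ) ≤ D ^ (p * r / (p - r)) := by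
    rw [← hX.C3_rpow hp hq hr hrp]
    exact ENNReal.rpow_le_rpow le_add_self hρ.le
  set F : ℝ → ℝ≥0∞ := fun t : ℝ => seg f a t ^ q * u t with hF
  have hFm : Measurable F :=
    (((measurable_seg_left f a).comp measurable_coe_real_ereal).pow_const q).mul hu.1
  set ω : ℝ → ℝ≥0∞ := fun τ => seg u (X (2 * τ)) (X τ) ^ (r / q) with hω
  have hωm : Measurable ω := (measurable_seg hu.1 hX2m hXm).pow_const _
  set g₁ : ℝ → ℝ≥0∞ := fun τ =>
    seg (fun t : ℝ => seg f (X (2 * τ)) t ^ q * u t) (X (2 * τ)) (X τ) with hg₁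
  have hT₁ : ∫⁻ τ in Ioi (0 : ℝ), g₁ τ ^ (r / q) ≤ K₂ ^ (r / q) * (D ^ r * J ^ (r / p)) := by
    calc ∫⁻ τ in Ioi (0 : ℝ), g₁ τ ^ (r / q)
        ≤ ∫⁻ τ in Ioi (0 : ℝ), K₂ ^ (r / q) * (wsup p u v a (1 / q) 1 (X τ) ^ r *
            seg (dens p v f) (X (2 * τ)) (X τ) ^ (r / p)) := by
          refine lintegral_mono fun τ => ?_
          have h := hloc a b (X (2 * τ)) (X τ) u v f (wsup p u v a (1 / q) 1 (X τ)) hu hv hf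
            (hX.le_left _) (hX.le_right _) fun t ht => by
              have := seg_mul_Vp_le_wsup hp u v (α := 1 / q) (β := 1) (by positivity) one_pos
                (x := X τ) ((hX.le_left (2 * τ)).trans ht.1.le)
              rwa [ENNReal.rpow_one] at this
          refine (ENNReal.rpow_le_rpow h hrq.le).trans_eq ?_
          rw [ENNReal.mul_rpow_of_nonneg _ _ hrq.le, ENNReal.mul_rpow_of_nonneg _ _ hrq.le,
            ← ENNReal.rpow_mul, ← ENNReal.rpow_mul, mul_div_cancel₀ r hq.ne',
            show q / p * (r / q) = r / p by field_simp]
      _ = K₂ ^ (r / q) * ∫⁻ τ in Ioi (0 : ℝ), wsup p u v a (1 / q) 1 (X τ) ^ r *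
            seg (dens p v f) (X (2 * τ)) (X τ) ^ (r / p) :=
          lintegral_const_mul' _ _ (ENNReal.rpow_ne_top_of_nonneg hrq.le hK₂)
      _ ≤ K₂ ^ (r / q) * ((∫⁻ τ in Ioi (0 : ℝ), ENNReal.ofReal τ ^ (r / (p - r)) *
            wsup p u v a (1 / q) 1 (X τ) ^ (p * r / (p - r))) ^ ((p - r) / p) * J ^ (r / p)) := by
          refine mul_le_mul' le_rfl ?_
          exact lintegral_rpow_mul_seg_le hr hrp hX.anti hX.le_left (fun τ _ => hX.le_right τ)
            (measurable_dens p hv.1 hf)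
            ((wsup_mono p u v a _ (by positivity)).measurable.comp hXm)
      _ ≤ K₂ ^ (r / q) * (D ^ r * J ^ (r / p)) := by
          rw [← hDρ]
          refine mul_le_mul' le_rfl (mul_le_mul' (ENNReal.rpow_le_rpow ?_ hs.le) le_rfl)
          refine le_trans (le_of_eq ?_) hC2
          refine lintegral_congr fun τ => ?_
          rw [wsup_rpow _ _ _ _ _ _ hρ, one_mul, show 1 / q * (p * r / (p - r)) =
            r * p / (q * (p - r)) by field_simp]
  have hT₂ : ∫⁻ τ in Ioi (0 : ℝ), seg f a (X (2 * τ)) ^ r * ω τ ≤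
      K₃ * (2 ^ (r / (p - r)) * 2) ^ ((p - r) / p) * (D ^ r * J ^ (r / p)) := by
    refine (hhardy a b v f ω (fun τ => X (2 * τ)) hab hv hf hωm hX2m
      fun τ => hX.le_right _).trans ?_
    rw [mul_assoc, ← mul_assoc _ (D ^ r), ← hDρ, ← ENNReal.mul_rpow_of_nonneg _ _ hs.le]
    refine mul_le_mul' le_rfl (mul_le_mul' (ENNReal.rpow_le_rpow ?_ hs.le) le_rfl)
    have hpt : ∀ τ ∈ Ioi (0 : ℝ), Vp p v a (X (2 * τ)) ^ (p * r / (p - r)) *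
        (∫⁻ σ in {σ | 0 < σ ∧ X (2 * τ) ≤ X (2 * σ)}, ω σ) ^ (r / (p - r)) * ω τ ≤
        2 ^ (r / (p - r)) * ((∫⁻ σ in Ioi (0 : ℝ), seg u (X τ) (X σ) ^ (r / q)) ^ (r / (p - r)) *
          wsup p u v a (r / q) (p * r / (p - r)) (X τ) + ENNReal.ofReal τ ^ (r / (p - r)) *
          wsup p u v a (r * p / (q * (p - r))) (p * r / (p - r)) (X τ)) := by
      intro τ hτ
      have hτ0 : (0 : ℝ) < τ := hτ
      rcases (hX.le_left (2 * τ)).eq_or_lt with ha | ha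
      · rw [← ha, Vp_self hp, ENNReal.zero_rpow_of_pos hρ, zero_mul, zero_mul]
        exact zero_le
      set N := ∫⁻ σ in {σ | 0 < σ ∧ X (2 * τ) ≤ X (2 * σ)}, ω σ with hN
      set Ψ := ∫⁻ σ in Ioi (0 : ℝ), seg u (X τ) (X σ) ^ (r / q) with hΨ
      set V := Vp p v a (X (2 * τ)) with hV
      have hNle : N ≤ Ψ + ω τ * ENNReal.ofReal τ := by
        have hsub : {σ | 0 < σ ∧ X (2 * τ) ≤ X (2 * σ)} ⊆ Ioc 0 τ := by
          intro σ hσ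
          have hσ0 : 0 < σ := hσ.1
          refine ⟨hσ0, ?_⟩
          have := hX.le_of_le (by linarith) (by linarith) ha hσ.2
          linarith
        calc N ≤ ∫⁻ σ in Ioc 0 τ, ω σ := lintegral_mono_set hsub
          _ ≤ ∫⁻ σ in Ioc 0 τ, seg u (X τ) (X σ) ^ (r / q) + ω τ := by
              refine setLIntegral_mono' measurableSet_Ioc fun σ hσ => ?_
              calc ω σ ≤ (seg u (X (2 * τ)) (X τ) + seg u (X τ) (X σ)) ^ (r / q) := by
                    refine ENNReal.rpow_le_rpow ?_ hrq.le
                    refine le_trans (seg_mono_set u (hX.anti ?_) le_rfl) (seg_le_add u _ _ _)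
                    have := hσ.2
                    linarith
                _ ≤ _ := by
                    rw [add_comm (seg u (X τ) (X σ) ^ (r / q))]
                    exact ENNReal.rpow_add_le_add_rpow _ _ hrq.le hrq1
          _ = (∫⁻ σ in Ioc 0 τ, seg u (X τ) (X σ) ^ (r / q)) + ω τ * ENNReal.ofReal τ := by
              rw [lintegral_add_right _ measurable_const, setLIntegral_const, Real.volume_Ioc,
                sub_zero]
          _ ≤ _ := by
              gcongr
              exact lintegral_mono_set fun σ hσ => hσ.1
      have hVS : V ^ (p * r / (p - r)) * ω τ ≤ wsup p u v a (r / q) (p * r / (p - r)) (X τ) := by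
        rw [mul_comm]
        exact seg_mul_Vp_le_wsup hp u v hrq hρ (hX.le_left _)
      have hVA : V ^ (p * r / (p - r)) * (ω τ ^ (r / (p - r)) * ω τ) ≤
          wsup p u v a (r * p / (q * (p - r))) (p * r / (p - r)) (X τ) := by
        have h1 : ω τ ^ (r / (p - r)) * ω τ =
            seg u (X (2 * τ)) (X τ) ^ (r * p / (q * (p - r))) := by
          rw [hω]
          simp only
          rw [← ENNReal.rpow_mul, ← ENNReal.rpow_add_of_nonneg _ _ (by positivity) hrq.le]
          congr 1
          field_simp
          ring
        rw [h1, mul_comm]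
        exact seg_mul_Vp_le_wsup hp u v (by positivity) hρ (hX.le_left _)
      calc V ^ (p * r / (p - r)) * N ^ (r / (p - r)) * ω τ
          ≤ V ^ (p * r / (p - r)) * (2 ^ (r / (p - r)) * (Ψ ^ (r / (p - r)) +
            (ω τ * ENNReal.ofReal τ) ^ (r / (p - r)))) * ω τ := by
            gcongr
            exact (ENNReal.rpow_le_rpow hNle he.le).trans (ennreal_add_rpow_le _ _ he.le)
        _ = 2 ^ (r / (p - r)) * (Ψ ^ (r / (p - r)) * (V ^ (p * r / (p - r)) * ω τ) +
            ENNReal.ofReal τ ^ (r / (p - r)) *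
              (V ^ (p * r / (p - r)) * (ω τ ^ (r / (p - r)) * ω τ))) := by
            rw [ENNReal.mul_rpow_of_nonneg _ _ he.le]
            ring
        _ ≤ _ := by gcongr
    calc _ ≤ ∫⁻ τ in Ioi (0 : ℝ), 2 ^ (r / (p - r)) *
          ((∫⁻ σ in Ioi (0 : ℝ), seg u (X τ) (X σ) ^ (r / q)) ^ (r / (p - r)) *
          wsup p u v a (r / q) (p * r / (p - r)) (X τ) + ENNReal.ofReal τ ^ (r / (p - r)) *
          wsup p u v a (r * p / (q * (p - r))) (p * r / (p - r)) (X τ)) :=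
          setLIntegral_mono' measurableSet_Ioi hpt
      _ ≤ 2 ^ (r / (p - r)) * (D ^ (p * r / (p - r)) + D ^ (p * r / (p - r))) := by
          rw [lintegral_const_mul' _ _ (htop _ he.le), lintegral_add_right]
          · exact mul_le_mul' le_rfl (add_le_add hC3 hC2)
          · exact (ENNReal.measurable_ofReal.pow_const _).mul
              ((wsup_mono p u v a _ (by positivity)).measurable.comp hXm)
      _ = _ := by ring
  rw [hX.lhsIter_rpow hq hr]
  calc ∫⁻ τ in Ioi (0 : ℝ), seg F a (X τ) ^ (r / q)
      ≤ K₁ * ∫⁻ τ in Ioi (0 : ℝ), seg F (X (2 * τ)) (X τ) ^ (r / q) := by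
        refine hdy _ _ (measurable_seg hFm hX2m hXm) fun σ hσ => ?_
        have := seg_le_tsum F a (fun j => X (2 ^ j * σ)) fun t ht => hX.exists_le t σ ht hσ
        simpa [pow_succ', mul_assoc] using this
    _ ≤ K₁ * ∫⁻ τ in Ioi (0 : ℝ), 2 ^ r * (g₁ τ ^ (r / q) + seg f a (X (2 * τ)) ^ r * ω τ) := by
        refine mul_le_mul' le_rfl (lintegral_mono fun τ => ?_)
        have h1 : seg F (X (2 * τ)) (X τ) ≤
            2 ^ q * (g₁ τ + seg f a (X (2 * τ)) ^ q * seg u (X (2 * τ)) (X τ)) := by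
          calc seg F (X (2 * τ)) (X τ)
              ≤ seg (fun t : ℝ => 2 ^ q * (seg f (X (2 * τ)) t ^ q * u t +
                  seg f a (X (2 * τ)) ^ q * u t)) (X (2 * τ)) (X τ) := by
                refine seg_mono fun t _ => ?_
                calc seg f a t ^ q * u t
                    ≤ (seg f (X (2 * τ)) t + seg f a (X (2 * τ))) ^ q * u t := by
                      gcongr
                      rw [add_comm]
                      exact seg_le_add f _ _ _
                  _ ≤ (2 ^ q * (seg f (X (2 * τ)) t ^ q + seg f a (X (2 * τ)) ^ q)) * u t := by
                      gcongr
                      exact ennreal_add_rpow_le _ _ hq.le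
                  _ = _ := by ring
            _ = _ := by
                rw [seg, lintegral_const_mul' _ _ (htop _ hq.le), lintegral_add_right _
                  (hu.1.const_mul _), lintegral_const_mul _ hu.1]
                rfl
        calc seg F (X (2 * τ)) (X τ) ^ (r / q)
            ≤ (2 ^ q * (g₁ τ + seg f a (X (2 * τ)) ^ q * seg u (X (2 * τ)) (X τ))) ^ (r / q) :=
              ENNReal.rpow_le_rpow h1 hrq.le
          _ = 2 ^ r * (g₁ τ + seg f a (X (2 * τ)) ^ q * seg u (X (2 * τ)) (X τ)) ^ (r / q) := by
              rw [ENNReal.mul_rpow_of_nonneg _ _ hrq.le, ← ENNReal.rpow_mul,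
                mul_div_cancel₀ r hq.ne']
          _ ≤ 2 ^ r * (g₁ τ ^ (r / q) +
                (seg f a (X (2 * τ)) ^ q * seg u (X (2 * τ)) (X τ)) ^ (r / q)) := by
              gcongr
              exact ENNReal.rpow_add_le_add_rpow _ _ hrq.le hrq1
          _ = _ := by
              rw [ENNReal.mul_rpow_of_nonneg _ _ hrq.le, ← ENNReal.rpow_mul,
                mul_div_cancel₀ r hq.ne']
    _ = K₁ * (2 ^ r * ((∫⁻ τ in Ioi (0 : ℝ), g₁ τ ^ (r / q)) +
          ∫⁻ τ in Ioi (0 : ℝ), seg f a (X (2 * τ)) ^ r * ω τ)) := by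
        rw [lintegral_const_mul' _ _ (htop _ hr.le), lintegral_add_right]
        exact (((measurable_seg_left f a).comp hX2m).pow_const r).mul hωm
    _ ≤ K₁ * (2 ^ r * (K₂ ^ (r / q) * (D ^ r * J ^ (r / p)) +
          K₃ * (2 ^ (r / (p - r)) * 2) ^ ((p - r) / p) * (D ^ r * J ^ (r / p)))) := by
        gcongr
    _ = _ := by ring

/-- The dyadic blocks of `u` along the level function `X`. -/
def blk (u : ℝ → ℝ≥0∞) (X : ℝ → EReal) (s : ℝ) (τ : ℝ) : ℝ≥0∞ := seg u (X (2 * τ)) (X τ) ^ s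

/-- The primitive of the dyadic blocks. -/
def blkInt (u : ℝ → ℝ≥0∞) (X : ℝ → EReal) (s : ℝ) (τ : ℝ) : ℝ≥0∞ :=
  ∫⁻ σ in Ioo 0 τ, blk u X s σ

/-- The part of the dyadic blocks dominated by the average of the preceding ones. -/
def blkMin (u : ℝ → ℝ≥0∞) (X : ℝ → EReal) (s : ℝ) (τ : ℝ) : ℝ≥0∞ :=
  min (blk u X s (2 * τ)) (blkInt u X s τ * (ENNReal.ofReal τ)⁻¹)

lemma measurable_blk {u : ℝ → ℝ≥0∞} {X : ℝ → EReal} (hu : Measurable u) (hX : Measurable X)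
    (s : ℝ) : Measurable (blk u X s) :=
  (measurable_seg hu (hX.comp (measurable_const_mul _)) hX).pow_const _

lemma blkInt_mono (u : ℝ → ℝ≥0∞) (X : ℝ → EReal) (s : ℝ) : Monotone (blkInt u X s) :=
  fun _ _ h => lintegral_mono_set (Ioo_subset_Ioo_right h)

lemma measurable_blkMin {u : ℝ → ℝ≥0∞} {X : ℝ → EReal} (hu : Measurable u) (hX : Measurable X)
    (s : ℝ) : Measurable (blkMin u X s) :=
  ((measurable_blk hu hX s).comp (measurable_const_mul _)).min
    ((blkInt_mono u X s).measurable.mul ENNReal.measurable_ofReal.inv)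

lemma seg_rpow_mul_seg_le {f u : ℝ → ℝ≥0∞} {a c x : EReal} {q : ℝ} (hq : 0 < q)
    (hu : Measurable u) (hc : a ≤ c) :
    seg f a c ^ q * seg u c x ≤ seg (fun t : ℝ => seg f a t ^ q * u t) a x := by
  calc seg f a c ^ q * seg u c x = seg (fun t => seg f a c ^ q * u t) c x :=
        (lintegral_const_mul _ hu).symm
    _ ≤ seg (fun t : ℝ => seg f a t ^ q * u t) c x := seg_mono fun t ht => by
        gcongr
        exact seg_mono_set f le_rfl ht.1.le
    _ ≤ _ := seg_mono_set _ hc le_rfl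

lemma blkInt_rpow_mul_le {a : EReal} {X : ℝ → EReal} {p s e ρ : ℝ} (hp : 1 ≤ p) (hs : 0 < s)
    (he : 0 < e)
    (hρ : 0 < ρ) (u v : ℝ → ℝ≥0∞) {τ : ℝ} (hτ : 0 < τ) {c : EReal} (hc : a ≤ c)
    (hcX : X (2 * τ) ≤ c) :
    blkInt u X s (2⁻¹ * τ) ^ e * (seg u c (X τ) ^ s * Vp p v a c ^ ρ) ≤
      ENNReal.ofReal τ ^ e * wsup p u v a (s * (1 + e)) ρ (X τ) +
        Vp p v a (X τ) ^ ρ * blkInt u X s (2⁻¹ * τ) ^ e * blkMin u X s (2⁻¹ * τ) := by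
  rcases le_or_gt (X τ) c with hle | hlt
  · rw [seg_eq_zero hle, ENNReal.zero_rpow_of_pos hs, zero_mul, mul_zero]
    exact zero_le
  set y := seg u c (X τ) ^ s with hy
  set N := blkInt u X s (2⁻¹ * τ) with hN
  have hτ' : 0 < 2⁻¹ * τ := by positivity
  have hyblk : y ≤ blk u X s (2 * (2⁻¹ * τ)) := by
    rw [show 2 * (2⁻¹ * τ) = τ by ring]
    exact ENNReal.rpow_le_rpow (seg_mono_set u hcX le_rfl) hs.le
  have hV : Vp p v a c ^ ρ ≤ Vp p v a (X τ) ^ ρ :=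
    ENNReal.rpow_le_rpow (Vp_mono hp v a hlt.le) hρ.le
  rcases le_or_gt y (N * (ENNReal.ofReal (2⁻¹ * τ))⁻¹) with hcase | hcase
  · refine le_add_left ?_
    have hmin : y ≤ blkMin u X s (2⁻¹ * τ) := le_min hyblk hcase
    calc N ^ e * (y * Vp p v a c ^ ρ)
        ≤ N ^ e * (blkMin u X s (2⁻¹ * τ) * Vp p v a (X τ) ^ ρ) := by gcongr
      _ = _ := by ring
  · refine le_add_right ?_
    have hNy : N ≤ ENNReal.ofReal τ * y := by
      have h1 : N ≤ y * ENNReal.ofReal (2⁻¹ * τ) := by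
        have h2 := mul_le_mul' hcase.le (le_refl (ENNReal.ofReal (2⁻¹ * τ)))
        rwa [mul_assoc, ENNReal.inv_mul_cancel (by simpa using hτ) ENNReal.ofReal_ne_top,
          mul_one] at h2
      rw [mul_comm]
      refine h1.trans (mul_le_mul' le_rfl (ENNReal.ofReal_le_ofReal ?_))
      linarith
    calc N ^ e * (y * Vp p v a c ^ ρ)
        ≤ (ENNReal.ofReal τ * y) ^ e * (y * Vp p v a c ^ ρ) := by gcongr
      _ = ENNReal.ofReal τ ^ e * (seg u c (X τ) ^ (s * (1 + e)) * Vp p v a c ^ ρ) := by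
          rw [ENNReal.mul_rpow_of_nonneg _ _ he.le, mul_add, mul_one,
            ENNReal.rpow_add_of_nonneg _ _ hs.le (by positivity), ENNReal.rpow_mul _ s e]
          ring
      _ ≤ _ := by
          gcongr
          exact seg_mul_Vp_le_wsup hp u v (by positivity) hρ hc

namespace IsLevel

variable {a b : EReal} {w : ℝ → ℝ≥0∞} {X : ℝ → EReal}

lemma lintegral_seg_rpow_le (h : IsLevel a b w X) {s : ℝ} (hs : 0 < s) {K : ℝ≥0∞}
    (hK : ∀ h g : ℝ → ℝ≥0∞, Measurable g → (∀ τ, 0 < τ → h τ ≤ ∑' j : ℕ, g (2 ^ j * τ)) →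
      ∫⁻ τ in Ioi (0 : ℝ), h τ ^ s ≤ K * ∫⁻ τ in Ioi (0 : ℝ), g τ ^ s)
    {u : ℝ → ℝ≥0∞} (hu : Measurable u) (τ : ℝ) :
    ∫⁻ σ in Ioi (0 : ℝ), seg u (X τ) (X σ) ^ s ≤ K * blkInt u X s τ := by
  have hXm := h.anti.measurable
  set g : ℝ → ℝ≥0∞ := fun σ => seg u (max (X (2 * σ)) (X τ)) (max (X σ) (X τ)) with hg
  have hgm : Measurable g := measurable_seg hu
    ((hXm.comp (measurable_const_mul _)).max measurable_const) (hXm.max measurable_const)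
  calc ∫⁻ σ in Ioi (0 : ℝ), seg u (X τ) (X σ) ^ s
      ≤ K * ∫⁻ σ in Ioi (0 : ℝ), g σ ^ s := by
        refine hK _ _ hgm fun σ hσ => ?_
        have := seg_le_tsum u (X τ) (fun j => max (X (2 ^ j * σ)) (X τ)) fun t ht => by
          obtain ⟨n, hn⟩ := h.exists_le t σ ((h.le_left τ).trans_lt ht) hσ
          exact ⟨n, max_le hn ht.le⟩
        refine (seg_mono_set u le_rfl (le_max_left _ (X τ))).trans ?_
        simpa [pow_succ', mul_assoc] using this
    _ ≤ K * ∫⁻ σ in Ioi (0 : ℝ), (Iio τ).indicator (blk u X s) σ := by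
        refine mul_le_mul' le_rfl (setLIntegral_mono' measurableSet_Ioi fun σ hσ => ?_)
        have hσ0 : (0 : ℝ) < σ := hσ
        rcases lt_or_ge σ τ with hlt | hge
        · rw [indicator_of_mem (show σ ∈ Iio τ from hlt), hg, blk]
          simp only
          rw [max_eq_left (h.anti hlt.le)]
          exact ENNReal.rpow_le_rpow (seg_mono_set u (le_max_left _ _) le_rfl) hs.le
        · rw [hg]
          simp only
          rw [max_eq_right (h.anti hge), seg_eq_zero (le_max_right _ _),
            ENNReal.zero_rpow_of_pos hs]
          exact zero_le
    _ = K * blkInt u X s τ := by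
        rw [setLIntegral_indicator measurableSet_Iio, inter_comm, Ioi_inter_Iio]
        rfl

lemma lintegral_seg_le_add (h : IsLevel a b w X) {s : ℝ} (hs : 0 < s) (hs1 : s ≤ 1)
    (u : ℝ → ℝ≥0∞) (σ τ : ℝ) :
    ∫⁻ ξ in Ioi (0 : ℝ), seg u (X τ) (X ξ) ^ s ≤ seg u (X τ) (X σ) ^ s * ENNReal.ofReal τ +
      ∫⁻ ξ in Ioi (0 : ℝ), seg u (X σ) (X ξ) ^ s := by
  calc ∫⁻ ξ in Ioi (0 : ℝ), seg u (X τ) (X ξ) ^ s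
      ≤ ∫⁻ ξ in Ioi (0 : ℝ), ((Iio τ).indicator (fun _ => seg u (X τ) (X σ) ^ s) ξ +
          seg u (X σ) (X ξ) ^ s) := by
        refine lintegral_mono fun ξ => ?_
        rcases lt_or_ge ξ τ with hlt | hge
        · rw [indicator_of_mem (show ξ ∈ Iio τ from hlt)]
          exact (ENNReal.rpow_le_rpow (seg_le_add u _ _ _) hs.le).trans
            (ENNReal.rpow_add_le_add_rpow _ _ hs.le hs1)
        · rw [seg_eq_zero (h.anti hge), ENNReal.zero_rpow_of_pos hs]
          exact zero_le
    _ = _ := by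
        rw [lintegral_add_left (measurable_const.indicator measurableSet_Iio),
          setLIntegral_indicator measurableSet_Iio, inter_comm, Ioi_inter_Iio, setLIntegral_const,
          Real.volume_Ioo, sub_zero]

lemma blkInt_rpow_mul_wsup_le (h : IsLevel a b w X) {p s e ρ : ℝ} (hp : 1 ≤ p) (hs : 0 < s)
    (hs1 : s ≤ 1) (he : 0 < e) (hρ : 0 < ρ) (u v : ℝ → ℝ≥0∞) {Z : ℝ → ℝ≥0∞}
    (hZ : ∀ τ, ENNReal.ofReal τ ^ e * wsup p u v a (s * (1 + e)) ρ (X τ) +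
        Vp p v a (X τ) ^ ρ * blkInt u X s (2⁻¹ * τ) ^ e * blkMin u X s (2⁻¹ * τ) = Z τ)
    {τ : ℝ} (hτ : 0 < τ) :
    blkInt u X s (2⁻¹ * τ) ^ e * wsup p u v a s ρ (X τ) ≤ ∑' j : ℕ, Z (2 ^ j * τ) := by
  have key : ∀ (n : ℕ) (t : ℝ) (τ : ℝ), a < t → 0 < τ → X (2 ^ n * τ) ≤ t →
      blkInt u X s (2⁻¹ * τ) ^ e * (seg u t (X τ) ^ s * Vp p v a t ^ ρ) ≤
        ∑ j ∈ Finset.range n, Z (2 ^ j * τ) := by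
    intro n t
    induction n with
    | zero =>
      intro τ _ _ hX
      rw [pow_zero, one_mul] at hX
      rw [seg_eq_zero hX, ENNReal.zero_rpow_of_pos hs, zero_mul, mul_zero]
      exact zero_le
    | succ n ih =>
      intro τ hat hτ hX
      have hsum : ∑ j ∈ Finset.range (n + 1), Z (2 ^ j * τ) =
          (∑ j ∈ Finset.range n, Z (2 ^ j * (2 * τ))) + Z τ := by
        rw [Finset.sum_range_succ', pow_zero, one_mul]
        congr 1
        refine Finset.sum_congr rfl fun j _ => ?_
        rw [pow_succ, mul_assoc]
      rw [hsum]
      rcases le_or_gt (X (2 * τ)) t with hle | hlt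
      · refine le_add_left ?_
        rw [← hZ τ]
        exact blkInt_rpow_mul_le hp hs he hρ u v hτ hat.le hle
      · calc blkInt u X s (2⁻¹ * τ) ^ e * (seg u t (X τ) ^ s * Vp p v a t ^ ρ)
            ≤ blkInt u X s (2⁻¹ * τ) ^ e * ((seg u t (X (2 * τ)) ^ s +
                seg u (X (2 * τ)) (X τ) ^ s) * Vp p v a t ^ ρ) := by
              gcongr
              exact (ENNReal.rpow_le_rpow (seg_le_add u _ _ _) hs.le).trans
                (ENNReal.rpow_add_le_add_rpow _ _ hs.le hs1)
          _ = blkInt u X s (2⁻¹ * τ) ^ e * (seg u t (X (2 * τ)) ^ s * Vp p v a t ^ ρ) +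
                blkInt u X s (2⁻¹ * τ) ^ e * (seg u (X (2 * τ)) (X τ) ^ s * Vp p v a t ^ ρ) := by
              ring
          _ ≤ blkInt u X s (2⁻¹ * (2 * τ)) ^ e * (seg u t (X (2 * τ)) ^ s * Vp p v a t ^ ρ) +
                blkInt u X s (2⁻¹ * τ) ^ e *
                  (seg u (X (2 * τ)) (X τ) ^ s * Vp p v a (X (2 * τ)) ^ ρ) := by
              gcongr
              · exact blkInt_mono u X s (by linarith)
              · exact Vp_mono hp v a hlt.le
          _ ≤ _ := by
              refine add_le_add (ih (2 * τ) hat (by positivity) ?_) ?_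
              · rwa [← mul_assoc, ← pow_succ]
              · rw [← hZ τ]
                exact blkInt_rpow_mul_le hp hs he hρ u v hτ (h.le_left _) le_rfl
  simp only [wsup, ENNReal.mul_iSup]
  refine iSup₂_le fun t ht => ?_
  obtain ⟨n, hn⟩ := h.exists_le t τ ht.1 hτ
  exact (key n t τ ht.1 hτ hn).trans (ENNReal.sum_le_tsum _)

end IsLevel

lemma level_C2_le {p q r : ℝ} (hp : 1 ≤ p) (hq : 0 < q) (hr : 0 < r) (hrp : r < p) :
    ∃ K : ℝ≥0∞, K ≠ ⊤ ∧ ∀ (a b : EReal) (u v : ℝ → ℝ≥0∞) (X : ℝ → EReal) (C : ℝ≥0∞),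
      Measurable u → IsWeight a b v → Antitone X → (∀ τ, X τ ≤ b) →
      (∀ f, Measurable f →
        ∫⁻ τ in Ioi (0 : ℝ), seg (fun t : ℝ => seg f a t ^ q * u t) a (X τ) ^ (r / q) ≤
          C ^ r * seg (dens p v f) a b ^ (r / p)) →
      ∫⁻ τ in Ioi (0 : ℝ), ENNReal.ofReal τ ^ (r / (p - r)) *
        wsup p u v a (r * p / (q * (p - r))) (p * r / (p - r)) (X τ) ≤
        K * C ^ (p * r / (p - r)) := by
  obtain ⟨K, hK, htest⟩ := lintegral_le_of_test hr hrp
  have hp0 : 0 < p := by linarith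
  have hpr : 0 < p - r := sub_pos.2 hrp
  have hρ : 0 < p * r / (p - r) := by positivity
  have hq' : 0 < 1 / q := by positivity
  refine ⟨K, hK, ?_⟩
  intro a b u v X C hu hv hX hXb hC
  have hmain := htest a b v
    (fun τ f => ⨆ (t : ℝ) (_ : t ∈ io a (X τ)), seg u t (X τ) ^ (1 / q) * seg f a t)
    (fun τ => wsup p u v a (1 / q) 1 (X τ)) C hv.1 ?_ ?_ ?_
    ((wsup_mono p u v a 1 hq'.le).comp_antitone hX) ?_
  · refine le_trans (le_of_eq ?_) hmain
    refine lintegral_congr fun τ => ?_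
    rw [wsup_rpow _ _ _ _ _ _ hρ, one_mul, show 1 / q * (p * r / (p - r)) =
      r * p / (q * (p - r)) by field_simp]
  · intro f σ τ h
    refine iSup₂_le fun t ht => ?_
    refine le_trans ?_ (le_iSup₂ (f := fun (t : ℝ) (_ : t ∈ io a (X σ)) =>
      seg u t (X σ) ^ (1 / q) * seg f a t) t (io_subset_io le_rfl (hX h) ht))
    gcongr
    exact seg_mono_set u le_rfl (hX h)
  · intro τ f g α h
    simp only [ENNReal.mul_iSup]
    refine iSup₂_mono fun t ht => ?_
    rw [mul_left_comm]
    refine mul_le_mul' le_rfl ?_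
    exact (lintegral_const_mul_le _ _).trans (seg_mono fun x _ => h x)
  · intro f hf
    refine le_trans (lintegral_mono fun τ => ?_) (hC f hf)
    rw [show r / q = 1 / q * r by ring, ENNReal.rpow_mul]
    refine ENNReal.rpow_le_rpow (iSup₂_le fun t ht => ?_) hr.le
    calc seg u t (X τ) ^ (1 / q) * seg f a t
        = (seg f a t ^ q * seg u t (X τ)) ^ (1 / q) := by
          rw [ENNReal.mul_rpow_of_nonneg _ _ hq'.le, ← ENNReal.rpow_mul, mul_one_div_cancel hq.ne',
            ENNReal.rpow_one, mul_comm]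
      _ ≤ _ := ENNReal.rpow_le_rpow (seg_rpow_mul_seg_le hq hu ht.1.le) hq'.le
  · intro τ _
    refine iSup₂_le fun t ht => ?_
    rw [ENNReal.rpow_one]
    calc seg u t (X τ) ^ (1 / q) * Vp p v a t
        ≤ seg u t (X τ) ^ (1 / q) *
          ⨆ (f : ℝ → ℝ≥0∞) (_ : Measurable f ∧ seg (dens p v f) a b ≤ 1), seg f a t := by
          gcongr
          exact Vp_le_iSup hp hv (ht.2.le.trans (hXb τ))
      _ ≤ _ := by
          simp only [ENNReal.mul_iSup]
          refine iSup₂_mono fun f _ => ?_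
          exact le_iSup₂ (f := fun (t : ℝ) (_ : t ∈ io a (X τ)) =>
            seg u t (X τ) ^ (1 / q) * seg f a t) t ht

lemma level_blkMin_le {p q r : ℝ} (hp : 1 ≤ p) (hq : 0 < q) (hr : 0 < r) (hrp : r < p) :
    ∃ K : ℝ≥0∞, K ≠ ⊤ ∧ ∀ (a b : EReal) (u v w : ℝ → ℝ≥0∞) (X : ℝ → EReal) (C : ℝ≥0∞), a ≤ b →
      Measurable u → IsWeight a b v → IsLevel a b w X →
      (∀ f, Measurable f →
        ∫⁻ τ in Ioi (0 : ℝ), seg (fun t : ℝ => seg f a t ^ q * u t) a (X τ) ^ (r / q) ≤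
          C ^ r * seg (dens p v f) a b ^ (r / p)) →
      ∫⁻ τ in Ioi (0 : ℝ), Vp p v a (X (2 * τ)) ^ (p * r / (p - r)) *
        blkInt u X (r / q) τ ^ (r / (p - r)) * blkMin u X (r / q) τ ≤
        K * C ^ (p * r / (p - r)) := by
  obtain ⟨K, hK, hnec⟩ := hardy_necessity hp hr hrp
  have hp0 : 0 < p := by linarith
  have hpr : 0 < p - r := sub_pos.2 hrp
  have hρ : 0 < p * r / (p - r) := by positivity
  have he : 0 < r / (p - r) := by positivity
  have hs : 0 < r / q := by positivity
  refine ⟨K * (3 ^ (1 / r)) ^ (p * r / (p - r)), ENNReal.mul_ne_top hK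
    (ENNReal.rpow_ne_top_of_nonneg hρ.le (ENNReal.rpow_ne_top_of_nonneg (by positivity)
      (by simp))), ?_⟩
  intro a b u v w X C hab hu hv hX hC
  have hXm : Measurable X := hX.anti.measurable
  have hX2m : Measurable fun τ => X (2 * τ) := hXm.comp (measurable_const_mul _)
  set ω := blk u X (r / q) with hω
  set η := fun τ => blkMin u X (r / q) τ + ω τ with hη
  have hωm : Measurable ω := measurable_blk hu hXm _
  have hηm : Measurable (blkMin u X (r / q)) := measurable_blkMin hu hXm _
  have hbound : ∀ f, Measurable f → ∫⁻ τ in Ioi (0 : ℝ), seg f a (X (2 * τ)) ^ r * η τ ≤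
      (3 ^ (1 / r) * C) ^ r * seg (dens p v f) a b ^ (r / p) := by
    intro f hf
    have hG : Antitone fun τ => seg f a (X (2 * τ)) ^ r := fun x y h =>
      ENNReal.rpow_le_rpow (seg_mono_set f le_rfl (hX.anti (by linarith))) hr.le
    have hle : ∫⁻ τ in Ioi (0 : ℝ), seg f a (X (2 * τ)) ^ r * ω τ ≤
        C ^ r * seg (dens p v f) a b ^ (r / p) := by
      refine le_trans (lintegral_mono fun τ => ?_) (hC f hf)
      calc seg f a (X (2 * τ)) ^ r * ω τ
          = (seg f a (X (2 * τ)) ^ q * seg u (X (2 * τ)) (X τ)) ^ (r / q) := by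
            rw [ENNReal.mul_rpow_of_nonneg _ _ hs.le, ← ENNReal.rpow_mul, mul_div_cancel₀ r hq.ne']
            rfl
        _ ≤ _ := ENNReal.rpow_le_rpow (seg_rpow_mul_seg_le hq hu (hX.le_left _)) hs.le
    calc ∫⁻ τ in Ioi (0 : ℝ), seg f a (X (2 * τ)) ^ r * η τ
        = (∫⁻ τ in Ioi (0 : ℝ), seg f a (X (2 * τ)) ^ r * blkMin u X (r / q) τ) +
          ∫⁻ τ in Ioi (0 : ℝ), seg f a (X (2 * τ)) ^ r * ω τ := by
          rw [← lintegral_add_right (g := fun τ => seg f a (X (2 * τ)) ^ r * ω τ) _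
            (hG.measurable.mul hωm)]
          refine lintegral_congr fun τ => ?_
          rw [hη, mul_add]
      _ ≤ 2 * (∫⁻ τ in Ioi (0 : ℝ), seg f a (X (2 * τ)) ^ r * ω τ) +
          ∫⁻ τ in Ioi (0 : ℝ), seg f a (X (2 * τ)) ^ r * ω τ := by
          gcongr
          exact lintegral_antitone_mul_le hG hηm hωm (fun τ _ => min_le_left _ _)
            (fun τ _ => min_le_right _ _)
      _ = 3 * ∫⁻ τ in Ioi (0 : ℝ), seg f a (X (2 * τ)) ^ r * ω τ := by ring
      _ ≤ 3 * (C ^ r * seg (dens p v f) a b ^ (r / p)) := by gcongr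
      _ = _ := by
          rw [ENNReal.mul_rpow_of_nonneg _ _ hr.le, ← ENNReal.rpow_mul, one_div_mul_cancel hr.ne',
            ENNReal.rpow_one, mul_assoc]
  have hmain := hnec a b v η (fun τ => X (2 * τ)) (3 ^ (1 / r) * C) hab hv (hηm.add hωm) hX2m
    (fun τ => hX.le_left _) (fun τ => hX.le_right _) hbound
  rw [ENNReal.mul_rpow_of_nonneg _ _ hρ.le, ← mul_assoc] at hmain
  refine le_trans (setLIntegral_mono' measurableSet_Ioi fun τ hτ => ?_) hmain
  have hτ0 : (0 : ℝ) < τ := hτ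
  rcases (hX.le_left (2 * τ)).eq_or_lt with ha | ha
  · rw [← ha, Vp_self hp, ENNReal.zero_rpow_of_pos hρ, zero_mul, zero_mul]
    exact zero_le
  · have hN : blkInt u X (r / q) τ ≤ ∫⁻ σ in {σ | 0 < σ ∧ X (2 * τ) < X (2 * σ)}, η σ := by
      refine (lintegral_mono fun σ => le_add_self).trans (lintegral_mono_set fun σ hσ => ?_)
      exact ⟨hσ.1, hX.lt_of_lt (by linarith [hσ.1]) ha (by linarith [hσ.2])⟩
    have hle : blkMin u X (r / q) τ ≤ η τ := le_self_add
    gcongr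

/-- Necessity of the two conditions, for a given level function. -/
lemma level_necessity {p q r : ℝ} (hp : 1 ≤ p) (hr : 0 < r) (hrp : r < p) (hpq : p ≤ q) :
    ∃ K : ℝ≥0∞, K ≠ ⊤ ∧ ∀ (a b : EReal) (u v w : ℝ → ℝ≥0∞) (X : ℝ → EReal) (C : ℝ≥0∞), a ≤ b →
      Measurable u → IsWeight a b v → IsLevel a b w X →
      (∀ f, Measurable f → lhsIter a b q r u w f ≤ C * rhsNorm a b p v f) →
      C2 a b p q r u v w ^ (p * r / (p - r)) ≤ K * C ^ (p * r / (p - r)) ∧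
      C3 a b p q r u v w ^ (p * r / (p - r)) ≤ K * C ^ (p * r / (p - r)) := by
  have hp0 : 0 < p := by linarith
  have hq : 0 < q := hp0.trans_le hpq
  have hpr : 0 < p - r := sub_pos.2 hrp
  have hs : 0 < r / q := by positivity
  have hs1 : r / q ≤ 1 := (div_le_one hq).2 (by linarith)
  have he : 0 < r / (p - r) := by positivity
  have hρ : 0 < p * r / (p - r) := by positivity
  obtain ⟨K₁, hK₁, hdy⟩ := lintegral_rpow_le_of_dyadic hs
  obtain ⟨K₂, hK₂, hdy1⟩ := lintegral_rpow_le_of_dyadic one_pos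
  obtain ⟨K₃, hK₃, hC2⟩ := level_C2_le hp hq hr hrp
  obtain ⟨K₄, hK₄, hmin⟩ := level_blkMin_le hp hq hr hrp
  set e := r / (p - r) with he'
  set ρ := p * r / (p - r) with hρ'
  have hexp : r * p / (q * (p - r)) = r / q * (1 + e) := by
    rw [he']
    field_simp
    ring
  have htop : (2 : ℝ≥0∞) ^ e ≠ ⊤ := ENNReal.rpow_ne_top_of_nonneg he.le (by simp)
  have hK₁e : K₁ ^ e ≠ ⊤ := ENNReal.rpow_ne_top_of_nonneg he.le hK₁
  refine ⟨K₃ + 2 ^ e * (2 * (2 ^ e * K₃) + K₁ ^ e * (K₂ * (K₃ + 2 * K₄))), by finiteness, ?_⟩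
  intro a b u v w X C hab hu hv hX hC
  have hXm : Measurable X := hX.anti.measurable
  have hC' : ∀ f, Measurable f →
      ∫⁻ τ in Ioi (0 : ℝ), seg (fun t : ℝ => seg f a t ^ q * u t) a (X τ) ^ (r / q) ≤
        C ^ r * seg (dens p v f) a b ^ (r / p) := by
    intro f hf
    rw [← hX.lhsIter_rpow hq hr, ← rhsNorm_rpow, ← ENNReal.mul_rpow_of_nonneg _ _ hr.le]
    exact ENNReal.rpow_le_rpow (hC f hf) hr.le
  have h2 := hC2 a b u v X C hu hv hX.anti hX.le_right hC'
  have hQ := hmin a b u v w X C hab hu hv hX hC'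
  have h2' : C2 a b p q r u v w ^ ρ ≤ K₃ * C ^ ρ := by
    rw [hρ', hX.C2_rpow hp hq hr hrp]
    exact h2
  rw [hexp] at h2
  refine ⟨h2'.trans (mul_le_mul' le_self_add le_rfl), ?_⟩
  have hSm : Measurable fun τ => wsup p u v a (r / q * (1 + e)) ρ (X τ) :=
    (wsup_mono p u v a _ (by positivity)).measurable.comp hXm
  have hofm : Measurable fun τ : ℝ => ENNReal.ofReal τ ^ e := ENNReal.measurable_ofReal.pow_const _
  have hVm : Measurable fun τ => Vp p v a (X τ) := (Vp_mono hp v a).measurable.comp hXm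
  set Q : ℝ → ℝ≥0∞ := fun τ =>
    Vp p v a (X (2 * τ)) ^ ρ * blkInt u X (r / q) τ ^ e * blkMin u X (r / q) τ with hQdef
  have hQm : Measurable Q := (((hVm.comp (measurable_const_mul 2)).pow_const _).mul
    ((blkInt_mono u X _).measurable.pow_const _)).mul (measurable_blkMin hu hXm _)
  set Z : ℝ → ℝ≥0∞ := fun τ => ENNReal.ofReal τ ^ e * wsup p u v a (r / q * (1 + e)) ρ (X τ) +
    Q (2⁻¹ * τ) with hZ
  have hZm : Measurable Z := (hofm.mul hSm).add (hQm.comp (measurable_const_mul _))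
  have htwo : ENNReal.ofReal (2⁻¹ : ℝ)⁻¹ = 2 := by simp
  have hIZ : ∫⁻ τ in Ioi (0 : ℝ), Z τ ≤ (K₃ + 2 * K₄) * C ^ ρ := by
    simp only [hZ]
    rw [lintegral_add_left (f := fun τ => ENNReal.ofReal τ ^ e *
      wsup p u v a (r / q * (1 + e)) ρ (X τ)) (hofm.mul hSm),
      setLIntegral_scale (by norm_num) Q, htwo, add_mul,
      mul_assoc]
    gcongr
  have hII : ∫⁻ τ in Ioi (0 : ℝ), blkInt u X (r / q) (2⁻¹ * τ) ^ e *
      wsup p u v a (r / q) ρ (X τ) ≤ K₂ * ((K₃ + 2 * K₄) * C ^ ρ) := by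
    have h := hdy1 (fun τ => blkInt u X (r / q) (2⁻¹ * τ) ^ e * wsup p u v a (r / q) ρ (X τ)) Z hZm
      fun τ hτ => hX.blkInt_rpow_mul_wsup_le hp hs hs1 he hρ u v (fun τ => by
        simp only [hZ, hQdef]
        rw [show 2 * (2⁻¹ * τ) = τ by ring]) hτ
    simp only [ENNReal.rpow_one] at h
    exact h.trans (mul_le_mul' le_rfl hIZ)
  have hI : ∫⁻ τ in Ioi (0 : ℝ), (seg u (X τ) (X (2⁻¹ * τ)) ^ (r / q) * ENNReal.ofReal τ) ^ e *
      wsup p u v a (r / q) ρ (X τ) ≤ 2 * (2 ^ e * (K₃ * C ^ ρ)) := by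
    calc _ ≤ ∫⁻ τ in Ioi (0 : ℝ), (fun σ => 2 ^ e * (ENNReal.ofReal σ ^ e *
          wsup p u v a (r / q * (1 + e)) ρ (X σ))) (2⁻¹ * τ) := by
          refine setLIntegral_mono' measurableSet_Ioi fun τ hτ => ?_
          have hτ0 : (0 : ℝ) < τ := hτ
          simp only
          rw [← mul_assoc, ← ENNReal.mul_rpow_of_nonneg _ _ he.le,
            show (2 : ℝ≥0∞) = ENNReal.ofReal 2 by simp, ← ENNReal.ofReal_mul two_pos.le,
            show 2 * (2⁻¹ * τ) = τ by ring, ENNReal.mul_rpow_of_nonneg _ _ he.le,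
            mul_comm _ (ENNReal.ofReal τ ^ e), mul_assoc]
          refine mul_le_mul' le_rfl ?_
          simp only [wsup, ENNReal.mul_iSup]
          refine iSup₂_le fun t ht => ?_
          have hXle : X τ ≤ X (2⁻¹ * τ) := hX.anti (by linarith)
          refine le_trans ?_ (le_iSup₂ (f := fun (t : ℝ) (_ : t ∈ io a (X (2⁻¹ * τ))) =>
            seg u t (X (2⁻¹ * τ)) ^ (r / q * (1 + e)) * Vp p v a t ^ ρ) t
            (io_subset_io le_rfl hXle ht))
          rw [mul_add, mul_one, ENNReal.rpow_add_of_nonneg _ _ hs.le (by positivity),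
            ENNReal.rpow_mul _ _ e, ← mul_assoc, mul_comm ((_ ^ (r / q)) ^ e)]
          gcongr
          · exact seg_mono_set u le_rfl hXle
          · exact seg_mono_set u ht.2.le le_rfl
      _ = 2 * ∫⁻ τ in Ioi (0 : ℝ), 2 ^ e * (ENNReal.ofReal τ ^ e *
          wsup p u v a (r / q * (1 + e)) ρ (X τ)) := by
          have h := setLIntegral_scale (c := 2⁻¹) (by norm_num) fun σ =>
            2 ^ e * (ENNReal.ofReal σ ^ e * wsup p u v a (r / q * (1 + e)) ρ (X σ))
          rw [htwo] at h
          exact h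
      _ ≤ _ := by
          rw [lintegral_const_mul' _ _ htop]
          gcongr
  rw [hρ', hX.C3_rpow hp hq hr hrp]
  calc ∫⁻ τ in Ioi (0 : ℝ), (∫⁻ σ in Ioi (0 : ℝ), seg u (X τ) (X σ) ^ (r / q)) ^ e *
        wsup p u v a (r / q) ρ (X τ)
      ≤ ∫⁻ τ in Ioi (0 : ℝ), 2 ^ e * (
          (seg u (X τ) (X (2⁻¹ * τ)) ^ (r / q) * ENNReal.ofReal τ) ^ e *
            wsup p u v a (r / q) ρ (X τ) +
          K₁ ^ e * (blkInt u X (r / q) (2⁻¹ * τ) ^ e * wsup p u v a (r / q) ρ (X τ))) := by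
        refine lintegral_mono fun τ => ?_
        calc _ ≤ (2 ^ e * ((seg u (X τ) (X (2⁻¹ * τ)) ^ (r / q) * ENNReal.ofReal τ) ^ e +
              (K₁ * blkInt u X (r / q) (2⁻¹ * τ)) ^ e)) * wsup p u v a (r / q) ρ (X τ) := by
              refine mul_le_mul' ?_ le_rfl
              refine le_trans (ENNReal.rpow_le_rpow ?_ he.le) (ennreal_add_rpow_le _ _ he.le)
              exact (hX.lintegral_seg_le_add hs hs1 u (2⁻¹ * τ) τ).trans
                (add_le_add le_rfl (hX.lintegral_seg_rpow_le hs hdy hu _))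
          _ = _ := by
              rw [ENNReal.mul_rpow_of_nonneg K₁ _ he.le]
              ring
    _ ≤ 2 ^ e * (2 * (2 ^ e * (K₃ * C ^ ρ)) + K₁ ^ e * (K₂ * ((K₃ + 2 * K₄) * C ^ ρ))) := by
        rw [lintegral_const_mul' _ _ htop, lintegral_add_right, lintegral_const_mul' _ _ hK₁e]
        · gcongr
        · exact (((((blkInt_mono u X _).measurable.comp (measurable_const_mul _)).pow_const _)).mul
            ((wsup_mono p u v a _ hs.le).measurable.comp hXm)).const_mul _
    _ = 2 ^ e * (2 * (2 ^ e * K₃) + K₁ ^ e * (K₂ * (K₃ + 2 * K₄))) * C ^ ρ := by ring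
    _ ≤ _ := mul_le_mul' le_add_self le_rfl

lemma wsup_pos {p : ℝ} (hp : 1 ≤ p) {a b : EReal} {u v : ℝ → ℝ≥0∞} (hu : IsWeight a b u)
    (hv : IsWeight a b v) {α β : ℝ} (hα : 0 ≤ α) (hβ : 0 ≤ β) {x : EReal} (hax : a < x)
    (hxb : x ≤ b) : 0 < wsup p u v a α β x := by
  obtain ⟨t, hat, htx⟩ := EReal.lt_iff_exists_real_btwn.1 hax
  have hpos : 0 < seg u t x ^ α * Vp p v a t ^ β := by
    refine ENNReal.mul_pos ?_ ?_
    · exact (ENNReal.rpow_pos_of_nonneg (seg_pos hu.1 htx fun s hs =>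
        (hu.2 s (io_subset_io hat.le hxb hs)).1) hα).ne'
    · exact (ENNReal.rpow_pos_of_nonneg (Vp_pos hp hv hat (htx.le.trans hxb)) hβ).ne'
  exact hpos.trans_le (le_iSup₂ (f := fun (t : ℝ) (_ : t ∈ io a x) =>
    seg u t x ^ α * Vp p v a t ^ β) t ⟨hat, htx⟩)

lemma seg_ne_top_of_C2_lt_top {p q r : ℝ} (hp : 1 ≤ p) (hq : 0 < q) (hr : 0 < r) (hrp : r < p)
    {a b : EReal} {u v w : ℝ → ℝ≥0∞} (hu : IsWeight a b u) (hv : IsWeight a b v)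
    (hw : IsWeight a b w) (h2 : C2 a b p q r u v w < ⊤) (c : EReal) (hc : a < c) :
    seg w c b ≠ ⊤ := by
  intro htop
  have hp0 : 0 < p := by linarith
  have hpr : 0 < p - r := by linarith
  have hcb : c < b := by
    by_contra! hcb
    simp [seg_eq_zero hcb] at htop
  refine h2.ne ?_
  have hint : ∀ x ∈ io a c, (⊤ : ℝ≥0∞) ≤ (∫⁻ t in io x b, w t) ^ (r / (p - r)) * w x *
      essSup (fun t : ℝ =>
          (∫⁻ s in io t x, u s) ^ (r * p / (q * (p - r))) * Vp p v a t ^ (p * r / (p - r)))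
        (volume.restrict (io a x)) := by
    intro x hx
    have h1 : (∫⁻ t in io x b, w t) = ⊤ := top_le_iff.1 (htop ▸ seg_mono_set w hx.2.le le_rfl)
    have h3 := essSup_eq_wsup hp u v a (α := r * p / (q * (p - r))) (β := p * r / (p - r))
      (by positivity) (by positivity) (x : EReal)
    have h4 := wsup_pos hp hu hv (α := r * p / (q * (p - r))) (β := p * r / (p - r))
      (by positivity) (by positivity) hx.1 (hx.2.trans hcb).le
    rw [← h3] at h4
    rw [h1, ENNReal.top_rpow_of_pos (by positivity),
      ENNReal.top_mul (hw.2 x (io_subset_io le_rfl hcb.le hx)).1.ne']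
    exact (ENNReal.top_mul h4.ne').ge
  rw [C2, ENNReal.rpow_eq_top_iff_of_pos (by positivity), ← top_le_iff]
  calc (⊤ : ℝ≥0∞) = ∫⁻ _ in io a c, ⊤ := by
        rw [setLIntegral_const, ENNReal.top_mul (io_nonempty_pos hc).ne']
    _ ≤ _ := setLIntegral_mono' (measurableSet_io a c) hint
    _ ≤ _ := lintegral_mono_set (io_subset_io le_rfl hcb.le)

lemma seg_ne_top_of_admissible {p q r : ℝ} (hp : 1 ≤ p) (hq : 0 < q) (hr : 0 < r)
    {a b : EReal} {u v w : ℝ → ℝ≥0∞} {C : ℝ≥0∞} (hu : IsWeight a b u) (hv : IsWeight a b v)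
    (hw : Measurable w) (hCtop : C ≠ ⊤)
    (hC : ∀ f, Measurable f → lhsIter a b q r u w f ≤ C * rhsNorm a b p v f)
    (c : EReal) (hc : a < c) : seg w c b ≠ ⊤ := by
  intro htop
  have hp0 : 0 < p := by linarith
  have hcb : c < b := by
    by_contra! hcb
    simp [seg_eq_zero hcb] at htop
  obtain ⟨t, hat, htc⟩ := EReal.lt_iff_exists_real_btwn.1 hc
  have hV := (Vp_pos hp hv hat (htc.le.trans hcb.le)).trans_le
    (Vp_le_iSup hp hv (htc.le.trans hcb.le))
  simp only [lt_iSup_iff] at hV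
  obtain ⟨f, ⟨hfm, hf1⟩, hfpos⟩ := hV
  have hut : 0 < seg u t c :=
    seg_pos hu.1 htc fun s hs => (hu.2 s (io_subset_io hat.le hcb.le hs)).1
  set A : ℝ≥0∞ := (seg f a t ^ q * seg u t c) ^ (r / q) with hA
  have hApos : 0 < A := ENNReal.rpow_pos_of_nonneg
    (ENNReal.mul_pos (ENNReal.rpow_pos_of_nonneg hfpos hq.le).ne' hut.ne') (by positivity)
  have hlhs : lhsIter a b q r u w f = ⊤ := by
    rw [lhsIter, ENNReal.rpow_eq_top_iff_of_pos (by positivity), ← top_le_iff]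
    calc (⊤ : ℝ≥0∞) = A * seg w c b := by rw [htop, ENNReal.mul_top hApos.ne']
      _ = ∫⁻ x in io c b, A * w x := (lintegral_const_mul _ hw).symm
      _ ≤ ∫⁻ x in io c b,
          (∫⁻ t in io a x, (∫⁻ s in io a t, f s) ^ q * u t) ^ (r / q) * w x := by
          refine setLIntegral_mono' (measurableSet_io c b) fun x hx => mul_le_mul' ?_ le_rfl
          refine ENNReal.rpow_le_rpow ?_ (by positivity)
          exact (mul_le_mul' le_rfl (seg_mono_set u le_rfl hx.1.le)).trans
            (seg_rpow_mul_seg_le hq hu.1 hat.le)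
      _ ≤ _ := lintegral_mono_set (io_subset_io hc.le le_rfl)
  have hrhs : rhsNorm a b p v f ≤ 1 := by
    have h := rhsNorm_rpow p a b v f 1
    rw [ENNReal.rpow_one] at h
    rw [h]
    exact ENNReal.rpow_le_one hf1 (by positivity)
  have h := (hC f hfm).trans (mul_le_mul' le_rfl hrhs)
  rw [hlhs, mul_one, top_le_iff] at h
  exact hCtop h

lemma rpow_inv_le_of_rpow_le_mul {x K C : ℝ≥0∞} {s : ℝ} (hs : 0 < s) (h : x ^ s ≤ K * C ^ s) :
    x ≤ K ^ s⁻¹ * C := by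
  have := ENNReal.rpow_le_rpow h (inv_nonneg.2 hs.le)
  rwa [ENNReal.mul_rpow_of_nonneg _ _ (inv_nonneg.2 hs.le), ENNReal.rpow_rpow_inv hs.ne',
    ENNReal.rpow_rpow_inv hs.ne'] at this

/-- Sufficiency: the constants `C₂` and `C₃` control the inequality. -/
lemma lhsIter_le_mul_rhsNorm {p q r : ℝ} (hp : 1 ≤ p) (hr : 0 < r) (hrp : r < p) (hpq : p ≤ q) :
    ∃ K : ℝ≥0∞, K ≠ ⊤ ∧ ∀ (a b : EReal) (u v w : ℝ → ℝ≥0∞), a < b →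
      IsWeight a b u → IsWeight a b v → IsWeight a b w → C2 a b p q r u v w < ⊤ →
      ∀ f, Measurable f → lhsIter a b q r u w f ≤
        K * (C2 a b p q r u v w + C3 a b p q r u v w) * rhsNorm a b p v f := by
  have hq : 0 < q := by linarith
  obtain ⟨K, hK, hsuf⟩ := level_sufficiency hp hr hrp hpq
  refine ⟨K ^ r⁻¹, ENNReal.rpow_ne_top_of_nonneg (by positivity) hK, ?_⟩
  intro a b u v w hab hu hv hw h2 f hf
  obtain ⟨X, hX⟩ := exists_isLevel hab hw.1 (seg_ne_top_of_C2_lt_top hp hq hr hrp hu hv hw h2)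
  have h := hsuf a b u v w f X hab.le hu hv hX hf
  rw [← rhsNorm_rpow, ← ENNReal.mul_rpow_of_nonneg _ _ hr.le] at h
  rw [mul_assoc]
  exact rpow_inv_le_of_rpow_le_mul hr h

/-- Necessity: every admissible constant dominates `C₂` and `C₃`. -/
lemma C2_add_C3_le_mul {p q r : ℝ} (hp : 1 ≤ p) (hr : 0 < r) (hrp : r < p) (hpq : p ≤ q) :
    ∃ K : ℝ≥0∞, K ≠ ⊤ ∧ ∀ (a b : EReal) (u v w : ℝ → ℝ≥0∞) (C : ℝ≥0∞), a < b →
      IsWeight a b u → IsWeight a b v → IsWeight a b w → C ≠ ⊤ →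
      (∀ f, Measurable f → lhsIter a b q r u w f ≤ C * rhsNorm a b p v f) →
      C2 a b p q r u v w + C3 a b p q r u v w ≤ K * C := by
  have hp0 : 0 < p := by linarith
  have hq : 0 < q := by linarith
  have hpr : 0 < p - r := by linarith
  have hρ : 0 < p * r / (p - r) := by positivity
  obtain ⟨K, hK, hnec⟩ := level_necessity hp hr hrp hpq
  refine ⟨2 * K ^ (p * r / (p - r))⁻¹,
    ENNReal.mul_ne_top (by simp) (ENNReal.rpow_ne_top_of_nonneg (by positivity) hK), ?_⟩
  intro a b u v w C hab hu hv hw hCtop hC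
  obtain ⟨X, hX⟩ := exists_isLevel hab hw.1 (seg_ne_top_of_admissible hp hq hr hu hv hw.1 hCtop hC)
  obtain ⟨h2, h3⟩ := hnec a b u v w X C hab.le hu.1 hv hX hC
  rw [mul_assoc, two_mul]
  exact add_le_add (rpow_inv_le_of_rpow_le_mul hρ h2) (rpow_inv_le_of_rpow_le_mul hρ h3)

theorem iterated_hardy_case_ii (p q r : ℝ) (hp : 1 ≤ p) (hq : 0 < q) (hr : 0 < r)
    (hrp : r < p) (hpq : p ≤ q) :
    ∃ c₁ c₂ : ℝ≥0∞, 0 < c₁ ∧ c₂ < ⊤ ∧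
      ∀ (a b : EReal), a < b → ∀ u v w : ℝ → ℝ≥0∞,
        IsWeight a b u → IsWeight a b v → IsWeight a b w →
        ((∃ C : ℝ≥0∞, 0 < C ∧ C < ⊤ ∧ ∀ f : ℝ → ℝ≥0∞, Measurable f →
            lhsIter a b q r u w f ≤ C * rhsNorm a b p v f) ↔
          (C2 a b p q r u v w < ⊤ ∧ C3 a b p q r u v w < ⊤)) ∧
        c₁ * (C2 a b p q r u v w + C3 a b p q r u v w) ≤ bestIter a b p q r u v w ∧
        bestIter a b p q r u v w ≤ c₂ * (C2 a b p q r u v w + C3 a b p q r u v w) := by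
  obtain ⟨K₁, hK₁, hsuf⟩ := lhsIter_le_mul_rhsNorm hp hr hrp hpq
  obtain ⟨K₂, hK₂, hnec⟩ := C2_add_C3_le_mul hp hr hrp hpq
  refine ⟨(K₂ + 1)⁻¹, K₁ + 1, ENNReal.inv_pos.2 (by finiteness), by finiteness, ?_⟩
  intro a b hab u v w hu hv hw
  refine ⟨⟨?_, ?_⟩, ?_, ?_⟩
  · rintro ⟨C, -, hCtop, hC⟩
    have h := (hnec a b u v w C hab hu hv hw hCtop.ne hC).trans_lt
      (ENNReal.mul_lt_top hK₂.lt_top hCtop)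
    exact ENNReal.add_lt_top.1 h
  · rintro ⟨h2, h3⟩
    refine ⟨K₁ * (C2 a b p q r u v w + C3 a b p q r u v w) + 1, by simp, by finiteness,
      fun f hf => (hsuf a b u v w hab hu hv hw h2 f hf).trans (mul_le_mul' le_self_add le_rfl)⟩
  · refine le_sInf fun C hC => ?_
    rcases eq_or_ne C ⊤ with rfl | hCtop
    · exact le_top
    · rw [mul_comm, ← div_eq_mul_inv]
      refine ENNReal.div_le_of_le_mul ?_
      rw [mul_comm]
      exact (hnec a b u v w C hab hu hv hw hCtop hC).trans (mul_le_mul' le_self_add le_rfl)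
  · rcases eq_or_ne (C2 a b p q r u v w + C3 a b p q r u v w) ⊤ with htop | htop
    · rw [htop, ENNReal.mul_top (by simp)]
      exact le_top
    · refine sInf_le fun f hf => ?_
      refine (hsuf a b u v w hab hu hv hw (ENNReal.add_ne_top.1 htop).1.lt_top f hf).trans ?_
      exact mul_le_mul' (mul_le_mul' le_self_add le_rfl) le_rfl
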